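/- Let n ≥ 2. There exist positive constants C₄ ≤ 1, h_c ≤ 1/5, C₅ and C₆ depending only on n such that the following holds. Let L > 0 and let u be strictly convex and C² on the closure of the section S := S(u, L) = {z : u(z) < u(0) + L}, with B₁(ξ) ⊆ S ⊆ B_n(ξ) for some ξ ∈ ℝⁿ, D u(0) = 0, u = 0 on ∂S, and (det D²u)^{1/n} = g in S with g(0) = 1 and δ := sup_S |g − 1| ≤ n^{−2}/5. Let w be convex, smooth in S and continuous on S̄, with det D²w = 1 in S and w = 0 on ∂S. Suppose 0 < h ≤ h_c and δ ≤ min{C₄ h, n^{−2}/5}, let T x := h^{−1/2}(D²w(0))^{1/2} x, and let w♯ be convex, smooth in S(u,h) and continuous up to its boundary, with det D²w♯ = 1 in S(u, h) and w♯ = 0 on ∂S(u, h). Then |D²(F_T w♯)(0) − I| ≤ C₅ δ/h and sup_{B_{1/4}} |D³(F_T w♯ − F_T w)| ≤ C₆ δ/h. -/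

import Mathlib

open scoped RealInnerProductSpace
noncomputable section

abbrev Euc (n : ℕ) := EuclideanSpace ℝ (Fin n)

/-- Hessian matrix of `u` at `x`. -/
def hessianMatrix {n : ℕ} (u : Euc n → ℝ) (x : Euc n) : Matrix (Fin n) (Fin n) ℝ :=
  Matrix.of fun i j =>
    iteratedFDeriv ℝ 2 u x ![EuclideanSpace.single i 1, EuclideanSpace.single j 1]

/-- Determinant of the Hessian of `u` at `x`. -/
def hessDet {n : ℕ} (u : Euc n → ℝ) (x : Euc n) : ℝ := (hessianMatrix u x).det

/-- Operator norm of a matrix induced by the Euclidean vector norm. -/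
def matOpNorm {n : ℕ} (A : Matrix (Fin n) (Fin n) ℝ) : ℝ :=
  ‖(Matrix.toEuclideanCLM (𝕜 := ℝ) A : Euc n →L[ℝ] Euc n)‖

/-- The action `(F_T u)(y) = (det T)^{2/n} u(T⁻¹ y)` of an invertible linear map
(given by the matrix `A`) on functions. -/
def affFT {n : ℕ} (A : Matrix (Fin n) (Fin n) ℝ) (u : Euc n → ℝ) (y : Euc n) : ℝ :=
  A.det ^ ((2 : ℝ) / n) * u (Matrix.toEuclideanLin A⁻¹ y)

section
namespace MA
open Filter Topology

/-- smooth at a point -/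
def Sm {n : ℕ} (f : Euc n → ℝ) (x : Euc n) : Prop :=
  ∀ᶠ y in 𝓝 x, ContDiffAt ℝ ((⊤ : ℕ∞) : WithTop ℕ∞) f y

/-- directional derivative -/
def dd {n : ℕ} (b : Euc n) (f : Euc n → ℝ) : Euc n → ℝ := fun x => fderiv ℝ f x b

variable {n : ℕ}

theorem Sm.nat {f : Euc n → ℝ} {x : Euc n} (h : Sm f x) (k : ℕ) : ContDiffAt ℝ (k : WithTop ℕ∞) f x :=
  h.self_of_nhds.of_le (by exact_mod_cast le_top)

theorem Sm.two {f : Euc n → ℝ} {x : Euc n} (h : Sm f x) : ContDiffAt ℝ 2 f x := h.nat 2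

theorem Sm.diff {f : Euc n → ℝ} {x : Euc n} (h : Sm f x) : DifferentiableAt ℝ f x :=
  h.self_of_nhds.differentiableAt (by simp)

theorem Sm.ev {f : Euc n → ℝ} {x : Euc n} (h : Sm f x) : ∀ᶠ y in 𝓝 x, Sm f y :=
  eventually_eventually_nhds.2 h

theorem Sm.dd {f : Euc n → ℝ} {x : Euc n} (h : Sm f x) (b : Euc n) : Sm (dd b f) x := by
  refine h.mono fun y h => ?_
  have h1 : ContDiffAt ℝ ((⊤ : ℕ∞) : WithTop ℕ∞) (fderiv ℝ f) y := h.fderiv_right (by simp)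
  exact h1.clm_apply contDiffAt_const

theorem c2_dd {f : Euc n → ℝ} {x : Euc n} (h : ContDiffAt ℝ 2 f x) (b : Euc n) :
    ContDiffAt ℝ 1 (dd b f) x := by
  have h1 : ContDiffAt ℝ 1 (fderiv ℝ f) x := h.fderiv_right (by norm_num)
  exact h1.clm_apply contDiffAt_const

theorem c2_ev {f : Euc n → ℝ} {x : Euc n} (h : ContDiffAt ℝ 2 f x) :
    ∀ᶠ y in 𝓝 x, DifferentiableAt ℝ f y := by
  filter_upwards [h.eventually (by decide)] with y hy using hy.differentiableAt (by norm_num)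

theorem dd_congr {f g : Euc n → ℝ} {x : Euc n} (h : f =ᶠ[𝓝 x] g) (b : Euc n) :
    dd b f =ᶠ[𝓝 x] dd b g := by
  filter_upwards [h.eventuallyEq_nhds] with y hy
  simp only [dd, hy.fderiv_eq]

theorem dd_congr_at {f g : Euc n → ℝ} {x : Euc n} (h : f =ᶠ[𝓝 x] g) (b : Euc n) :
    dd b f x = dd b g x := (dd_congr h b).self_of_nhds

theorem dd_add {f g : Euc n → ℝ} {x : Euc n} (b : Euc n) (hf : DifferentiableAt ℝ f x)
    (hg : DifferentiableAt ℝ g x) : dd b (fun y => f y + g y) x = dd b f x + dd b g x := by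
  simp only [dd]; rw [fderiv_fun_add hf hg]; rfl

theorem dd_sub {f g : Euc n → ℝ} {x : Euc n} (b : Euc n) (hf : DifferentiableAt ℝ f x)
    (hg : DifferentiableAt ℝ g x) : dd b (fun y => f y - g y) x = dd b f x - dd b g x := by
  simp only [dd]; rw [fderiv_fun_sub hf hg]; rfl

theorem dd_mul {f g : Euc n → ℝ} {x : Euc n} (b : Euc n) (hf : DifferentiableAt ℝ f x)
    (hg : DifferentiableAt ℝ g x) :
    dd b (fun y => f y * g y) x = dd b f x * g x + f x * dd b g x := by
  simp only [dd]; rw [fderiv_fun_mul hf hg]; simp; ring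

theorem dd_const (c : ℝ) (b x : Euc n) : dd b (fun _ => c) x = 0 := by
  simp [dd]

theorem dd_const_mul {f : Euc n → ℝ} {x : Euc n} (b : Euc n) (c : ℝ) (hf : DifferentiableAt ℝ f x) :
    dd b (fun y => c * f y) x = c * dd b f x := by
  simp only [dd]; rw [fderiv_const_mul hf]; simp

theorem dd_sum {ι : Type*} (s : Finset ι) {f : ι → Euc n → ℝ} {x : Euc n} (b : Euc n)
    (hf : ∀ i ∈ s, DifferentiableAt ℝ (f i) x) :
    dd b (fun y => ∑ i ∈ s, f i y) x = ∑ i ∈ s, dd b (f i) x := by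
  simp only [dd]; rw [fderiv_fun_sum hf]; simp

theorem dd_vadd (b c : Euc n) (f : Euc n → ℝ) (x : Euc n) : dd (b + c) f x = dd b f x + dd c f x := by
  simp [dd]

theorem dd_vsmul (r : ℝ) (b : Euc n) (f : Euc n → ℝ) (x : Euc n) : dd (r • b) f x = r * dd b f x := by
  simp [dd]

theorem dd_vsum {ι : Type*} (s : Finset ι) (r : ι → ℝ) (b : ι → Euc n) (f : Euc n → ℝ) (x : Euc n) :
    dd (∑ i ∈ s, r i • b i) f x = ∑ i ∈ s, r i * dd (b i) f x := by
  simp [dd]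

theorem dd2_eq {f : Euc n → ℝ} {x : Euc n} (h : ContDiffAt ℝ 2 f x) (b c : Euc n) :
    dd b (dd c f) x = fderiv ℝ (fderiv ℝ f) x b c := by
  have h1 : DifferentiableAt ℝ (fderiv ℝ f) x :=
    (h.fderiv_right (m := 1) (by norm_num)).differentiableAt (by norm_num)
  have h2 := h1.hasFDerivAt.clm_apply (hasFDerivAt_const c x)
  have h3 : dd c f = fun y => fderiv ℝ f y c := rfl
  rw [dd, h3, h2.fderiv]
  simp

theorem dd_comm2 {f : Euc n → ℝ} {x : Euc n} (h : ContDiffAt ℝ 2 f x) (b c : Euc n) :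
    dd b (dd c f) x = dd c (dd b f) x := by
  rw [dd2_eq h, dd2_eq h]
  exact h.isSymmSndFDerivAt (by simp) b c

theorem dd_comm {f : Euc n → ℝ} {x : Euc n} (h : Sm f x) (b c : Euc n) :
    dd b (dd c f) x = dd c (dd b f) x := dd_comm2 h.two b c

theorem dd_comm_ev {f : Euc n → ℝ} {x : Euc n} (h : Sm f x) (b c : Euc n) :
    dd b (dd c f) =ᶠ[𝓝 x] dd c (dd b f) := by
  filter_upwards [h.two.eventually (by decide)] with y hy using dd_comm2 hy b c

theorem dd2_mul {f g : Euc n → ℝ} {x : Euc n} (b : Euc n) (hf : ContDiffAt ℝ 2 f x)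
    (hg : ContDiffAt ℝ 2 g x) :
    dd b (dd b (fun y => f y * g y)) x =
      dd b (dd b f) x * g x + 2 * (dd b f x * dd b g x) + f x * dd b (dd b g) x := by
  have h1 : dd b (fun y => f y * g y) =ᶠ[𝓝 x] fun y => dd b f y * g y + f y * dd b g y := by
    filter_upwards [c2_ev hf, c2_ev hg] with y h1 h2 using dd_mul b h1 h2
  have d1 := (c2_dd hf b).differentiableAt (by norm_num)
  have d2 := (c2_dd hg b).differentiableAt (by norm_num)
  have e1 := hf.differentiableAt (by norm_num)
  have e2 := hg.differentiableAt (by norm_num)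
  rw [dd_congr_at h1, dd_add b (d1.fun_mul e2) (e1.fun_mul d2), dd_mul b d1 e2, dd_mul b e1 d2]
  ring

theorem dd2_add {f g : Euc n → ℝ} {x : Euc n} (b c : Euc n) (hf : ContDiffAt ℝ 2 f x)
    (hg : ContDiffAt ℝ 2 g x) :
    dd b (dd c (fun y => f y + g y)) x = dd b (dd c f) x + dd b (dd c g) x := by
  have h1 : dd c (fun y => f y + g y) =ᶠ[𝓝 x] fun y => dd c f y + dd c g y := by
    filter_upwards [c2_ev hf, c2_ev hg] with y h1 h2 using dd_add c h1 h2
  have d1 := (c2_dd hf c).differentiableAt (by norm_num)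
  have d2 := (c2_dd hg c).differentiableAt (by norm_num)
  rw [dd_congr_at h1, dd_add b d1 d2]

theorem dd2_sub {f g : Euc n → ℝ} {x : Euc n} (b c : Euc n) (hf : ContDiffAt ℝ 2 f x)
    (hg : ContDiffAt ℝ 2 g x) :
    dd b (dd c (fun y => f y - g y)) x = dd b (dd c f) x - dd b (dd c g) x := by
  have h1 : dd c (fun y => f y - g y) =ᶠ[𝓝 x] fun y => dd c f y - dd c g y := by
    filter_upwards [c2_ev hf, c2_ev hg] with y h1 h2 using dd_sub c h1 h2
  have d1 := (c2_dd hf c).differentiableAt (by norm_num)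
  have d2 := (c2_dd hg c).differentiableAt (by norm_num)
  rw [dd_congr_at h1, dd_sub b d1 d2]

theorem dd2_const_mul {f : Euc n → ℝ} {x : Euc n} (b c : Euc n) (r : ℝ) (hf : ContDiffAt ℝ 2 f x) :
    dd b (dd c (fun y => r * f y)) x = r * dd b (dd c f) x := by
  have h1 : dd c (fun y => r * f y) =ᶠ[𝓝 x] fun y => r * dd c f y := by
    filter_upwards [c2_ev hf] with y h1 using dd_const_mul c r h1
  have d1 := (c2_dd hf c).differentiableAt (by norm_num)
  rw [dd_congr_at h1, dd_const_mul b r d1]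

theorem dd2_sum {ι : Type*} (s : Finset ι) {f : ι → Euc n → ℝ} {x : Euc n} (b c : Euc n)
    (hf : ∀ i ∈ s, ContDiffAt ℝ 2 (f i) x) :
    dd b (dd c (fun y => ∑ i ∈ s, f i y)) x = ∑ i ∈ s, dd b (dd c (f i)) x := by
  have h0 : ∀ᶠ y in 𝓝 x, ∀ i ∈ s, DifferentiableAt ℝ (f i) y := by
    rw [Filter.eventually_all_finset]
    intro i hi; exact c2_ev (hf i hi)
  have h1 : dd c (fun y => ∑ i ∈ s, f i y) =ᶠ[𝓝 x] fun y => ∑ i ∈ s, dd c (f i) y := by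
    filter_upwards [h0] with y h1 using dd_sum s c h1
  rw [dd_congr_at h1, dd_sum s b]
  intro i hi
  exact (c2_dd (hf i hi) c).differentiableAt (by norm_num)

/-- derivative along a line -/
theorem line_hasDerivAt {f : Euc n → ℝ} {x b : Euc n} {t : ℝ} (h : DifferentiableAt ℝ f (x + t • b)) :
    HasDerivAt (fun s : ℝ => f (x + s • b)) (dd b f (x + t • b)) t := by
  have h1 : HasDerivAt (fun s : ℝ => x + s • b) b t := by
    simpa using ((hasDerivAt_id t).smul_const b).const_add x
  exact h.hasFDerivAt.comp_hasDerivAt t h1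

theorem line_tendsto (x b : Euc n) : Tendsto (fun s : ℝ => x + s • b) (𝓝 0) (𝓝 x) := by
  have : ContinuousAt (fun s : ℝ => x + s • b) 0 := by fun_prop
  simpa [ContinuousAt] using this

/-- one-variable second derivative test at a maximum -/
theorem max_test {f f' : ℝ → ℝ} {m : ℝ} (h1 : ∀ᶠ t in 𝓝 (0:ℝ), HasDerivAt f (f' t) t)
    (h2 : HasDerivAt f' m 0) (hm : IsLocalMax f 0) : f' 0 = 0 ∧ m ≤ 0 := by
  have h0 : HasDerivAt f (f' 0) 0 := h1.self_of_nhds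
  have hz : f' 0 = 0 := hm.hasDerivAt_eq_zero h0
  refine ⟨hz, ?_⟩
  by_contra hpos
  push Not at hpos
  have e1 : deriv f =ᶠ[𝓝 0] f' := by
    filter_upwards [h1] with t ht using ht.deriv
  have e2 : deriv (deriv f) 0 = m := by rw [e1.deriv_eq, h2.deriv]
  have hmin : IsLocalMin f 0 :=
    isLocalMin_of_deriv_deriv_pos (by rw [e2]; exact hpos) (by rw [h0.deriv, hz]) h0.continuousAt
  have hc : f =ᶠ[𝓝 0] fun _ => f 0 := by
    filter_upwards [hm, hmin] with t h1 h2 using le_antisymm h1 h2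
  have : deriv (deriv f) 0 = 0 := by
    have h3 : deriv f =ᶠ[𝓝 0] fun _ => 0 := by
      filter_upwards [hc.eventuallyEq_nhds] with t ht
      rw [ht.deriv_eq]; simp
    rw [h3.deriv_eq]; simp
  linarith

theorem max_dd {f : Euc n → ℝ} {x : Euc n} (h : ContDiffAt ℝ 2 f x) (hm : IsLocalMax f x) (b : Euc n) :
    dd b f x = 0 ∧ dd b (dd b f) x ≤ 0 := by
  have h1 : ∀ᶠ t in 𝓝 (0:ℝ), HasDerivAt (fun s : ℝ => f (x + s • b)) (dd b f (x + t • b)) t := by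
    filter_upwards [(line_tendsto x b).eventually (c2_ev h)] with t ht using line_hasDerivAt ht
  have hd := (c2_dd h b).differentiableAt (by norm_num)
  have h2 : HasDerivAt (fun s : ℝ => dd b f (x + s • b)) (dd b (dd b f) x) 0 := by
    have := line_hasDerivAt (f := dd b f) (x := x) (b := b) (t := 0) (by simpa using hd)
    simpa using this
  have h3 : IsLocalMax (fun s : ℝ => f (x + s • b)) 0 := by
    have := (line_tendsto x b).eventually hm
    simpa [IsLocalMax, IsMaxFilter] using this
  simpa using max_test h1 h2 h3

end MA
end

section
namespace MA
open Filter Topology Matrix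

variable {n : ℕ}

abbrev Mat (n : ℕ) := Matrix (Fin n) (Fin n) ℝ

/-- entrywise derivative of a matrix function -/
def EHD (M : ℝ → Mat n) (M' : Mat n) (t : ℝ) : Prop :=
  ∀ i j, HasDerivAt (fun s => M s i j) (M' i j) t

theorem EHD.mul {M N : ℝ → Mat n} {M' N' : Mat n} {t : ℝ} (hM : EHD M M' t) (hN : EHD N N' t) :
    EHD (fun s => M s * N s) (M' * N t + M t * N') t := by
  intro i j
  simp only [Matrix.mul_apply, Matrix.add_apply, ← Finset.sum_add_distrib]
  exact HasDerivAt.fun_sum fun k _ => (hM i k).mul (hN k j)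

theorem EHD.add {M N : ℝ → Mat n} {M' N' : Mat n} {t : ℝ} (hM : EHD M M' t) (hN : EHD N N' t) :
    EHD (fun s => M s + N s) (M' + N') t := by
  intro i j
  exact (hM i j).add (hN i j)

theorem EHD.trace {M : ℝ → Mat n} {M' : Mat n} {t : ℝ} (hM : EHD M M' t) :
    HasDerivAt (fun s => (M s).trace) M'.trace t := by
  simp only [Matrix.trace, Matrix.diag]
  exact HasDerivAt.fun_sum fun k _ => hM k k

theorem EHD.det {M : ℝ → Mat n} {M' : Mat n} {t : ℝ} (hM : EHD M M' t) :
    HasDerivAt (fun s => (M s).det) ((M t).adjugate * M').trace t := by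
  have h1 : HasDerivAt (fun s => (M s).det)
      (∑ σ : Equiv.Perm (Fin n), ((Equiv.Perm.sign σ : ℤ) : ℝ) *
        ∑ i, (∏ j ∈ Finset.univ.erase i, M t (σ j) j) * M' (σ i) i) t := by
    simp only [Matrix.det_apply']
    refine HasDerivAt.fun_sum fun σ _ => HasDerivAt.const_mul _ ?_
    have := HasDerivAt.fun_finsetProd (u := Finset.univ) (f := fun i s => M s (σ i) i)
      (f' := fun i => M' (σ i) i) (x := t) (fun i _ => hM (σ i) i)
    simpa [smul_eq_mul] using this
  convert h1 using 1
  have h2 : ∀ i, ((M t).adjugate * M') i i = ((M t).updateCol i (fun k => M' k i)).det := by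
    intro i
    rw [← Matrix.cramer_apply, Matrix.cramer_eq_adjugate_mulVec]
    rfl
  simp only [Matrix.trace, Matrix.diag, h2, Matrix.det_apply', Finset.mul_sum]
  rw [Finset.sum_comm]
  refine Finset.sum_congr rfl fun σ _ => Finset.sum_congr rfl fun i _ => ?_
  congr 1
  rw [← Finset.prod_erase_mul _ _ (Finset.mem_univ i)]
  congr 1
  · refine Finset.prod_congr rfl fun j hj => ?_
    rw [Matrix.updateCol_ne (Finset.ne_of_mem_erase hj)]
  · simp

theorem EHD.adj {M : ℝ → Mat n} {M' : Mat n} {t : ℝ} (hM : EHD M M' t) :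
    ∃ N', EHD (fun s => (M s).adjugate) N' t := by
  have : ∀ i j, ∃ d, HasDerivAt (fun s => (M s).adjugate i j) d t := by
    intro i j
    simp only [Matrix.adjugate_apply]
    refine ⟨_, EHD.det (M := fun s => (M s).updateRow j (Pi.single i 1))
      (M' := Matrix.of fun a b => if a = j then 0 else M' a b) ?_⟩
    intro a b
    by_cases h : a = j
    · subst h; simp [hasDerivAt_const]
    · simpa [Matrix.updateRow_ne h, h] using hM a b
  choose d hd using this
  exact ⟨Matrix.of d, fun i j => by simpa using hd i j⟩

theorem EHD.inv {M : ℝ → Mat n} {M' : Mat n} {t : ℝ} (hM : EHD M M' t)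
    (hdet : ∀ᶠ s in 𝓝 t, (M s).det = 1) :
    EHD (fun s => (M s).adjugate) (-((M t).adjugate * M' * (M t).adjugate)) t := by
  obtain ⟨N', hN⟩ := hM.adj
  have h1 := hN.mul hM
  have h2 : N' * M t + (M t).adjugate * M' = 0 := by
    ext i j
    have h3 : (fun s => ((M s).adjugate * M s) i j) =ᶠ[𝓝 t] fun _ => (1 : Mat n) i j := by
      filter_upwards [hdet] with s hs
      rw [Matrix.adjugate_mul, hs, one_smul]
    exact ((h1 i j).congr_of_eventuallyEq h3.symm).unique (hasDerivAt_const t _)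
  have h4 : M t * (M t).adjugate = 1 := by
    rw [Matrix.mul_adjugate, hdet.self_of_nhds, one_smul]
  have h5 : N' = -((M t).adjugate * M' * (M t).adjugate) := by
    calc N' = N' * (M t * (M t).adjugate) := by rw [h4, mul_one]
      _ = (N' * M t) * (M t).adjugate := by rw [Matrix.mul_assoc]
      _ = _ := by rw [eq_neg_of_add_eq_zero_left h2, Matrix.neg_mul]
  rw [← h5]; exact hN

theorem jac1 {M M1 : ℝ → Mat n} (h1 : ∀ᶠ t in 𝓝 (0:ℝ), EHD M (M1 t) t)
    (hdet : ∀ᶠ s in 𝓝 (0:ℝ), (M s).det = 1) :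
    ∀ᶠ s in 𝓝 (0:ℝ), ((M s).adjugate * M1 s).trace = 0 := by
  filter_upwards [h1, hdet.eventually_nhds] with t ht hd
  have h2 : (fun s => (M s).det) =ᶠ[𝓝 t] fun _ => 1 := hd
  exact (ht.det.congr_of_eventuallyEq h2.symm).unique (hasDerivAt_const t _)

theorem jac2 {M M1 M2 : ℝ → Mat n} (h1 : ∀ᶠ t in 𝓝 (0:ℝ), EHD M (M1 t) t)
    (h2 : ∀ᶠ t in 𝓝 (0:ℝ), EHD M1 (M2 t) t)
    (hdet : ∀ᶠ s in 𝓝 (0:ℝ), (M s).det = 1) :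
    ∀ᶠ s in 𝓝 (0:ℝ), ((M s).adjugate * M2 s).trace =
      ((M s).adjugate * M1 s * (M s).adjugate * M1 s).trace := by
  filter_upwards [h1, h2, hdet.eventually_nhds, (jac1 h1 hdet).eventually_nhds] with t ht ht2 hd hj
  have h3 := ((ht.inv hd).mul ht2).trace
  have h4 : (fun s => ((M s).adjugate * M1 s).trace) =ᶠ[𝓝 t] fun _ => 0 := hj
  have h5 := (h3.congr_of_eventuallyEq h4.symm).unique (hasDerivAt_const t _)
  rw [Matrix.trace_add, Matrix.neg_mul, Matrix.trace_neg] at h5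
  linarith

theorem jac3 {M M1 M2 : ℝ → Mat n} {M3 : Mat n} (h1 : ∀ᶠ t in 𝓝 (0:ℝ), EHD M (M1 t) t)
    (h2 : ∀ᶠ t in 𝓝 (0:ℝ), EHD M1 (M2 t) t) (h3 : EHD M2 M3 0)
    (hdet : ∀ᶠ s in 𝓝 (0:ℝ), (M s).det = 1) (h0 : M 0 = 1) :
    (M1 0).trace = 0 ∧ (M2 0).trace = (M1 0 * M1 0).trace ∧
    M3.trace = 3 * (M1 0 * M2 0).trace - 2 * (M1 0 * M1 0 * M1 0).trace := by
  have a0 : (M 0).adjugate = 1 := by rw [h0, Matrix.adjugate_one]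
  refine ⟨?_, ?_, ?_⟩
  · have := (jac1 h1 hdet).self_of_nhds
    simpa [a0] using this
  · have := (jac2 h1 h2 hdet).self_of_nhds
    simpa [a0] using this
  · have b1 := h1.self_of_nhds
    have b2 := h2.self_of_nhds
    have hN := b1.inv hdet
    have c1 := (hN.mul h3).trace
    have c2 := (((hN.mul b1 : _).mul (hN.mul b2 : _)) : _)
    have c3 := ((((hN.mul b2).mul hN).mul b2)).trace
    have c4 := ((((hN.mul b2).mul hN).mul b1)).trace
    have d := ((((hN.mul b2).mul hN).mul b2)).trace
    clear c2 c3 c4 d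
    have e := ((hN.mul b2).mul hN).mul b2
    have f : HasDerivAt (fun s => ((M s).adjugate * M1 s * (M s).adjugate * M1 s).trace) _ 0 :=
      (((hN.mul b2).mul hN).mul b2).trace
    have g : (fun s => ((M s).adjugate * M2 s).trace) =ᶠ[𝓝 0]
      fun s => ((M s).adjugate * M1 s * (M s).adjugate * M1 s).trace := jac2 h1 h2 hdet
    have k := (c1.congr_of_eventuallyEq g.symm).unique f
    simp only [a0, one_mul, mul_one, Matrix.neg_mul, Matrix.mul_neg, Matrix.add_mul, Matrix.mul_add,
      Matrix.trace_add, Matrix.trace_neg] at k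
    have t1 : (M2 0 * M1 0).trace = (M1 0 * M2 0).trace := Matrix.trace_mul_comm _ _
    rw [t1] at k
    linarith

end MA
end

section
namespace MA
open Filter Topology Matrix

variable {n : ℕ}

theorem symm_diag {N : Mat n} (hN : Nᵀ = N) :
    ∃ (U : Mat n) (d : Fin n → ℝ), Uᵀ * U = 1 ∧ U * Uᵀ = 1 ∧ Uᵀ * N * U = diagonal d := by
  have hH : N.IsHermitian := by
    rw [Matrix.IsHermitian, Matrix.conjTranspose_eq_transpose_of_trivial]; exact hN
  have h1 := hH.spectral_theorem
  rw [Unitary.conjStarAlgAut_apply] at h1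
  set U : Mat n := (hH.eigenvectorUnitary : Mat n) with hU
  have e1 : star U * U = 1 := Unitary.coe_star_mul_self _
  have e2 : U * star U = 1 := Unitary.coe_mul_star_self _
  have e3 : star U = Uᵀ := by
    rw [Matrix.star_eq_conjTranspose, Matrix.conjTranspose_eq_transpose_of_trivial]
  rw [e3] at e1 e2
  refine ⟨U, hH.eigenvalues, e1, e2, ?_⟩
  have h2 : N = U * diagonal hH.eigenvalues * Uᵀ := by
    rw [← e3]; exact h1
  calc Uᵀ * N * U = Uᵀ * (U * diagonal hH.eigenvalues * Uᵀ) * U := by rw [← h2]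
    _ = (Uᵀ * U) * diagonal hH.eigenvalues * (Uᵀ * U) := by simp only [Matrix.mul_assoc]
    _ = _ := by rw [e1]; simp

/-- bilinear form of a matrix -/
def qf (M : Mat n) (z z' : Euc n) : ℝ := ∑ i, ∑ j, z i * M i j * z' j

theorem qf_eq (M : Mat n) (z z' : Euc n) : qf M z z' = (z : Fin n → ℝ) ⬝ᵥ M *ᵥ (z' : Fin n → ℝ) := by
  simp only [qf, dotProduct, mulVec, Finset.mul_sum, mul_assoc]

theorem PSD_sym {M : Mat n} (h : M.PosSemidef) : Mᵀ = M := by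
  have := h.1
  rwa [Matrix.IsHermitian, Matrix.conjTranspose_eq_transpose_of_trivial] at this

theorem qf_nonneg {M : Mat n} (h : M.PosSemidef) (z : Euc n) : 0 ≤ qf M z z := by
  rw [qf_eq]; simpa using h.dotProduct_mulVec_nonneg (z : Fin n → ℝ)

theorem qf_pos {M : Mat n} (h : M.PosDef) {z : Euc n} (hz : z ≠ 0) : 0 < qf M z z := by
  rw [qf_eq]
  have : (z : Fin n → ℝ) ≠ 0 := by
    intro h0; apply hz; ext i; simpa using congrFun h0 i
  simpa using h.dotProduct_mulVec_pos this

theorem PSD_of_qf {M : Mat n} (hs : Mᵀ = M) (h : ∀ z : Euc n, 0 ≤ qf M z z) : M.PosSemidef := by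
  refine Matrix.PosSemidef.of_dotProduct_mulVec_nonneg ?_ fun x => ?_
  · rw [Matrix.IsHermitian, Matrix.conjTranspose_eq_transpose_of_trivial]; exact hs
  · have := h (WithLp.toLp 2 x)
    rw [qf_eq] at this
    simpa using this

theorem PD_of_PSD_det {M : Mat n} (h : M.PosSemidef) (hd : M.det ≠ 0) : M.PosDef := by
  rw [h.posDef_iff_isUnit, Matrix.isUnit_iff_isUnit_det]; exact isUnit_iff_ne_zero.2 hd

theorem qf_diag {U M : Mat n} (j k : Fin n) :
    (U * M * Uᵀ) j k = qf M (WithLp.toLp 2 (U j)) (WithLp.toLp 2 (U k)) := by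
  simp only [qf, Matrix.mul_apply, Matrix.transpose_apply, Finset.sum_mul]
  rw [Finset.sum_comm]

/-- the matrix whose rows are the vectors `b k` -/
def fm (b : Fin n → Euc n) : Mat n := Matrix.of fun k i => b k i

theorem fm_apply (M : Mat n) (b : Fin n → Euc n) (j k : Fin n) :
    (fm b * M * (fm b)ᵀ) j k = qf M (b j) (b k) := by
  simp only [qf, fm, Matrix.mul_apply, Matrix.transpose_apply, Finset.sum_mul, Matrix.of_apply]
  rw [Finset.sum_comm]

/-- orthonormal frame for `G` -/
def Frame (G : Mat n) (b : Fin n → Euc n) : Prop := fm b * G * (fm b)ᵀ = 1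

theorem exists_frame {G N : Mat n} (hG : G.PosDef) (hN : Nᵀ = N) :
    ∃ (b : Fin n → Euc n) (d : Fin n → ℝ), Frame G b ∧ fm b * N * (fm b)ᵀ = diagonal d := by
  obtain ⟨U, d, h1, h2, h3⟩ := symm_diag (PSD_sym hG.posSemidef)
  have hU : ∀ k, WithLp.toLp 2 (Uᵀ k) ≠ (0 : Euc n) := by
    intro k h0
    have h4 : ∀ i, U i k = 0 := fun i => by
      have := congrArg (fun v : Euc n => v i) h0
      simpa using this
    have h5 := congrFun (congrFun h1 k) k
    rw [Matrix.mul_apply] at h5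
    simp [h4] at h5
  have hd : ∀ k, 0 < d k := by
    intro k
    have h5 := congrFun (congrFun h3 k) k
    have h6 := qf_diag (U := Uᵀ) (M := G) k k
    rw [Matrix.transpose_transpose, h5, Matrix.diagonal_apply_eq] at h6
    rw [h6]; exact qf_pos hG (hU k)
  set S : Mat n := diagonal fun k => (Real.sqrt (d k))⁻¹ with hS
  have hS1 : S * diagonal d * S = 1 := by
    rw [hS, Matrix.diagonal_mul_diagonal, Matrix.diagonal_mul_diagonal, ← Matrix.diagonal_one]
    congr 1; ext k
    have := Real.mul_self_sqrt (hd k).le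
    have h0 : Real.sqrt (d k) ≠ 0 := (Real.sqrt_pos.2 (hd k)).ne'
    field_simp
    nlinarith [this]
  have hST : Sᵀ = S := by rw [hS, Matrix.diagonal_transpose]
  have hN' : (S * (Uᵀ * N * U) * S)ᵀ = S * (Uᵀ * N * U) * S := by
    simp only [Matrix.transpose_mul, hST, hN, Matrix.transpose_transpose, Matrix.mul_assoc]
  obtain ⟨V, e, k1, k2, k3⟩ := symm_diag hN'
  refine ⟨fun k => WithLp.toLp 2 ((Vᵀ * S * Uᵀ) k), e, ?_, ?_⟩
  · have hfm : fm (fun k => WithLp.toLp 2 ((Vᵀ * S * Uᵀ) k)) = Vᵀ * S * Uᵀ := by ext; rfl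
    rw [Frame, hfm]
    calc Vᵀ * S * Uᵀ * G * (Vᵀ * S * Uᵀ)ᵀ = Vᵀ * (S * (Uᵀ * G * U) * S) * V := by
          simp only [Matrix.transpose_mul, hST, Matrix.transpose_transpose, Matrix.mul_assoc]
      _ = 1 := by rw [h3, hS1, Matrix.mul_one, k1]
  · have hfm : fm (fun k => WithLp.toLp 2 ((Vᵀ * S * Uᵀ) k)) = Vᵀ * S * Uᵀ := by ext; rfl
    rw [hfm, ← k3]
    simp only [Matrix.transpose_mul, hST, Matrix.transpose_transpose, Matrix.mul_assoc]

theorem Frame.mul_right {G : Mat n} {b : Fin n → Euc n} (h : Frame G b) :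
    G * ((fm b)ᵀ * fm b) = 1 := by
  have h1 : fm b * (G * (fm b)ᵀ) = 1 := by rw [← Matrix.mul_assoc]; exact h
  have h2 : (G * (fm b)ᵀ) * fm b = 1 := _root_.mul_eq_one_comm.1 h1
  rw [← Matrix.mul_assoc]; exact h2

theorem Frame.mul_left {G : Mat n} {b : Fin n → Euc n} (h : Frame G b) :
    ((fm b)ᵀ * fm b) * G = 1 := _root_.mul_eq_one_comm.1 h.mul_right

theorem Frame.qf {G : Mat n} {b : Fin n → Euc n} (h : Frame G b) (j k : Fin n) :
    qf G (b j) (b k) = if j = k then 1 else 0 := by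
  rw [← fm_apply, h, Matrix.one_apply]

theorem Frame.det {G : Mat n} {b : Fin n → Euc n} (h : Frame G b) : (fm b).det ^ 2 * G.det = 1 := by
  have := congrArg Matrix.det h
  rw [Matrix.det_mul, Matrix.det_mul, Matrix.det_transpose, Matrix.det_one] at this
  rw [← this]; ring

theorem Frame.trace {G : Mat n} {b : Fin n → Euc n} (h : Frame G b) (hd : G.det = 1) (N : Mat n) :
    ∑ k, MA.qf N (b k) (b k) = (G.adjugate * N).trace := by
  have h1 : (fm b)ᵀ * fm b = G.adjugate := by
    calc (fm b)ᵀ * fm b = ((fm b)ᵀ * fm b) * (G * G.adjugate) := by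
          rw [Matrix.mul_adjugate, hd, one_smul, Matrix.mul_one]
      _ = _ := by rw [← Matrix.mul_assoc, h.mul_left, Matrix.one_mul]
  have h2 : ∑ k, MA.qf N (b k) (b k) = (fm b * N * (fm b)ᵀ).trace := by
    simp only [Matrix.trace, Matrix.diag, fm_apply]
  rw [h2, Matrix.trace_mul_comm, ← Matrix.mul_assoc, h1]

/-- AM-GM -/
theorem det_le_one {M : Mat n} (h : M.PosSemidef) (ht : M.trace ≤ n) : M.det ≤ 1 := by
  rcases Nat.eq_zero_or_pos n with h0 | hn
  · subst h0; simp
  have hH := h.1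
  rw [hH.det_eq_prod_eigenvalues]
  rw [hH.trace_eq_sum_eigenvalues] at ht
  simp only [RCLike.ofReal_real_eq_id, id] at *
  have hz := h.eigenvalues_nonneg
  have hn' : (0 : ℝ) < n := by exact_mod_cast hn
  have h1 := Real.geom_mean_le_arith_mean_weighted Finset.univ (fun _ : Fin n => (n : ℝ)⁻¹) hH.eigenvalues
    (fun i _ => by positivity) (by simp [hn'.ne']) (fun i _ => hz i)
  rw [← Finset.mul_sum] at h1
  have h2 : (n : ℝ)⁻¹ * ∑ i, hH.eigenvalues i ≤ 1 := by
    calc _ ≤ (n : ℝ)⁻¹ * n := by gcongr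
      _ = 1 := by field_simp
  rw [Real.finsetProd_rpow _ _ (fun i _ => hz i)] at h1
  by_contra hc
  push Not at hc
  have := Real.one_lt_rpow hc (show (0:ℝ) < (n:ℝ)⁻¹ by positivity)
  linarith

end MA
end

section
namespace MA
open Filter Topology Matrix

variable {n : ℕ}

/-- standard basis vector -/
def bas (i : Fin n) : Euc n := EuclideanSpace.single i 1

theorem bas_norm (i : Fin n) : ‖(bas i : Euc n)‖ = 1 := by simp [bas]

theorem bas_expand (z : Euc n) : z = ∑ i, z i • bas i := by
  ext j
  simp [bas, Finset.sum_apply, Pi.single_apply]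

theorem qf_bas (M : Mat n) (i j : Fin n) : qf M (bas i) (bas j) = M i j := by
  simp [qf, bas]

theorem hess_apply {w : Euc n → ℝ} {x : Euc n} (h : ContDiffAt ℝ 2 w x) (i j : Fin n) :
    hessianMatrix w x i j = dd (bas i) (dd (bas j) w) x := by
  rw [hessianMatrix, Matrix.of_apply, iteratedFDeriv_two_apply, dd2_eq h]
  rfl

theorem dd_qf {w : Euc n → ℝ} {x : Euc n} (h : ContDiffAt ℝ 2 w x) (z z' : Euc n) :
    dd z (dd z' w) x = qf (hessianMatrix w x) z z' := by
  rw [dd2_eq h]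
  conv_lhs => rw [bas_expand z, bas_expand z']
  simp only [map_sum, map_smul, _root_.sum_apply, _root_.smul_apply,
    smul_eq_mul, qf, hess_apply h, dd2_eq h]
  rw [Finset.sum_comm]
  refine Finset.sum_congr rfl fun i _ => ?_
  rw [Finset.mul_sum]
  refine Finset.sum_congr rfl fun j _ => ?_
  ring

theorem hess_symm {w : Euc n → ℝ} {x : Euc n} (h : ContDiffAt ℝ 2 w x) :
    (hessianMatrix w x)ᵀ = hessianMatrix w x := by
  ext i j
  rw [Matrix.transpose_apply, hess_apply h, hess_apply h, dd_comm2 h]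

theorem hess_sub {a b : Euc n → ℝ} {x : Euc n} (ha : ContDiffAt ℝ 2 a x) (hb : ContDiffAt ℝ 2 b x) :
    hessianMatrix (fun y => a y - b y) x = hessianMatrix a x - hessianMatrix b x := by
  ext i j
  rw [Matrix.sub_apply, hess_apply ha, hess_apply hb, hess_apply (ha.sub hb), dd2_sub _ _ ha hb]

theorem hess_add {a b : Euc n → ℝ} {x : Euc n} (ha : ContDiffAt ℝ 2 a x) (hb : ContDiffAt ℝ 2 b x) :
    hessianMatrix (fun y => a y + b y) x = hessianMatrix a x + hessianMatrix b x := by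
  ext i j
  rw [Matrix.add_apply, hess_apply ha, hess_apply hb, hess_apply (ha.add hb), dd2_add _ _ ha hb]

theorem hess_const_mul {a : Euc n → ℝ} {x : Euc n} (r : ℝ) (ha : ContDiffAt ℝ 2 a x) :
    hessianMatrix (fun y => r * a y) x = r • hessianMatrix a x := by
  ext i j
  rw [Matrix.smul_apply, hess_apply ha, hess_apply (contDiffAt_const.mul ha), dd2_const_mul _ _ _ ha]
  rfl

theorem hess_congr {a b : Euc n → ℝ} {x : Euc n} (h : a =ᶠ[𝓝 x] b) :
    hessianMatrix a x = hessianMatrix b x := by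
  ext i j
  simp only [hessianMatrix, Matrix.of_apply]
  rw [(h.iteratedFDeriv ℝ 2).self_of_nhds]

theorem hess_const (c : ℝ) (x : Euc n) : hessianMatrix (fun _ : Euc n => c) x = 0 := by
  ext i j
  rw [hess_apply contDiffAt_const]
  have : dd (bas j) (fun _ : Euc n => c) = fun _ => 0 := by ext y; exact dd_const _ _ _
  rw [this, dd_const]; rfl

theorem qf_add_mat (M N : Mat n) (z z' : Euc n) : qf (M + N) z z' = qf M z z' + qf N z z' := by
  simp only [qf, Matrix.add_apply, mul_add, add_mul, Finset.sum_add_distrib]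

theorem qf_sub_mat (M N : Mat n) (z z' : Euc n) : qf (M - N) z z' = qf M z z' - qf N z z' := by
  simp only [qf, Matrix.sub_apply, mul_sub, sub_mul, Finset.sum_sub_distrib]

theorem qf_smul_mat (r : ℝ) (M : Mat n) (z z' : Euc n) : qf (r • M) z z' = r * qf M z z' := by
  simp only [qf, Matrix.smul_apply, smul_eq_mul, Finset.mul_sum]
  refine Finset.sum_congr rfl fun i _ => Finset.sum_congr rfl fun j _ => by ring

theorem qf_one (z z' : Euc n) : qf (1 : Mat n) z z' = ⟪z, z'⟫ := by
  simp [qf, Matrix.one_apply, PiLp.inner_apply, mul_comm]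

theorem qf_one_self (z : Euc n) : qf (1 : Mat n) z z = ‖z‖ ^ 2 := by
  rw [qf_one, real_inner_self_eq_norm_sq]

theorem qf_add_left (M : Mat n) (x y z : Euc n) : qf M (x + y) z = qf M x z + qf M y z := by
  simp only [qf, PiLp.add_apply, add_mul, Finset.sum_add_distrib]

theorem qf_add_right (M : Mat n) (x y z : Euc n) : qf M z (x + y) = qf M z x + qf M z y := by
  simp only [qf, PiLp.add_apply, mul_add, Finset.sum_add_distrib]

theorem qf_smul_left (M : Mat n) (r : ℝ) (x z : Euc n) : qf M (r • x) z = r * qf M x z := by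
  simp only [qf, PiLp.smul_apply, smul_eq_mul, Finset.mul_sum, mul_assoc]

theorem qf_smul_right (M : Mat n) (r : ℝ) (x z : Euc n) : qf M z (r • x) = r * qf M z x := by
  simp only [qf, PiLp.smul_apply, smul_eq_mul, Finset.mul_sum]
  refine Finset.sum_congr rfl fun i _ => Finset.sum_congr rfl fun j _ => by ring

theorem qf_symm {M : Mat n} (h : Mᵀ = M) (x y : Euc n) : qf M x y = qf M y x := by
  simp only [qf]
  rw [Finset.sum_comm]
  refine Finset.sum_congr rfl fun i _ => Finset.sum_congr rfl fun j _ => ?_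
  rw [← h, Matrix.transpose_apply, h]; ring

theorem convex_tangent {s : Set (Euc n)} {w : Euc n → ℝ} (hw : ConvexOn ℝ s w) {x y : Euc n} (hxs : x ∈ s)
    (hy : y ∈ s) (h : DifferentiableAt ℝ w x) : w x + fderiv ℝ w x (y - x) ≤ w y := by
  have h1 : ConvexOn ℝ (Set.Icc (0:ℝ) 1) (fun t : ℝ => w (x + t • (y - x))) := by
    refine ⟨convex_Icc 0 1, fun a ha b hb p q hp hq hpq => ?_⟩
    have e : x + (p • a + q • b) • (y - x) = p • (x + a • (y - x)) + q • (x + b • (y - x)) := by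
      have : x = (p + q) • x := by rw [hpq, one_smul]
      nth_rewrite 1 [this]
      simp only [smul_eq_mul]; module
    have mem : ∀ t ∈ Set.Icc (0:ℝ) 1, x + t • (y - x) ∈ s := by
      intro t ht
      have := hw.1 hxs hy (sub_nonneg.2 ht.2) ht.1 (by ring)
      convert this using 1; module
    simp only [e]
    exact hw.2 (mem a ha) (mem b hb) hp hq hpq
  have hd : HasDerivAt (fun t : ℝ => w (x + t • (y - x))) (dd (y - x) w x) 0 := by
    have := line_hasDerivAt (f := w) (x := x) (b := y - x) (t := 0)
      (by simpa using h)
    simpa using this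
  have h2 := h1.le_slope_of_hasDerivAt (x := 0) (y := 1) (by simp) (by simp) (by norm_num) hd
  simp [slope_def_field] at h2
  simp only [dd] at *
  linarith

/-- Hessian of a C² convex function is PSD -/
theorem convex_hess {s : Set (Euc n)} {w : Euc n → ℝ} (hw : ConvexOn ℝ s w) {x : Euc n} (hx : s ∈ 𝓝 x)
    (h : ContDiffAt ℝ 2 w x) : (hessianMatrix w x).PosSemidef := by
  refine PSD_of_qf (hess_symm h) fun z => ?_
  rw [← dd_qf h]
  set f : Euc n → ℝ := fun y => (w x + fderiv ℝ w x (y - x)) - w y with hf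
  have hl : ∀ y ∈ s, f y ≤ 0 := by
    intro y hy
    have := convex_tangent hw (mem_of_mem_nhds hx) hy (h.differentiableAt (by norm_num))
    simp only [hf]; linarith
  have hf2 : ContDiffAt ℝ 2 (fun y => w x + fderiv ℝ w x (y - x)) x := by fun_prop
  have hmax : IsLocalMax f x := by
    filter_upwards [hx] with y hy
    have := hl y hy
    simpa [hf] using this
  have h3 := (max_dd (hf2.sub h) hmax z).2
  rw [dd2_sub z z hf2 h] at h3
  have h4 : dd z (dd z (fun y => w x + fderiv ℝ w x (y - x))) x = 0 := by
    have : dd z (fun y => w x + fderiv ℝ w x (y - x)) = fun _ => fderiv ℝ w x z := by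
      ext y
      simp only [dd]
      have h5 : HasFDerivAt (fun y => w x + fderiv ℝ w x (y - x)) (fderiv ℝ w x) y := by
        have := ((fderiv ℝ w x).hasFDerivAt (x := y - x)).comp y ((hasFDerivAt_id y).sub_const x)
        simpa using this.const_add (w x)
      rw [h5.fderiv]
    rw [this, dd_const]
  linarith

/-- Hessian quadratic form in a frame -/
theorem fm_hess {w : Euc n → ℝ} {x : Euc n} (h : ContDiffAt ℝ 2 w x) (b : Fin n → Euc n) :
    fm b * hessianMatrix w x * (fm b)ᵀ = Matrix.of fun j k => dd (b j) (dd (b k) w) x := by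
  ext j k
  rw [fm_apply, Matrix.of_apply, dd_qf h]

theorem frame_upper {G : Mat n} {b : Fin n → Euc n} (h : Frame G b) {l : ℝ} (hl : 0 < l)
    (hG : ∀ z, l * ‖z‖ ^ 2 ≤ qf G z z) (k : Fin n) : ‖b k‖ ^ 2 ≤ l⁻¹ := by
  have := hG (b k)
  rw [h.qf, if_pos rfl] at this
  rw [← one_div, le_div_iff₀ hl]; linarith

theorem fm_mulVec (b : Fin n → Euc n) (z : Euc n) (k : Fin n) :
    (fm b *ᵥ (z : Fin n → ℝ)) k = ⟪b k, z⟫ := by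
  simp [fm, mulVec, dotProduct, PiLp.inner_apply, mul_comm]

theorem frame_lower {G : Mat n} {b : Fin n → Euc n} (h : Frame G b) (hs : G.PosSemidef) {L : ℝ} (hL : 0 < L)
    (hG : ∀ z, qf G z z ≤ L * ‖z‖ ^ 2) (z : Euc n) : ‖z‖ ^ 2 / L ≤ ∑ k, ⟪b k, z⟫ ^ 2 := by
  set y : Euc n := WithLp.toLp 2 (((fm b)ᵀ * fm b) *ᵥ (z : Fin n → ℝ)) with hy
  have hsum : ∑ k, ⟪b k, z⟫ ^ 2 = (fm b *ᵥ (z : Fin n → ℝ)) ⬝ᵥ (fm b *ᵥ (z : Fin n → ℝ)) := by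
    simp only [dotProduct, fm_mulVec, sq]
  have e0 : G *ᵥ (y : Fin n → ℝ) = (z : Fin n → ℝ) := by
    rw [hy]; simp only [Matrix.mulVec_mulVec]; rw [h.mul_right, Matrix.one_mulVec]
  have e1 : qf G z y = ‖z‖ ^ 2 := by
    rw [qf_eq, e0, ← qf_one_self, qf_eq, Matrix.one_mulVec]
  have e2 : qf G y y = ∑ k, ⟪b k, z⟫ ^ 2 := by
    rw [qf_eq, e0, hsum, hy]
    simp only
    rw [← Matrix.mulVec_mulVec, Matrix.mulVec_transpose, ← Matrix.dotProduct_mulVec]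
  have e3 := qf_nonneg hs (z + (-L) • y)
  rw [qf_add_left, qf_add_right, qf_add_right, qf_smul_left, qf_smul_left, qf_smul_right, qf_smul_right,
    qf_symm (PSD_sym hs) y z, e1, e2] at e3
  have := hG z
  rw [div_le_iff₀ hL]
  nlinarith

theorem frame_gamma_le {b : Fin n → Euc n} {l : ℝ}
    (hb : ∀ k, ‖b k‖ ^ 2 ≤ l) (z : Euc n) : ∑ k, ⟪b k, z⟫ ^ 2 ≤ n * l * ‖z‖ ^ 2 := by
  have : ∀ k ∈ (Finset.univ : Finset (Fin n)), ⟪b k, z⟫ ^ 2 ≤ l * ‖z‖ ^ 2 := by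
    intro k _
    have h1 := abs_real_inner_le_norm (b k) z
    have h2 : ⟪b k, z⟫ ^ 2 ≤ (‖b k‖ * ‖z‖) ^ 2 := by rw [← sq_abs]; gcongr
    calc _ ≤ _ := h2
      _ = ‖b k‖ ^ 2 * ‖z‖ ^ 2 := by ring
      _ ≤ _ := by gcongr; exact hb k
  calc _ ≤ ∑ k : Fin n, l * ‖z‖ ^ 2 := Finset.sum_le_sum this
    _ = _ := by simp; ring

/-- eigenvalue lower bound from determinant one -/
theorem eig_lower {G : Mat n} (hs : G.PosDef) (hd : G.det = 1) {L : ℝ} (hL : 1 ≤ L)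
    (hG : ∀ z, qf G z z ≤ L * ‖z‖ ^ 2) (z : Euc n) : (L ^ n)⁻¹ * ‖z‖ ^ 2 ≤ qf G z z := by
  have hL0 : 0 < L := by linarith
  obtain ⟨U, d, h1, h2, h3⟩ := symm_diag (PSD_sym hs.posSemidef)
  have hUb : ∀ k, ‖(WithLp.toLp 2 (Uᵀ k) : Euc n)‖ ^ 2 = 1 := by
    intro k
    have := congrFun (congrFun h1 k) k
    rw [Matrix.mul_apply, Matrix.one_apply_eq] at this
    rw [EuclideanSpace.real_norm_sq_eq, ← this]
    refine Finset.sum_congr rfl fun i _ => ?_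
    simp [sq]
  have hdq : ∀ k, d k = qf G (WithLp.toLp 2 (Uᵀ k)) (WithLp.toLp 2 (Uᵀ k)) := by
    intro k
    have h5 := congrFun (congrFun h3 k) k
    have h6 := qf_diag (U := Uᵀ) (M := G) k k
    rw [Matrix.transpose_transpose, h5, Matrix.diagonal_apply_eq] at h6
    exact h6
  have hdL : ∀ k, d k ≤ L := fun k => by
    have := hG (WithLp.toLp 2 (Uᵀ k)); rw [hUb, mul_one] at this; rw [hdq]; exact this
  have hd0 : ∀ k, 0 ≤ d k := fun k => by rw [hdq]; exact qf_nonneg hs.posSemidef _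
  have hprod : ∏ k, d k = 1 := by
    have := congrArg Matrix.det h3
    rw [Matrix.det_diagonal, Matrix.det_mul, Matrix.det_mul, hd] at this
    rw [← this, mul_one, ← Matrix.det_mul, h1, Matrix.det_one]
  have hdl : ∀ k, (L ^ n)⁻¹ ≤ d k := by
    intro k
    have e1 := Finset.mul_prod_erase Finset.univ d (Finset.mem_univ k)
    rw [hprod] at e1
    have e2 : ∏ i ∈ Finset.univ.erase k, d i ≤ L ^ n := by
      calc _ ≤ ∏ i ∈ Finset.univ.erase k, L := Finset.prod_le_prod (fun i _ => hd0 i) (fun i _ => hdL i)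
        _ = L ^ (Finset.univ.erase k).card := by rw [Finset.prod_const]
        _ ≤ L ^ n := by
            apply pow_le_pow_right₀ hL
            exact (Finset.card_le_card (Finset.erase_subset _ _)).trans (by simp)
    rw [inv_eq_one_div, div_le_iff₀ (by positivity), ← e1]
    exact mul_le_mul_of_nonneg_left e2 (hd0 k)
  have hGU : G = U * diagonal d * Uᵀ := by
    rw [← h3]
    calc G = (U * Uᵀ) * G * (U * Uᵀ) := by rw [h2]; simp
      _ = _ := by simp only [Matrix.mul_assoc]
  set y : Fin n → ℝ := Uᵀ *ᵥ (z : Fin n → ℝ) with hy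
  have e1 : qf G z z = ∑ k, d k * y k ^ 2 := by
    rw [qf_eq, hGU, ← Matrix.mulVec_mulVec, ← Matrix.mulVec_mulVec, Matrix.dotProduct_mulVec,
      ← Matrix.mulVec_transpose, ← hy]
    simp only [dotProduct, Matrix.mulVec_diagonal]
    exact Finset.sum_congr rfl fun k _ => by ring
  have e2 : ‖z‖ ^ 2 = ∑ k, y k ^ 2 := by
    rw [← qf_one_self, qf_eq, ← h2, ← Matrix.mulVec_mulVec, Matrix.dotProduct_mulVec,
      ← Matrix.mulVec_transpose, ← hy]
    simp only [dotProduct, sq]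
  rw [e1, e2, Finset.mul_sum]
  exact Finset.sum_le_sum fun k _ => mul_le_mul_of_nonneg_right (hdl k) (sq_nonneg _)

end MA
end

section
namespace MA
open Filter Topology Matrix

variable {n : ℕ}

theorem conj_PSD {M : Mat n} (h : M.PosSemidef) (b : Fin n → Euc n) : (fm b * M * (fm b)ᵀ).PosSemidef := by
  have := h.mul_mul_conjTranspose_same (fm b)
  rwa [Matrix.conjTranspose_eq_transpose_of_trivial] at this

/-- pointwise comparison of determinants -/
theorem det_le_of_le {A G : Mat n} (hA : A.PosSemidef) (hG : G.PosDef)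
    (h : ∀ z, qf A z z ≤ qf G z z) : A.det ≤ G.det := by
  obtain ⟨b, d, hb, -⟩ := exists_frame (N := 0) hG (by simp)
  have h1 := det_le_one (conj_PSD hA b) (by
    have : (fm b * A * (fm b)ᵀ).trace = ∑ k, qf A (b k) (b k) := by
      simp only [Matrix.trace, Matrix.diag, fm_apply]
    rw [this]
    calc _ ≤ ∑ k, qf G (b k) (b k) := Finset.sum_le_sum fun k _ => h (b k)
      _ = n := by simp [hb.qf])
  rw [Matrix.det_mul, Matrix.det_mul, Matrix.det_transpose] at h1
  have h2 := hb.det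
  have h3 : 0 < (fm b).det ^ 2 := by
    rcases (sq_nonneg (fm b).det).eq_or_lt with h | h
    · rw [← h] at h2; simp at h2
    · exact h
  nlinarith

theorem interior_max {Ω : Set (Euc n)} (hb : Bornology.IsBounded Ω)
    {f : Euc n → ℝ} (hc : ContinuousOn f (closure Ω)) (hf : ∀ z ∈ frontier Ω, f z ≤ 0)
    {x : Euc n} (hx : x ∈ closure Ω) (hpos : 0 < f x) :
    ∃ x0 ∈ interior Ω, IsLocalMax f x0 ∧ ∀ y ∈ closure Ω, f y ≤ f x0 := by
  have hcomp : IsCompact (closure Ω) := hb.isCompact_closure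
  obtain ⟨x0, hx0, hmax⟩ := hcomp.exists_isMaxOn ⟨x, hx⟩ hc
  have h1 : x0 ∈ interior Ω := by
    by_contra hni
    have := hf x0 ⟨hx0, hni⟩
    have := hmax hx
    simp only [Set.mem_setOf_eq] at this
    linarith
  refine ⟨x0, h1, ?_, fun y hy => hmax hy⟩
  filter_upwards [isOpen_interior.mem_nhds h1] with y hy
  exact hmax (subset_closure (interior_subset hy))

theorem comparison_strict {Ω : Set (Euc n)} (ho : IsOpen Ω) (hb : Bornology.IsBounded Ω)
    {a b : Euc n → ℝ} (hac : ContinuousOn a (closure Ω)) (hbc : ContinuousOn b (closure Ω))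
    (ha : ∀ x ∈ Ω, ContDiffAt ℝ 2 a x) (hb2 : ∀ x ∈ Ω, ContDiffAt ℝ 2 b x)
    (hap : ∀ x ∈ Ω, (hessianMatrix a x).PosSemidef) (hbp : ∀ x ∈ Ω, (hessianMatrix b x).PosDef)
    (hd : ∀ x ∈ Ω, hessDet b x < hessDet a x) (hf : ∀ z ∈ frontier Ω, a z ≤ b z) :
    ∀ x ∈ closure Ω, a x ≤ b x := by
  intro x hx
  by_contra hcon
  push Not at hcon
  obtain ⟨x0, hx0, hm, -⟩ := interior_max (f := fun y => a y - b y) hb (hac.sub hbc)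
    (fun z hz => by have := hf z hz; linarith) hx (by linarith)
  rw [ho.interior_eq] at hx0
  have h1 : ∀ z, qf (hessianMatrix a x0) z z ≤ qf (hessianMatrix b x0) z z := by
    intro z
    have := (max_dd ((ha x0 hx0).sub (hb2 x0 hx0)) hm z).2
    rw [dd2_sub z z (ha x0 hx0) (hb2 x0 hx0), dd_qf (ha x0 hx0), dd_qf (hb2 x0 hx0)] at this
    linarith
  have := det_le_of_le (hap x0 hx0) (hbp x0 hx0) h1
  have h2 := hd x0 hx0
  simp only [hessDet] at h2
  linarith

theorem hessDet_const_mul {a : Euc n → ℝ} {x : Euc n} (r : ℝ) (ha : ContDiffAt ℝ 2 a x) :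
    hessDet (fun y => r * a y) x = r ^ n * hessDet a x := by
  rw [hessDet, hess_const_mul r ha, Matrix.det_smul, Fintype.card_fin, hessDet]

theorem hess_sub_const {a : Euc n → ℝ} {x : Euc n} (c : ℝ) (ha : ContDiffAt ℝ 2 a x) :
    hessianMatrix (fun y => a y - c) x = hessianMatrix a x := by
  rw [hess_sub ha contDiffAt_const, hess_const, sub_zero]

theorem comparison {Ω : Set (Euc n)} (hn : n ≠ 0) (ho : IsOpen Ω) (hb : Bornology.IsBounded Ω)
    {a b : Euc n → ℝ} (hac : ContinuousOn a (closure Ω)) (hbc : ContinuousOn b (closure Ω))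
    (ha : ∀ x ∈ Ω, ContDiffAt ℝ 2 a x) (hb2 : ∀ x ∈ Ω, ContDiffAt ℝ 2 b x)
    (hap : ∀ x ∈ Ω, (hessianMatrix a x).PosSemidef) (hbp : ∀ x ∈ Ω, (hessianMatrix b x).PosDef)
    (hd : ∀ x ∈ Ω, hessDet b x ≤ hessDet a x) (hf : ∀ z ∈ frontier Ω, a z ≤ b z) :
    ∀ x ∈ closure Ω, a x ≤ b x := by
  have hcomp : IsCompact (closure Ω) := hb.isCompact_closure
  obtain ⟨M, hM⟩ := hcomp.exists_bound_of_continuousOn hac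
  intro x hx
  have key : ∀ ε : ℝ, 0 < ε → a x + ε * (a x - M) ≤ b x := by
    intro ε hε
    have h2 : ∀ y, (1 + ε) * a y - ε * M = a y + ε * (a y - M) := fun y => by ring
    have := comparison_strict (a := fun y => (1 + ε) * a y - ε * M) ho hb
      ((continuousOn_const.mul hac).sub continuousOn_const) hbc
      (fun y hy => (contDiffAt_const.mul (ha y hy)).sub contDiffAt_const) hb2
      (fun y hy => by
        rw [hess_sub_const _ (contDiffAt_const.mul (ha y hy)), hess_const_mul _ (ha y hy)]
        exact (hap y hy).smul (by positivity)) hbp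
      (fun y hy => by
        have e : hessDet (fun y => (1 + ε) * a y - ε * M) y = (1 + ε) ^ n * hessDet a y := by
          rw [hessDet, hess_sub_const _ (contDiffAt_const.mul (ha y hy)), ← hessDet,
            hessDet_const_mul _ (ha y hy)]
        rw [e]
        have h3 : 0 < hessDet b y := (hbp y hy).det_pos
        have h4 : 1 < (1 + ε) ^ n := one_lt_pow₀ (by linarith) hn
        have := hd y hy
        nlinarith)
      (fun z hz => by
        have h5 := hM z (frontier_subset_closure hz)
        rw [Real.norm_eq_abs] at h5
        have h6 := (abs_le.1 h5).2
        have := hf z hz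
        rw [h2]; nlinarith) x hx
    rw [h2] at this; exact this
  have hlim : Tendsto (fun ε : ℝ => a x + ε * (a x - M)) (𝓝[>] 0) (𝓝 (a x)) := by
    have : ContinuousAt (fun ε : ℝ => a x + ε * (a x - M)) 0 := by fun_prop
    have h := this.tendsto
    simp only [zero_mul, add_zero] at h
    exact h.mono_left nhdsWithin_le_nhds
  exact le_of_tendsto hlim (eventually_mem_nhdsWithin.mono fun ε hε => key ε hε)

end MA
end

section
namespace MA
open Filter Topology Matrix Metric

variable {n : ℕ}

theorem dd_inner (c b ξ x : Euc n) : dd b (fun y => ⟪c, y - ξ⟫) x = ⟪c, b⟫ := by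
  have h : HasFDerivAt (fun y : Euc n => ⟪c, y - ξ⟫) (innerSL ℝ c) x := by
    exact ((innerSL ℝ c).hasFDerivAt (x := x - ξ)).comp x ((hasFDerivAt_id x).sub_const ξ)
  rw [dd, h.fderiv]; simp

theorem sm_inner (c ξ x : Euc n) : ContDiffAt ℝ 2 (fun y : Euc n => ⟪c, y - ξ⟫) x :=
  ((innerSL ℝ c).contDiff.contDiffAt).comp x (contDiffAt_id.sub contDiffAt_const)

theorem dd_nsq (b ξ x : Euc n) : dd b (fun y => ‖y - ξ‖ ^ 2) x = 2 * ⟪x - ξ, b⟫ := by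
  have h : HasFDerivAt (fun y : Euc n => ‖y - ξ‖ ^ 2) (2 • (innerSL ℝ (x - ξ))) x := by
    have := ((hasFDerivAt_id x).sub_const ξ).norm_sq
    simpa using this
  rw [dd, h.fderiv, _root_.smul_apply, innerSL_apply_apply, nsmul_eq_mul, Nat.cast_ofNat]

theorem sm_nsq {N : WithTop ℕ∞} (ξ x : Euc n) : ContDiffAt ℝ N (fun y : Euc n => ‖y - ξ‖ ^ 2) x :=
  (contDiff_norm_sq ℝ).contDiffAt.comp x (contDiffAt_id.sub contDiffAt_const)

theorem dd2_nsq (b c ξ x : Euc n) : dd b (dd c (fun y => ‖y - ξ‖ ^ 2)) x = 2 * ⟪b, c⟫ := by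
  have : dd c (fun y : Euc n => ‖y - ξ‖ ^ 2) = fun y => 2 * ⟪c, y - ξ⟫ := by
    ext y; rw [dd_nsq, real_inner_comm]
  rw [this, dd_const_mul _ _ ((sm_inner c ξ x).differentiableAt (by norm_num)), dd_inner, real_inner_comm]

theorem hess_nsq (ξ x : Euc n) : hessianMatrix (fun y => ‖y - ξ‖ ^ 2) x = (2 : ℝ) • (1 : Mat n) := by
  ext i j
  rw [hess_apply (sm_nsq ξ x), dd2_nsq, Matrix.smul_apply, ← qf_bas (1 : Mat n), qf_one]; rfl

/-- normalized quadratic -/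
theorem hess_quad (ξ x : Euc n) (r c : ℝ) :
    hessianMatrix (fun y => r * ‖y - ξ‖ ^ 2 - c) x = (2 * r) • (1 : Mat n) := by
  rw [hess_sub_const _ (contDiffAt_const.mul (sm_nsq ξ x)), hess_const_mul _ (sm_nsq ξ x), hess_nsq, smul_smul,
    mul_comm]

theorem hess_inner (c ξ x : Euc n) : hessianMatrix (fun y => ⟪c, y - ξ⟫) x = 0 := by
  ext i j
  rw [hess_apply (sm_inner c ξ x)]
  have : dd (bas j) (fun y : Euc n => ⟪c, y - ξ⟫) = fun _ => ⟪c, bas j⟫ := by ext y; rw [dd_inner]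
  rw [this, dd_const]; rfl

theorem hess_inner_sq (c ξ x : Euc n) :
    hessianMatrix (fun y => ⟪c, y - ξ⟫ * ⟪c, y - ξ⟫) x = (2 : ℝ) • Matrix.of fun i j => c i * c j := by
  have hs := sm_inner c ξ x
  ext i j
  rw [hess_apply (hs.mul hs)]
  have : dd (bas j) (fun y : Euc n => ⟪c, y - ξ⟫ * ⟪c, y - ξ⟫) = fun y => (2 * c j) * ⟪c, y - ξ⟫ := by
    ext y
    have hd := (sm_inner c ξ y).differentiableAt (by norm_num)
    rw [dd_mul _ hd hd, dd_inner]
    have : ⟪c, bas j⟫ = c j := by simp [bas, EuclideanSpace.inner_single_right]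
    rw [this]; ring
  rw [this, dd_const_mul _ _ (hs.differentiableAt (by norm_num)), dd_inner]
  have : ⟪c, bas i⟫ = c i := by simp [bas, EuclideanSpace.inner_single_right]
  rw [this]; simp; ring

/-- normalized solutions of the Monge-Ampere equation -/
structure Sol (Ω : Set (Euc n)) (ξ : Euc n) (w : Euc n → ℝ) : Prop where
  ho : IsOpen Ω
  hc : Convex ℝ Ω
  h1 : ball ξ 1 ⊆ Ω
  h2 : Ω ⊆ ball ξ (n : ℝ)
  conv : ConvexOn ℝ Ω w
  sm : ∀ x ∈ Ω, Sm w x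
  cont : ContinuousOn w (closure Ω)
  det : ∀ x ∈ Ω, hessDet w x = 1
  bd : ∀ z ∈ frontier Ω, w z = 0

namespace Sol
variable {Ω : Set (Euc n)} {ξ : Euc n} {w : Euc n → ℝ}

theorem pd (S : Sol Ω ξ w) {x : Euc n} (hx : x ∈ Ω) : (hessianMatrix w x).PosDef :=
  PD_of_PSD_det (convex_hess S.conv (S.ho.mem_nhds hx) (S.sm x hx).two) (by
    have := S.det x hx; rw [hessDet] at this; rw [this]; norm_num)

theorem bdd (S : Sol Ω ξ w) : Bornology.IsBounded Ω := isBounded_ball.subset S.h2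

theorem lower (S : Sol Ω ξ w) (hn : n ≠ 0) : ∀ x ∈ closure Ω, (1 / 2) * ‖x - ξ‖ ^ 2 - n ^ 2 / 2 ≤ w x := by
  have hq : ∀ x : Euc n, ContDiffAt ℝ 2 (fun y => (1 / 2) * ‖y - ξ‖ ^ 2 - (n : ℝ) ^ 2 / 2) x := fun x =>
    (contDiffAt_const.mul (sm_nsq ξ x)).sub contDiffAt_const
  refine comparison hn S.ho S.bdd (fun x _ => (hq x).continuousAt.continuousWithinAt) S.cont (fun x _ => hq x)
    (fun x hx => (S.sm x hx).two) (fun x _ => ?_) (fun x hx => S.pd hx) (fun x hx => ?_) (fun z hz => ?_)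
  · rw [hess_quad]; exact Matrix.PosSemidef.one.smul (by norm_num)
  · rw [S.det x hx, hessDet, hess_quad]; norm_num
  · rw [S.bd z hz]
    have h1 : z ∈ closedBall ξ (n : ℝ) :=
      (closure_minimal (S.h2.trans ball_subset_closedBall) isClosed_closedBall) (frontier_subset_closure hz)
    rw [mem_closedBall, dist_eq_norm] at h1
    nlinarith [norm_nonneg (z - ξ)]

theorem upper (S : Sol Ω ξ w) (hn : n ≠ 0) : ∀ x ∈ closure Ω, w x ≤ (1 / 2) * ‖x - ξ‖ ^ 2 - 1 / 2 := by
  have hq : ∀ x : Euc n, ContDiffAt ℝ 2 (fun y => (1 / 2) * ‖y - ξ‖ ^ 2 - (1 : ℝ) / 2) x := fun x =>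
    (contDiffAt_const.mul (sm_nsq ξ x)).sub contDiffAt_const
  refine comparison hn S.ho S.bdd S.cont (fun x _ => (hq x).continuousAt.continuousWithinAt)
    (fun x hx => (S.sm x hx).two) (fun x _ => hq x) (fun x hx => (S.pd hx).posSemidef) (fun x _ => ?_)
    (fun x hx => ?_) (fun z hz => ?_)
  · rw [hess_quad]; norm_num; exact Matrix.PosDef.one
  · rw [S.det x hx, hessDet, hess_quad]; norm_num
  · rw [S.bd z hz]
    have h1 : z ∉ ball ξ 1 := fun h => by
      have := hz.2; rw [S.ho.interior_eq] at this; exact this (S.h1 h)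
    rw [mem_ball, dist_eq_norm, not_lt] at h1
    nlinarith

theorem nonpos (S : Sol Ω ξ w) : ∀ x ∈ closure Ω, w x ≤ 0 := by
  intro x hx
  by_contra hcon
  push Not at hcon
  obtain ⟨x0, hx0, hm, hM⟩ := interior_max (f := w) S.bdd S.cont (fun z hz => (S.bd z hz).le) hx hcon
  have hx0 := interior_subset hx0
  have h1 := (S.pd hx0)
  by_cases hn : n = 0
  · subst hn
    have : x0 = ξ := Subsingleton.elim _ _
    have := S.h2 hx0
    simp at this
  have h2 := qf_pos h1 (z := bas ⟨0, Nat.pos_of_ne_zero hn⟩) (by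
    intro h; have := bas_norm (n := n) ⟨0, Nat.pos_of_ne_zero hn⟩; rw [h] at this; simp at this)
  have h3 := (max_dd (S.sm x0 hx0).two hm (bas ⟨0, Nat.pos_of_ne_zero hn⟩)).2
  rw [dd_qf (S.sm x0 hx0).two] at h3
  linarith

theorem support (S : Sol Ω ξ w) {y : Euc n} (hy : y ∉ Ω) :
    ∃ ν : Euc n, ‖ν‖ = 1 ∧ ∀ z ∈ Ω, 0 ≤ ⟪ν, z - y⟫ := by
  obtain ⟨f, hf⟩ := geometric_hahn_banach_open_point S.hc S.ho hy
  set v := (InnerProductSpace.toDual ℝ (Euc n)).symm f with hv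
  have hfv : ∀ x, f x = ⟪v, x⟫ := fun x => (InnerProductSpace.toDual_symm_apply).symm
  have hξ : ξ ∈ Ω := S.h1 (mem_ball_self one_pos)
  have hv0 : v ≠ 0 := by
    intro h
    have := hf ξ hξ
    rw [hfv, hfv, h] at this; simp at this
  have hvn : 0 < ‖v‖ := norm_pos_iff.2 hv0
  refine ⟨-(‖v‖⁻¹ • v), ?_, fun z hz => ?_⟩
  · rw [norm_neg, norm_smul, norm_inv, norm_norm]; field_simp
  · have := hf z hz
    rw [hfv, hfv] at this
    rw [inner_neg_left, real_inner_smul_left, inner_sub_right]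
    have h2 : 0 < ‖v‖⁻¹ := inv_pos.2 hvn
    nlinarith

/-- barrier -/
theorem barrier (S : Sol Ω ξ w) (hn : n ≠ 0) {ε : ℝ} (hε : 0 < ε) {y : Euc n} (hy : y ∈ frontier Ω) :
    ∃ ν : Euc n, ‖ν‖ = 1 ∧ ∀ x ∈ closure Ω,
      ε * ((1 / 2) * ‖x - ξ‖ ^ 2 - n ^ 2 / 2) + ε * ((ε ^ n)⁻¹ / 2) * (⟪ν, x - y⟫ * ⟪ν, x - y⟫ - 3 * n * ⟪ν, x - y⟫) ≤ w x := by
  have hyn : y ∉ Ω := fun h => by have := hy.2; rw [S.ho.interior_eq] at this; exact this h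
  obtain ⟨ν, hν, hs⟩ := S.support hyn
  refine ⟨ν, hν, ?_⟩
  set N := (ε ^ n)⁻¹ with hN
  have hNpos : 0 < N := by positivity
  have hcl : closure Ω ⊆ closedBall ξ (n : ℝ) :=
    closure_minimal (S.h2.trans ball_subset_closedBall) isClosed_closedBall
  have hpos : ∀ z ∈ closure Ω, 0 ≤ ⟪ν, z - y⟫ := by
    intro z hz
    have hcl2 : IsClosed {z : Euc n | 0 ≤ ⟪ν, z - y⟫} := isClosed_le continuous_const (by fun_prop)
    exact closure_minimal hs hcl2 hz
  have hle : ∀ z ∈ closure Ω, ⟪ν, z - y⟫ ≤ 2 * n := by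
    intro z hz
    have h1 := real_inner_le_norm ν (z - y)
    have h2 := hcl hz
    have h3 := hcl (frontier_subset_closure hy)
    rw [mem_closedBall] at h2 h3
    have h4 := dist_triangle_right z y ξ
    rw [hν, one_mul, ← dist_eq_norm] at h1
    linarith
  have c1 : ∀ x : Euc n, ContDiffAt ℝ 2 (fun y => (1 / 2) * ‖y - ξ‖ ^ 2 - (n : ℝ) ^ 2 / 2) x := fun x =>
    (contDiffAt_const.mul (sm_nsq ξ x)).sub contDiffAt_const
  have c0 : ∀ x : Euc n, ContDiffAt ℝ 2 (fun x : Euc n => ⟪ν, x - y⟫ * ⟪ν, x - y⟫) x := fun x =>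
    (sm_inner ν y x).mul (sm_inner ν y x)
  have c00 : ∀ x : Euc n, ContDiffAt ℝ 2 (fun x : Euc n => 3 * (n:ℝ) * ⟪ν, x - y⟫) x := fun x =>
    contDiffAt_const.mul (sm_inner ν y x)
  have c2 : ∀ x : Euc n, ContDiffAt ℝ 2 (fun x : Euc n => ⟪ν, x - y⟫ * ⟪ν, x - y⟫ - 3 * (n:ℝ) * ⟪ν, x - y⟫) x := fun x =>
    (c0 x).sub (c00 x)
  have hq : ∀ x : Euc n, ContDiffAt ℝ 2 (fun x : Euc n => ε * ((1 / 2) * ‖x - ξ‖ ^ 2 - n ^ 2 / 2) +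
      ε * (N / 2) * (⟪ν, x - y⟫ * ⟪ν, x - y⟫ - 3 * n * ⟪ν, x - y⟫)) x := fun x =>
    (contDiffAt_const.mul (c1 x)).add (contDiffAt_const.mul (c2 x))
  have hH : ∀ x : Euc n, hessianMatrix (fun x : Euc n => ε * ((1 / 2) * ‖x - ξ‖ ^ 2 - n ^ 2 / 2) +
      ε * (N / 2) * (⟪ν, x - y⟫ * ⟪ν, x - y⟫ - 3 * n * ⟪ν, x - y⟫)) x =
      ε • (1 + N • (Matrix.of fun i j => ν i * ν j)) := by
    intro x
    rw [hess_add (contDiffAt_const.mul (c1 x)) (contDiffAt_const.mul (c2 x)), hess_const_mul _ (c1 x),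
      hess_const_mul _ (c2 x), hess_quad, hess_sub (c0 x) (c00 x), hess_const_mul _ (sm_inner ν y x),
      hess_inner, hess_inner_sq, smul_zero, sub_zero, smul_add, smul_smul, smul_smul, smul_smul]
    congr 2 <;> ring
  have hdetq : (ε • ((1 : Mat n) + N • (Matrix.of fun i j => ν i * ν j))).det = ε ^ n * (1 + N) := by
    rw [Matrix.det_smul, Fintype.card_fin]
    congr 1
    have h5 : N • (Matrix.of fun i j => ν i * ν j : Mat n) =
        replicateCol (Fin 1) (fun i => N * ν i) * replicateRow (Fin 1) (fun i => ν i) := by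
      ext i j; simp [Matrix.mul_apply]; ring
    have h55 := det_one_add_replicateCol_mul_replicateRow (ι := Fin 1) (fun i => N * ν i) (fun i => ν i)
    rw [h5]
    refine h55.trans ?_
    have h6 : ∑ i, ν i ^ 2 = 1 := by rw [← EuclideanSpace.real_norm_sq_eq, hν, one_pow]
    congr 1
    simp only [dotProduct]
    calc ∑ i, ν i * (N * ν i) = N * ∑ i, ν i ^ 2 := by
          rw [Finset.mul_sum]; exact Finset.sum_congr rfl fun i _ => by ring
      _ = N := by rw [h6, mul_one]
  refine comparison hn S.ho S.bdd (fun x _ => (hq x).continuousAt.continuousWithinAt) S.cont (fun x _ => hq x)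
    (fun x hx => (S.sm x hx).two) (fun x _ => ?_) (fun x hx => S.pd hx) (fun x hx => ?_) (fun z hz => ?_)
  · refine PSD_of_qf (hess_symm (hq x)) fun z => ?_
    rw [hH, qf_smul_mat, qf_add_mat, qf_smul_mat, qf_one_self]
    have h7 : qf (Matrix.of fun i j => ν i * ν j) z z = (∑ i, z i * ν i) ^ 2 := by
      rw [sq, Finset.sum_mul_sum]
      simp only [qf, Matrix.of_apply]
      exact Finset.sum_congr rfl fun i _ => Finset.sum_congr rfl fun j _ => by ring
    rw [h7]; positivity
  · rw [S.det x hx, hessDet, hH, hdetq, hN, mul_add, mul_inv_cancel₀ (by positivity)]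
    have : 0 < ε ^ n := by positivity
    linarith
  · rw [S.bd z hz]
    have hz' := frontier_subset_closure hz
    have h1 := hcl hz'
    rw [mem_closedBall, dist_eq_norm] at h1
    have h2 := hpos z hz'
    have h3 := hle z hz'
    have e1 : (1 / 2) * ‖z - ξ‖ ^ 2 - (n:ℝ) ^ 2 / 2 ≤ 0 := by nlinarith [norm_nonneg (z - ξ)]
    have e2 : ⟪ν, z - y⟫ * ⟪ν, z - y⟫ - 3 * n * ⟪ν, z - y⟫ ≤ 0 := by
      have : (0:ℝ) ≤ n := Nat.cast_nonneg n
      nlinarith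
    have e3 : 0 < ε * (N / 2) := by positivity
    nlinarith

end Sol

/-- universal radius -/
theorem exists_radius (hn : n ≠ 0) : ∃ d : ℝ, 0 < d ∧ d ≤ 1 ∧ ∀ (Ω : Set (Euc n)) (ξ : Euc n) (w : Euc n → ℝ), Sol Ω ξ w →
    ∀ x ∈ Ω, w x ≤ -(1 / 16) → ball x d ⊆ Ω := by
  have hn' : (0:ℝ) < n := by exact_mod_cast Nat.pos_of_ne_zero hn
  set ε : ℝ := 1 / (16 * n ^ 2) with hε
  have hε0 : 0 < ε := by positivity
  set N : ℝ := (ε ^ n)⁻¹ with hN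
  have hN0 : 0 < N := by positivity
  refine ⟨min 1 (1 / (48 * n * (ε * N))), by positivity, min_le_left _ _, fun Ω ξ w S x hx hw => ?_⟩
  have key : ∀ y ∈ frontier Ω, 1 / (48 * n * (ε * N)) ≤ dist y x := by
    intro y hy
    obtain ⟨ν, hν, hb⟩ := S.barrier hn hε0 hy
    have h1 := hb x (subset_closure hx)
    set t := ⟪ν, x - y⟫ with ht
    have h2 : t ≤ dist y x := by
      have := real_inner_le_norm ν (x - y)
      rw [hν, one_mul, ← dist_eq_norm, dist_comm] at this
      exact this
    refine le_trans ?_ h2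
    rw [div_le_iff₀ (by positivity)]
    have h3 : ε * (n ^ 2 / 2) = 1 / 32 := by rw [hε]; field_simp; norm_num
    have h4 : 0 ≤ ε * ((1 / 2) * ‖x - ξ‖ ^ 2) := by positivity
    have h5 : 0 ≤ ε * (N / 2) * (t * t) := by have := mul_self_nonneg t; positivity
    nlinarith
  have hpre : IsPreconnected (ball x (min 1 (1 / (48 * n * (ε * N))))) := (convex_ball _ _).isPreconnected
  refine hpre.subset_of_closure_inter_subset S.ho ⟨x, mem_ball_self (by positivity), hx⟩ ?_
  rintro y ⟨hy1, hy2⟩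
  by_contra hy3
  have := key y ⟨hy1, by rwa [S.ho.interior_eq]⟩
  have h6 := lt_of_lt_of_le (mem_ball.1 hy2) (min_le_right _ _)
  linarith

theorem Sol.grad {Ω : Set (Euc n)} {ξ : Euc n} {w : Euc n → ℝ} (S : Sol Ω ξ w) (hn : n ≠ 0) {x : Euc n} {d : ℝ} (hd : 0 < d)
    (hx : ball x d ⊆ Ω) {e : Euc n} (he : ‖e‖ = 1) : |dd e w x| ≤ n ^ 2 / d := by
  have hxm : x ∈ Ω := hx (mem_ball_self hd)
  have key : ∀ e : Euc n, ‖e‖ = 1 → dd e w x ≤ n ^ 2 / d := by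
    intro e he
    have hy : x + (d / 2) • e ∈ Ω := hx (by
      rw [mem_ball, dist_eq_norm, add_sub_cancel_left, norm_smul, he, Real.norm_of_nonneg (by positivity)]; linarith)
    have h1 := convex_tangent S.conv hxm hy (S.sm x hxm).diff
    rw [add_sub_cancel_left, map_smul, smul_eq_mul] at h1
    have h2 := S.nonpos _ (subset_closure hy)
    have h3 := S.lower hn _ (subset_closure hxm)
    have h4 : 0 ≤ ‖x - ξ‖ ^ 2 := by positivity
    rw [le_div_iff₀ hd]
    simp only [dd]
    nlinarith
  rw [abs_le]
  refine ⟨?_, key e he⟩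
  have := key (-e) (by rwa [norm_neg])
  have h2 : dd (-e) w x = - dd e w x := by simp [dd]
  linarith

theorem Sol.half {Ω : Set (Euc n)} {ξ : Euc n} {w : Euc n → ℝ} (S : Sol Ω ξ w) {x : Euc n} {d c : ℝ}
    (hx : ball x d ⊆ Ω) (hw : w x ≤ -c) {y : Euc n} (hy : y ∈ ball x (d / 2)) : w y ≤ -(c / 2) := by
  have hd : 0 < d := by have := dist_nonneg.trans_lt (mem_ball.1 hy); linarith
  have hxm : x ∈ Ω := hx (mem_ball_self hd)
  have hy' : x + (2:ℝ) • (y - x) ∈ Ω := hx (by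
    rw [mem_ball, dist_eq_norm] at *
    rw [add_sub_cancel_left, norm_smul]; norm_num; linarith)
  have h1 := S.conv.2 hxm hy' (show (0:ℝ) ≤ 1 / 2 by norm_num) (show (0:ℝ) ≤ 1 / 2 by norm_num) (by norm_num)
  have e : (1 / 2 : ℝ) • x + (1 / 2 : ℝ) • (x + (2:ℝ) • (y - x)) = y := by module
  rw [e] at h1
  have h2 := S.nonpos _ (subset_closure hy')
  simp only [smul_eq_mul] at h1
  linarith

end MA
end

section
namespace MA
open Filter Topology Matrix Metric

variable {n : ℕ}

theorem dd_comm3 {f : Euc n → ℝ} {x : Euc n} (h : Sm f x) (b c e : Euc n) :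
    dd b (dd c (dd e f)) x = dd e (dd b (dd c f)) x := by
  rw [dd_congr_at (dd_comm_ev h c e), dd_comm (h.dd c)]

theorem dd_comm3_ev {f : Euc n → ℝ} {x : Euc n} (h : Sm f x) (b c e : Euc n) :
    dd b (dd c (dd e f)) =ᶠ[𝓝 x] dd e (dd b (dd c f)) := by
  filter_upwards [h.ev] with y hy using dd_comm3 hy b c e

theorem dd_comm4 {f : Euc n → ℝ} {x : Euc n} (h : Sm f x) (b c e e' : Euc n) :
    dd b (dd c (dd e (dd e' f))) x = dd e (dd e' (dd b (dd c f))) x := by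
  rw [dd_comm3 (h.dd e'), dd_congr_at (dd_comm3_ev h b c e')]

theorem dd_comm4_ev {f : Euc n → ℝ} {x : Euc n} (h : Sm f x) (b c e e' : Euc n) :
    dd b (dd c (dd e (dd e' f))) =ᶠ[𝓝 x] dd e (dd e' (dd b (dd c f))) := by
  filter_upwards [h.ev] with y hy using dd_comm4 hy b c e e'

theorem dd_comm5 {f : Euc n → ℝ} {x : Euc n} (h : Sm f x) (b c e e' e'' : Euc n) :
    dd b (dd c (dd e (dd e' (dd e'' f)))) x = dd e (dd e' (dd e'' (dd b (dd c f)))) x := by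
  rw [dd_comm3 ((h.dd e'').dd e'), dd_congr_at (dd_comm4_ev h b c e' e'')]

theorem frame_det_ev {w : Euc n → ℝ} {x : Euc n} (hs : Sm w x) (hd : ∀ᶠ y in 𝓝 x, hessDet w y = 1)
    {b : Fin n → Euc n} (hb : Frame (hessianMatrix w x) b) :
    ∀ᶠ y in 𝓝 x, (Matrix.of fun j k => dd (b j) (dd (b k) w) y : Mat n).det = 1 := by
  filter_upwards [hs.ev, hd] with y hy hdy
  rw [← fm_hess hy.two, Matrix.det_mul, Matrix.det_mul, Matrix.det_transpose]
  have h1 := hb.det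
  have h2 : (hessianMatrix w x).det = 1 := hd.self_of_nhds
  rw [hessDet] at hdy
  rw [h2] at h1
  rw [hdy]; linarith

theorem frame_jac {w : Euc n → ℝ} {x : Euc n} (hs : Sm w x) (hd : ∀ᶠ y in 𝓝 x, hessDet w y = 1)
    {b : Fin n → Euc n} (hb : Frame (hessianMatrix w x) b) (e : Euc n) :
    (∑ k, dd e (dd (b k) (dd (b k) w)) x = 0) ∧
    (∑ k, dd e (dd e (dd (b k) (dd (b k) w))) x =
      ∑ j, ∑ k, dd e (dd (b j) (dd (b k) w)) x * dd e (dd (b k) (dd (b j) w)) x) ∧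
    (∑ k, dd e (dd e (dd e (dd (b k) (dd (b k) w)))) x =
      3 * ∑ j, ∑ k, dd e (dd (b j) (dd (b k) w)) x * dd e (dd e (dd (b k) (dd (b j) w))) x -
      2 * ((Matrix.of fun j k => dd e (dd (b j) (dd (b k) w)) x : Mat n) *
        (Matrix.of fun j k => dd e (dd (b j) (dd (b k) w)) x : Mat n) *
        (Matrix.of fun j k => dd e (dd (b j) (dd (b k) w)) x : Mat n)).trace) := by
  set M : ℝ → Mat n := fun t => Matrix.of fun j k => dd (b j) (dd (b k) w) (x + t • e) with hM
  set M1 : ℝ → Mat n := fun t => Matrix.of fun j k => dd e (dd (b j) (dd (b k) w)) (x + t • e) with hM1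
  set M2 : ℝ → Mat n := fun t => Matrix.of fun j k => dd e (dd e (dd (b j) (dd (b k) w))) (x + t • e) with hM2
  set M3 : Mat n := Matrix.of fun j k => dd e (dd e (dd e (dd (b j) (dd (b k) w)))) x with hM3
  have hev : ∀ᶠ t in 𝓝 (0:ℝ), Sm w (x + t • e) := (line_tendsto x e).eventually hs.ev
  have g1 : ∀ᶠ t in 𝓝 (0:ℝ), EHD M (M1 t) t := by
    filter_upwards [hev] with t ht i j
    exact line_hasDerivAt ((ht.dd _).dd _).diff
  have g2 : ∀ᶠ t in 𝓝 (0:ℝ), EHD M1 (M2 t) t := by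
    filter_upwards [hev] with t ht i j
    exact line_hasDerivAt (((ht.dd _).dd _).dd _).diff
  have g3 : EHD M2 M3 0 := by
    intro i j
    have := line_hasDerivAt (f := dd e (dd e (dd (b i) (dd (b j) w)))) (x := x) (b := e) (t := 0)
      (by simpa using ((((hs.dd _).dd _).dd _).dd _).diff)
    simpa [hM2, hM3] using this
  have g4 : ∀ᶠ s in 𝓝 (0:ℝ), (M s).det = 1 := (line_tendsto x e).eventually (frame_det_ev hs hd hb)
  have g5 : M 0 = 1 := by
    rw [← show fm b * hessianMatrix w x * (fm b)ᵀ = 1 from hb, fm_hess hs.two]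
    simp [hM]
  obtain ⟨r1, r2, r3⟩ := jac3 g1 g2 g3 g4 g5
  have z1 : M1 0 = Matrix.of fun j k => dd e (dd (b j) (dd (b k) w)) x := by simp [hM1]
  have z2 : M2 0 = Matrix.of fun j k => dd e (dd e (dd (b j) (dd (b k) w))) x := by simp [hM2]
  rw [z1] at r1 r2 r3
  rw [z2] at r2 r3
  refine ⟨r1, ?_, ?_⟩
  · simpa [Matrix.trace, Matrix.mul_apply] using r2
  · rw [← show M3.trace = ∑ k, dd e (dd e (dd e (dd (b k) (dd (b k) w)))) x from rfl, r3]
    congr 2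

theorem frame_one {w : Euc n → ℝ} {x : Euc n} (hs : ContDiffAt ℝ 2 w x)
    {b : Fin n → Euc n} (hb : Frame (hessianMatrix w x) b) (j k : Fin n) :
    dd (b j) (dd (b k) w) x = if j = k then 1 else 0 := by
  rw [dd_qf hs, hb.qf]

theorem Frame.expand {G : Mat n} {b : Fin n → Euc n} (h : Frame G b) (z : Euc n) :
    z = ∑ k, MA.qf G (b k) z • b k := by
  have h1 := h.mul_left
  have h2 : (z : Fin n → ℝ) = (fm b)ᵀ *ᵥ (fm b *ᵥ (G *ᵥ (z : Fin n → ℝ))) := by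
    rw [Matrix.mulVec_mulVec, Matrix.mulVec_mulVec, h1, Matrix.one_mulVec]
  ext i
  have h3 := congrFun h2 i
  rw [h3]
  simp only [mulVec, dotProduct, transpose_apply, WithLp.ofLp_sum, WithLp.ofLp_smul, Finset.sum_apply, Pi.smul_apply,
    smul_eq_mul, fm, Matrix.of_apply]
  refine Finset.sum_congr rfl fun k _ => ?_
  rw [qf_eq, mul_comm]
  rfl

/-- frame adapted to a vector -/
theorem exists_frame_vec {G : Mat n} (hG : G.PosDef) {e : Euc n} (he : e ≠ 0) :
    ∃ (b : Fin n → Euc n) (j0 : Fin n) (c : ℝ), Frame G b ∧ e = c • b j0 ∧ c ^ 2 = qf G e e := by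
  set g : Fin n → ℝ := G *ᵥ (e : Fin n → ℝ) with hg
  obtain ⟨b, d, hb, hd⟩ := exists_frame (N := Matrix.of fun i j => g i * g j) hG (by
    ext i j; simp [mul_comm])
  have hq : ∀ z, qf G z e = ∑ i, z i * g i := fun z => by rw [qf_eq]; rfl
  have hN : ∀ j k, j ≠ k → qf G (b j) e * qf G (b k) e = 0 := by
    intro j k hjk
    have h1 := congrFun (congrFun hd j) k
    rw [fm_apply, Matrix.diagonal_apply_ne _ hjk] at h1
    rw [← h1, hq, hq, Finset.sum_mul_sum]
    simp only [qf, Matrix.of_apply]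
    exact Finset.sum_congr rfl fun i _ => Finset.sum_congr rfl fun j _ => by ring
  have hexp := hb.expand e
  obtain ⟨j0, hj0⟩ : ∃ j, qf G (b j) e ≠ 0 := by
    by_contra hcon
    push Not at hcon
    apply he
    rw [hexp]; simp [hcon]
  have h2 : e = qf G (b j0) e • b j0 := by
    conv_lhs => rw [hexp]
    rw [Finset.sum_eq_single j0]
    · intro k _ hk
      have := hN k j0 hk
      rcases mul_eq_zero.1 this with h | h
      · rw [h, zero_smul]
      · exact absurd h hj0
    · simp
  refine ⟨b, j0, qf G (b j0) e, hb, h2, ?_⟩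
  have h3 : qf G e e = qf G (b j0) e * qf G (b j0) e := by
    conv_lhs => rw [h2]
    rw [qf_smul_left, ← h2]
  rw [h3, sq]

theorem dd_log {f : Euc n → ℝ} {x : Euc n} (b : Euc n) (hf : DifferentiableAt ℝ f x) (h0 : f x ≠ 0) :
    dd b (fun y => Real.log (f y)) x = dd b f x / f x := by
  simp only [dd]
  rw [(hf.hasFDerivAt.log h0).fderiv]
  simp; ring

theorem dd2_log {f : Euc n → ℝ} {x : Euc n} (b : Euc n) (hf : ContDiffAt ℝ 2 f x) (h0 : f x ≠ 0) :
    dd b (dd b (fun y => Real.log (f y))) x = dd b (dd b f) x / f x - (dd b f x / f x) ^ 2 := by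
  have hd := hf.differentiableAt (by norm_num)
  have h1 : dd b (fun y => Real.log (f y)) =ᶠ[𝓝 x] fun y => dd b f y * (f y)⁻¹ := by
    filter_upwards [c2_ev hf, hf.continuousAt.eventually_ne h0] with y h1 h2
    rw [dd_log b h1 h2, div_eq_mul_inv]
  have d1 := (c2_dd hf b).differentiableAt (by norm_num)
  rw [dd_congr_at h1, dd_mul b d1 (hd.fun_inv h0)]
  have h2 : dd b (fun y => (f y)⁻¹) x = -(dd b f x) / (f x) ^ 2 := by
    simp only [dd]
    have h3 : HasFDerivAt (fun y => (f y)⁻¹) (-(f x ^ 2)⁻¹ • fderiv ℝ f x) x :=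
      (hasDerivAt_inv h0).comp_hasFDerivAt x hd.hasFDerivAt
    rw [h3.fderiv]
    simp; ring
  simp only [h2]
  field_simp
  ring

end MA
end

section
namespace MA
open Filter Topology Matrix Metric

variable {n : ℕ}

theorem sm_c2 {f : Euc n → ℝ} {x : Euc n} (h : Sm f x) : ContDiffAt ℝ 2 f x := h.two

theorem pog_point {w : Euc n → ℝ} {x : Euc n} (hs : Sm w x) (hd : ∀ᶠ y in 𝓝 x, hessDet w y = 1)
    (hp : (hessianMatrix w x).PosDef) {a : ℝ} (hv : w x < a) {e : Euc n} (he : e ≠ 0)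
    (hm : IsLocalMax (fun y => Real.log (a - w y) + (Real.log (dd e (dd e w) y) +
      (1 / 2) * (dd e w y * dd e w y))) x) :
    (dd e (dd e w) x * (a - w x)) ^ 2 - n * (dd e (dd e w) x * (a - w x)) - (dd e w x) ^ 2 ≤ 0 := by
  obtain ⟨b, j0, c, hb, hec, hcs⟩ := exists_frame_vec hp he
  set v : Euc n → ℝ := fun y => a - w y with hvdef
  have hvx : 0 < v x := by simp only [hvdef]; linarith
  have hspos : 0 < dd e (dd e w) x := by rw [dd_qf hs.two]; exact qf_pos hp he
  set s := dd e (dd e w) x with hsdef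
  have hcs' : c ^ 2 = s := by rw [hcs, hsdef, dd_qf hs.two]
  have cv : ContDiffAt ℝ 2 v x := contDiffAt_const.sub hs.two
  have ce : ContDiffAt ℝ 2 (dd e w) x := (hs.dd e).two
  have cee : ContDiffAt ℝ 2 (dd e (dd e w)) x := ((hs.dd e).dd e).two
  have c1 : ContDiffAt ℝ 2 (fun y => Real.log (v y)) x := cv.log hvx.ne'
  have c2 : ContDiffAt ℝ 2 (fun y => Real.log (dd e (dd e w) y)) x := cee.log hspos.ne'
  have c3' : ContDiffAt ℝ 2 (fun y => (dd e w y * dd e w y)) x := ce.mul ce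
  have c3 : ContDiffAt ℝ 2 (fun y => (1/2 : ℝ) * (dd e w y * dd e w y)) x := contDiffAt_const.mul c3'
  have two0 : (2 : WithTop ℕ∞) ≠ 0 := by norm_num
  have key := fun k => max_dd (c1.add (c2.add c3)) hm (b k)
  have dvk : ∀ k, dd (b k) v x = - dd (b k) w x := by
    intro k
    rw [hvdef, dd_sub _ (differentiableAt_const a) hs.diff, dd_const]; ring
  have dvkk : ∀ k, dd (b k) (dd (b k) v) x = - 1 := by
    intro k
    rw [hvdef, dd2_sub _ _ contDiffAt_const hs.two, frame_one hs.two hb]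
    have : dd (b k) (fun _ : Euc n => a) = fun _ => 0 := by ext y; exact dd_const _ _ _
    rw [this, dd_const]; simp
  have wke : ∀ k, dd (b k) (dd e w) x = if k = j0 then c else 0 := by
    intro k
    rw [dd_qf hs.two, hec, qf_smul_right, hb.qf]
    split_ifs <;> ring
  set A : Fin n → Fin n → ℝ := fun j k => dd e (dd (b j) (dd (b k) w)) x with hA
  have hAs : ∀ j k, A j k = A k j := fun j k => dd_congr_at (dd_comm_ev hs (b j) (b k)) e
  have wkee : ∀ k, dd (b k) (dd e (dd e w)) x = c * A j0 k := by
    intro k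
    rw [dd_comm3 hs, dd_congr_at (dd_comm_ev hs (b k) e), hA]
    have : dd e (dd (b k) w) =  fun y => c * dd (b j0) (dd (b k) w) y := by
      ext y; rw [hec, dd_vsmul]
    rw [this, dd_const_mul _ _ ((hs.dd _).dd _).diff]
  obtain ⟨J1, J2, -⟩ := frame_jac hs hd hb e
  have f1 : ∀ k, dd (b k) v x / v x + (c * A j0 k / s + dd e w x * (if k = j0 then c else 0)) = 0 := by
    intro k
    have h := (key k).1
    rw [dd_add _ (c1.differentiableAt two0) ((c2.add c3).differentiableAt two0)] at h
    rw [dd_add _ (c2.differentiableAt two0) (c3.differentiableAt two0),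
      dd_log _ (cv.differentiableAt two0) hvx.ne',
      dd_log _ (cee.differentiableAt two0) hspos.ne',
      dd_const_mul _ _ (c3'.differentiableAt two0),
      dd_mul _ (ce.differentiableAt two0) (ce.differentiableAt two0), wke, wkee] at h
    rw [← hsdef] at h; linear_combination h
  have f2 : ∀ k, (-1) / v x - (dd (b k) v x / v x) ^ 2 + (dd e (dd e (dd (b k) (dd (b k) w))) x / s -
      (c * A j0 k / s) ^ 2 + ((if k = j0 then c else 0) ^ 2 + dd e w x * dd e (dd (b k) (dd (b k) w)) x)) ≤ 0 := by
    intro k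
    have h := (key k).2
    rw [dd2_add _ _ c1 (c2.add c3)] at h
    rw [dd2_add _ _ c2 c3, dd2_log _ cv hvx.ne', dd2_log _ cee hspos.ne',
      dd2_const_mul _ _ _ c3', dd2_mul _ ce ce, wke, wkee, dvkk, dd_comm4 hs, dd_comm3 hs] at h
    refine le_trans (le_of_eq ?_) h; ring
  have f3 := Finset.sum_nonpos fun k (_ : k ∈ Finset.univ) => f2 k
  simp only [Finset.sum_add_distrib, Finset.sum_sub_distrib, ← Finset.sum_div, ← Finset.mul_sum] at f3
  rw [J1, J2] at f3
  have e1 : ∑ k : Fin n, (if k = j0 then c else 0) ^ 2 = s := by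
    rw [← hcs', Finset.sum_eq_single j0] <;> simp +contextual
  have e2 : ∀ k, k ≠ j0 → (dd (b k) v x / v x) ^ 2 = (c * A j0 k / s) ^ 2 := by
    intro k hk
    have := f1 k
    simp only [hk, if_false] at this
    have h : dd (b k) v x / v x = - (c * A j0 k / s) := by linarith
    rw [h]; ring
  have e3 : ∑ k, (dd (b k) v x / v x) ^ 2 = (dd (b j0) v x / v x) ^ 2 +
      (∑ k, (c * A j0 k / s) ^ 2 - (c * A j0 j0 / s) ^ 2) := by
    rw [← Finset.add_sum_erase _ _ (Finset.mem_univ j0), ← Finset.add_sum_erase _ (fun k => (c * A j0 k / s) ^ 2) (Finset.mem_univ j0)]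
    rw [Finset.sum_congr rfl (fun k hk => e2 k (Finset.ne_of_mem_erase hk))]
    ring
  have e4 : 2 * ∑ k, A j0 k ^ 2 - A j0 j0 ^ 2 ≤ ∑ j, ∑ k, A j k * A k j := by
    have : ∀ j, ∑ k, A j k * A k j = ∑ k, A j k ^ 2 := fun j =>
      Finset.sum_congr rfl fun k _ => by rw [hAs k j]; ring
    simp only [this]
    rw [← Finset.add_sum_erase _ (fun j => ∑ k, A j k ^ 2) (Finset.mem_univ j0)]
    have h2 : ∑ j ∈ Finset.univ.erase j0, A j j0 ^ 2 ≤ ∑ j ∈ Finset.univ.erase j0, ∑ k, A j k ^ 2 :=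
      Finset.sum_le_sum fun j _ => Finset.single_le_sum (f := fun k => A j k ^ 2) (fun _ _ => sq_nonneg _) (Finset.mem_univ j0)
    have h3 : ∑ k, A j0 k ^ 2 = A j0 j0 ^ 2 + ∑ j ∈ Finset.univ.erase j0, A j j0 ^ 2 := by
      rw [← Finset.add_sum_erase _ _ (Finset.mem_univ j0)]
      congr 1; exact Finset.sum_congr rfl fun k _ => by rw [hAs]
    linarith
  have e5 : ∀ k, (c * A j0 k / s) ^ 2 = A j0 k ^ 2 / s := by
    intro k; rw [div_pow, mul_pow, hcs']; field_simp
  have e6 : (dd (b j0) v x) ^ 2 * s = (dd e w x) ^ 2 := by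
    rw [dvk, ← hcs']
    have : dd e w x = c * dd (b j0) w x := by conv_lhs => rw [hec]
                                              rw [dd_vsmul]
    rw [this]; ring
  simp only [e5] at f3 e3
  rw [← Finset.sum_div] at f3 e3
  rw [e3, e1] at f3
  have e7 := div_le_div_of_nonneg_right e4 hspos.le
  rw [sub_div, mul_div_assoc] at e7
  have f4 : n * (-1 / v x) - (dd (b j0) v x / v x) ^ 2 + s ≤ 0 := by
    simp only [Finset.sum_const, Finset.card_univ, Fintype.card_fin, nsmul_eq_mul] at f3
    have f6 : (n * (-1 : ℝ)) / v x = n * (-1 / v x) := by ring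
    rw [f6] at f3
    linarith
  have f5 := mul_le_mul_of_nonneg_right f4 (show 0 ≤ s * v x ^ 2 by positivity)
  have : (n * (-1 / v x) - (dd (b j0) v x / v x) ^ 2 + s) * (s * v x ^ 2) =
     (s * v x) ^ 2 - n * (s * v x) - (dd (b j0) v x) ^ 2 * s := by field_simp; ring
  rw [this, e6] at f5
  linarith

theorem Sm.cont2 {f : Euc n → ℝ} {x : Euc n} (h : Sm f x) : ContinuousAt (fderiv ℝ (fderiv ℝ f)) x := by
  have h1 : ContDiffAt ℝ 1 (fderiv ℝ f) x := h.two.fderiv_right (by norm_num)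
  exact (h1.fderiv_right (m := 0) (by norm_num)).continuousAt

theorem Sm.cont1 {f : Euc n → ℝ} {x : Euc n} (h : Sm f x) : ContinuousAt (fderiv ℝ f) x := by
  have h1 : ContDiffAt ℝ 1 (fderiv ℝ f) x := h.two.fderiv_right (by norm_num)
  exact h1.continuousAt

theorem Sol.sub_compact {Ω : Set (Euc n)} {ξ : Euc n} {w : Euc n → ℝ} (S : Sol Ω ξ w) {c : ℝ} (hc : 0 < c) :
    IsCompact (closure Ω ∩ w ⁻¹' Set.Iic (-c)) ∧ (closure Ω ∩ w ⁻¹' Set.Iic (-c)) ⊆ Ω := by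
  constructor
  · have hb : Bornology.IsBounded (closure Ω) := (isBounded_ball.subset S.h2).closure
    refine Metric.isCompact_of_isClosed_isBounded ?_ (hb.subset Set.inter_subset_left)
    exact S.cont.preimage_isClosed_of_isClosed isClosed_closure isClosed_Iic
  · rintro y ⟨hy, hw⟩
    by_contra hcon
    have : y ∈ frontier Ω := ⟨hy, by rwa [S.ho.interior_eq]⟩
    have h0 := S.bd y this
    simp only [Set.mem_preimage, Set.mem_Iic, h0] at hw
    linarith

theorem pogorelov (hn : n ≠ 0) : ∃ Λ : ℝ, 1 ≤ Λ ∧ ∀ (Ω : Set (Euc n)) (ξ : Euc n) (w : Euc n → ℝ), Sol Ω ξ w →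
    ∀ x ∈ Ω, w x ≤ -(1 / 8) → ∀ z, qf (hessianMatrix w x) z z ≤ Λ * ‖z‖ ^ 2 := by
  obtain ⟨d, hd0, hd1, hrad⟩ := exists_radius (n := n) hn
  set g : ℝ := n ^ 2 / d with hg
  have hg0 : 0 ≤ g := by positivity
  have hn1 : (1 : ℝ) ≤ n := by exact_mod_cast Nat.one_le_iff_ne_zero.2 hn
  have hexp : 1 ≤ Real.exp (1 / 2 * (g * g)) := Real.one_le_exp (by positivity)
  refine ⟨16 * ((n + g) * Real.exp (1 / 2 * (g * g))), ?_, ?_⟩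
  · nlinarith
  intro Ω ξ w S x hx hwx z
  have hsx := S.sm x hx
  -- reduce to unit vectors
  suffices H : ∀ e : Euc n, ‖e‖ = 1 → dd e (dd e w) x ≤ 16 * ((n + g) * Real.exp (1 / 2 * (g * g))) by
    by_cases hz : z = 0
    · subst hz; simp [qf]
    have hz' : 0 < ‖z‖ := norm_pos_iff.2 hz
    have h1 := H (‖z‖⁻¹ • z) (by rw [norm_smul]; simp [hz'.ne'])
    rw [dd_qf hsx.two, qf_smul_left, qf_smul_right] at h1
    have h2 : qf (hessianMatrix w x) z z = (‖z‖⁻¹ * (‖z‖⁻¹ * qf (hessianMatrix w x) z z)) * ‖z‖ ^ 2 := by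
      field_simp
    rw [h2]
    exact mul_le_mul_of_nonneg_right h1 (by positivity)
  intro e he
  obtain ⟨hK, hKΩ⟩ := S.sub_compact (c := 1/16) (by norm_num)
  set K := closure Ω ∩ w ⁻¹' Set.Iic (-(1/16 : ℝ)) with hKdef
  have hmemK : ∀ y ∈ Ω, w y ≤ -(1/16) → y ∈ K := fun y hy h => ⟨subset_closure hy, h⟩
  set Φ : Euc n × Euc n → ℝ := fun p => (-(1/16) - w p.1) * (Real.exp (1 / 2 * (fderiv ℝ w p.1 p.2 * fderiv ℝ w p.1 p.2)) *
    fderiv ℝ (fderiv ℝ w) p.1 p.2 p.2) with hΦ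
  have hcont : ContinuousOn Φ (K ×ˢ sphere (0 : Euc n) 1) := by
    have a1 : ContinuousOn (fun p : Euc n × Euc n => fderiv ℝ w p.1) (K ×ˢ sphere (0 : Euc n) 1) := by
      intro p hp
      exact (ContinuousAt.comp (f := Prod.fst) (S.sm p.1 (hKΩ hp.1)).cont1 continuousAt_fst).continuousWithinAt
    have a2 : ContinuousOn (fun p : Euc n × Euc n => fderiv ℝ (fderiv ℝ w) p.1) (K ×ˢ sphere (0 : Euc n) 1) := by
      intro p hp
      exact (ContinuousAt.comp (f := Prod.fst) (S.sm p.1 (hKΩ hp.1)).cont2 continuousAt_fst).continuousWithinAt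
    have a0 : ContinuousOn (fun p : Euc n × Euc n => w p.1) (K ×ˢ sphere (0 : Euc n) 1) := by
      intro p hp
      exact (ContinuousAt.comp (f := Prod.fst) (S.sm p.1 (hKΩ hp.1)).diff.continuousAt continuousAt_fst).continuousWithinAt
    have a3 : ContinuousOn (fun p : Euc n × Euc n => p.2) (K ×ˢ sphere (0 : Euc n) 1) := continuousOn_snd
    have a4 := a1.clm_apply a3
    have a5 := (a2.clm_apply a3).clm_apply a3
    exact (continuousOn_const.sub a0).mul ((Real.continuous_exp.comp_continuousOn
      (continuousOn_const.mul (a4.mul a4))).mul a5)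
  have hxK : x ∈ K := hmemK x hx (by linarith)
  obtain ⟨⟨x0, e0⟩, ⟨hx0, he0⟩, hmax⟩ := (hK.prod (isCompact_sphere (0 : Euc n) 1)).exists_isMaxOn
    ⟨(x, e), hxK, by simpa using he⟩ hcont
  have hx0Ω := hKΩ hx0
  have he0' : ‖e0‖ = 1 := by simpa using he0
  have he0n : e0 ≠ 0 := by intro h; rw [h] at he0'; simp at he0'
  have hΦdd : ∀ y ∈ Ω, ∀ e', Φ (y, e') = (-(1/16) - w y) * (Real.exp (1 / 2 * (dd e' w y * dd e' w y)) * dd e' (dd e' w) y) := by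
    intro y hy e'
    simp only [hΦ, dd2_eq (S.sm y hy).two]; rfl
  have hpos : ∀ y ∈ Ω, ∀ e' : Euc n, e' ≠ 0 → 0 < dd e' (dd e' w) y := by
    intro y hy e' he'
    rw [dd_qf (S.sm y hy).two]; exact qf_pos (S.pd hy) he'
  have hen : e ≠ 0 := by intro h; rw [h] at he; simp at he
  have h1 : (1/16) * dd e (dd e w) x ≤ Φ (x, e) := by
    rw [hΦdd x hx]
    have p1 := hpos x hx e hen
    have p2 : 1 ≤ Real.exp (1 / 2 * (dd e w x * dd e w x)) := Real.one_le_exp (by nlinarith [mul_self_nonneg (dd e w x)])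
    have p3 : dd e (dd e w) x ≤ Real.exp (1 / 2 * (dd e w x * dd e w x)) * dd e (dd e w) x := by nlinarith
    exact mul_le_mul (by linarith) p3 p1.le (by linarith)
  have h2 : Φ (x, e) ≤ Φ (x0, e0) := hmax (Set.mk_mem_prod hxK (by simpa using he))
  have hs0 := hpos x0 hx0Ω e0 he0n
  have hΦ0 : 0 < Φ (x0, e0) := by nlinarith [hpos x hx e hen]
  have hv0 : 0 < -(1/16) - w x0 := by
    rw [hΦdd x0 hx0Ω] at hΦ0
    exact pos_of_mul_pos_left hΦ0 (by positivity)
  have hlm : IsLocalMax (fun y => Real.log (-(1/16) - w y) + (Real.log (dd e0 (dd e0 w) y) +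
      (1 / 2) * (dd e0 w y * dd e0 w y))) x0 := by
    have hcw : ∀ᶠ y in 𝓝 x0, w y < -(1/16) :=
      (S.sm x0 hx0Ω).diff.continuousAt.eventually_lt continuousAt_const (by linarith)
    have hlog : ∀ y ∈ Ω, w y < -(1/16) → Real.log (-(1/16) - w y) + (Real.log (dd e0 (dd e0 w) y) +
      (1 / 2) * (dd e0 w y * dd e0 w y)) = Real.log (Φ (y, e0)) := by
      intro y hy hwy
      have q1 : 0 < -(1/16) - w y := by linarith
      have q2 := hpos y hy e0 he0n
      rw [hΦdd y hy, Real.log_mul q1.ne' (by positivity), Real.log_mul (by positivity) q2.ne', Real.log_exp]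
      ring
    filter_upwards [hcw, S.ho.mem_nhds hx0Ω] with y hwy hy
    rw [hlog y hy hwy, hlog x0 hx0Ω (by linarith)]
    have q1 : 0 < -(1/16) - w y := by linarith
    have q2 := hpos y hy e0 he0n
    refine Real.log_le_log (by rw [hΦdd y hy]; positivity) (hmax (Set.mk_mem_prod (hmemK y hy hwy.le) he0))
  have hpt := pog_point (S.sm x0 hx0Ω) (by filter_upwards [S.ho.mem_nhds hx0Ω] with y hy using S.det y hy)
    (S.pd hx0Ω) (a := -(1/16)) (by linarith) he0n hlm
  have hgr : |dd e0 w x0| ≤ g := S.grad hn hd0 (hrad Ω ξ w S x0 hx0Ω hx0.2) he0'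
  have hgr2 : (dd e0 w x0) ^ 2 ≤ g ^ 2 := sq_le_sq' (by linarith [abs_le.1 hgr]) (abs_le.1 hgr).2
  set t := dd e0 (dd e0 w) x0 * (-(1/16) - w x0) with ht
  have ht0 : 0 < t := mul_pos hs0 hv0
  have htb : t ≤ n + g := by
    by_contra hcon
    push Not at hcon
    nlinarith
  have h3 : Φ (x0, e0) ≤ (n + g) * Real.exp (1 / 2 * (g * g)) := by
    rw [hΦdd x0 hx0Ω]
    have : (-(1/16) - w x0) * (Real.exp (1 / 2 * (dd e0 w x0 * dd e0 w x0)) * dd e0 (dd e0 w) x0)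
      = t * Real.exp (1 / 2 * (dd e0 w x0 * dd e0 w x0)) := by rw [ht]; ring
    rw [this]
    refine mul_le_mul htb (Real.exp_le_exp.2 (by nlinarith)) (Real.exp_pos _).le (by linarith)
  linarith

end MA
end

section
namespace MA
open Filter Topology Matrix Metric

variable {n : ℕ}

/-- second order jet at `0` of a function of one variable -/
def J2 (f : ℝ → ℝ) (f0 f1 f2 : ℝ) : Prop :=
  ∃ f' : ℝ → ℝ, (∀ᶠ t in 𝓝 (0:ℝ), HasDerivAt f (f' t) t) ∧ HasDerivAt f' f2 0 ∧ f' 0 = f1 ∧ f 0 = f0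

theorem J2.const (c : ℝ) : J2 (fun _ => c) c 0 0 :=
  ⟨fun _ => 0, Eventually.of_forall fun t => hasDerivAt_const t c, hasDerivAt_const _ _, rfl, rfl⟩

theorem J2.id : J2 (fun t => t) 0 1 0 :=
  ⟨fun _ => 1, Eventually.of_forall fun t => hasDerivAt_id t, hasDerivAt_const _ _, rfl, rfl⟩

theorem J2.add {f g : ℝ → ℝ} {f0 f1 f2 g0 g1 g2 : ℝ} (hf : J2 f f0 f1 f2) (hg : J2 g g0 g1 g2) :
    J2 (fun t => f t + g t) (f0 + g0) (f1 + g1) (f2 + g2) := by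
  obtain ⟨f', a1, a2, a3, a4⟩ := hf
  obtain ⟨g', b1, b2, b3, b4⟩ := hg
  refine ⟨fun t => f' t + g' t, ?_, a2.add b2, by simp only [a3, b3], by simp only [a4, b4]⟩
  filter_upwards [a1, b1] with t h1 h2 using h1.add h2

theorem J2.mul {f g : ℝ → ℝ} {f0 f1 f2 g0 g1 g2 : ℝ} (hf : J2 f f0 f1 f2) (hg : J2 g g0 g1 g2) :
    J2 (fun t => f t * g t) (f0 * g0) (f1 * g0 + f0 * g1) (f2 * g0 + 2 * (f1 * g1) + f0 * g2) := by
  obtain ⟨f', a1, a2, a3, a4⟩ := hf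
  obtain ⟨g', b1, b2, b3, b4⟩ := hg
  refine ⟨fun t => f' t * g t + f t * g' t, ?_, ?_, by simp only [a3, b3, a4, b4], by simp only [a4, b4]⟩
  · filter_upwards [a1, b1] with t h1 h2 using h1.mul h2
  · have h := (a2.mul b1.self_of_nhds).add (a1.self_of_nhds.mul b2)
    rw [a3, b3, a4, b4] at h
    have e : f2 * g0 + 2 * (f1 * g1) + f0 * g2 = f2 * g0 + f1 * g1 + (f1 * g1 + f0 * g2) := by ring
    rw [e]; exact h

theorem J2.smul {g : ℝ → ℝ} {g0 g1 g2 : ℝ} (c : ℝ) (hg : J2 g g0 g1 g2) :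
    J2 (fun t => c * g t) (c * g0) (c * g1) (c * g2) := by
  have h := (J2.const c).mul hg
  simpa using h

theorem J2.log {f : ℝ → ℝ} {f0 f1 f2 : ℝ} (hf : J2 f f0 f1 f2) (h0 : f0 ≠ 0) :
    J2 (fun t => Real.log (f t)) (Real.log f0) (f1 / f0) (f2 / f0 - (f1 / f0) ^ 2) := by
  obtain ⟨f', a1, a2, a3, a4⟩ := hf
  refine ⟨fun t => f' t / f t, ?_, ?_, by simp only [a3, a4], by simp only [a4]⟩
  · have hne : ∀ᶠ t in 𝓝 (0:ℝ), f t ≠ 0 := a1.self_of_nhds.continuousAt.eventually_ne (by rw [a4]; exact h0)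
    filter_upwards [a1, hne] with t h1 h2 using h1.log h2
  · have h := a2.div a1.self_of_nhds (by rw [a4]; exact h0)
    rw [a3, a4] at h
    have e : f2 / f0 - (f1 / f0) ^ 2 = (f2 * f0 - f1 * f1) / f0 ^ 2 := by field_simp
    rw [e]; exact h

theorem J2.congr {f g : ℝ → ℝ} {f0 f1 f2 : ℝ} (hf : J2 f f0 f1 f2) (h : g =ᶠ[𝓝 0] f) : J2 g f0 f1 f2 := by
  obtain ⟨f', a1, a2, a3, a4⟩ := hf
  refine ⟨f', ?_, a2, a3, by rw [h.self_of_nhds, a4]⟩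
  filter_upwards [a1, h.eventuallyEq_nhds] with t h1 h2 using h1.congr_of_eventuallyEq h2

theorem J2.line {f : Euc n → ℝ} {x : Euc n} (h : Sm f x) (b : Euc n) :
    J2 (fun t => f (x + t • b)) (f x) (dd b f x) (dd b (dd b f) x) := by
  refine ⟨fun t => dd b f (x + t • b), ?_, ?_, by simp, by simp⟩
  · filter_upwards [(line_tendsto x b).eventually h.ev] with t ht using line_hasDerivAt ht.diff
  · simpa using line_hasDerivAt (f := dd b f) (x := x) (b := b) (t := 0) (by simpa using (h.dd b).diff)

theorem J2.max {f : ℝ → ℝ} {f0 f1 f2 : ℝ} (hf : J2 f f0 f1 f2) (hm : IsLocalMax f 0) : f1 = 0 ∧ f2 ≤ 0 := by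
  obtain ⟨f', a1, a2, a3, a4⟩ := hf
  have := max_test a1 a2 hm
  rwa [a3] at this

theorem dd_lin {f g : Euc n → ℝ} {x : Euc n} (b : Euc n) (t : ℝ) (hf : Sm f x) (hg : Sm g x) :
    dd b (fun y => f y + t * g y) x = dd b f x + t * dd b g x := by
  rw [dd_add b hf.diff (hg.diff.const_mul t), dd_const_mul b t hg.diff]

theorem dd_lin_ev {f g : Euc n → ℝ} {x : Euc n} (b : Euc n) (t : ℝ) (hf : Sm f x) (hg : Sm g x) :
    dd b (fun y => f y + t * g y) =ᶠ[𝓝 x] fun y => dd b f y + t * dd b g y := by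
  filter_upwards [hf.ev, hg.ev] with y h1 h2 using dd_lin b t h1 h2

theorem dd_dir (e c : Euc n) (t : ℝ) (f : Euc n → ℝ) : dd (e + t • c) f = fun y => dd e f y + t * dd c f y := by
  ext y; rw [dd_vadd, dd_vsmul]

theorem exp2 {w : Euc n → ℝ} {y : Euc n} (h : Sm w y) (e c : Euc n) (t : ℝ) :
    dd (e + t • c) (dd (e + t • c) w) y = dd e (dd e w) y + 2 * t * dd e (dd c w) y + t ^ 2 * dd c (dd c w) y := by
  rw [dd_dir e c t w, dd_dir]
  simp only [dd_lin _ _ (h.dd _) (h.dd _)]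
  rw [dd_comm h c e]; ring

theorem exp3 {w : Euc n → ℝ} {y : Euc n} (h : Sm w y) (e c : Euc n) (t : ℝ) :
    dd (e + t • c) (dd (e + t • c) (dd (e + t • c) w)) y = dd e (dd e (dd e w)) y + 3 * t * dd e (dd e (dd c w)) y
      + 3 * t ^ 2 * dd c (dd c (dd e w)) y + t ^ 3 * dd c (dd c (dd c w)) y := by
  rw [dd_dir e c t w, dd_dir e c t, dd_dir]
  have h1 := dd_lin_ev e t (h.dd e) (h.dd c)
  have h2 := dd_lin_ev c t (h.dd e) (h.dd c)
  have s : ∀ p q, Sm (dd p (dd q w)) y := fun p q => (h.dd q).dd p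
  have h3 : (fun y => dd e (fun y => dd e w y + t * dd c w y) y + t * dd c (fun y => dd e w y + t * dd c w y) y)
    =ᶠ[𝓝 y] fun y => (fun y => dd e (dd e w) y + t * dd e (dd c w) y) y +
      t * (fun y => dd c (dd e w) y + t * dd c (dd c w) y) y := by
    filter_upwards [h1, h2] with z a1 a2
    rw [a1, a2]
  have sl : ∀ {f g : Euc n → ℝ}, Sm f y → Sm g y → Sm (fun y => f y + t * g y) y := by
    intro f g hf hg
    filter_upwards [hf, hg] with z h1 h2 using h1.add (contDiffAt_const.mul h2)
  simp only [dd_congr_at h3]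
  rw [dd_lin _ _ (sl (s _ _) (s _ _)) (sl (s _ _) (s _ _)), dd_lin _ _ (sl (s _ _) (s _ _)) (sl (s _ _) (s _ _))]
  simp only [dd_lin _ _ (s _ _) (s _ _)]
  have e1 : dd e (dd c (dd e w)) y = dd e (dd e (dd c w)) y := dd_congr_at (dd_comm_ev h c e) e
  have e2 : dd c (dd e (dd e w)) y = dd e (dd e (dd c w)) y := by rw [dd_comm3 h, dd_congr_at (dd_comm_ev h c e)]
  have e3 : dd e (dd c (dd c w)) y = dd c (dd c (dd e w)) y := (dd_comm3 h c c e).symm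
  have e4 : dd c (dd e (dd c w)) y = dd c (dd c (dd e w)) y := dd_congr_at (dd_comm_ev h e c) c
  rw [e1, e2, e3, e4]
  ring

/-- the moving direction jets -/
theorem calabi_jet {w η : Euc n → ℝ} {x : Euc n} (hs : Sm w x) (hη : Sm η x) (hη0 : 0 < η x) {e : Euc n}
    (hG : dd e (dd e w) x = 1) (hα : 0 < dd e (dd e (dd e w)) x)
    (b c : Euc n)
    (hmax : IsLocalMax (fun t : ℝ => 2 * Real.log (η (x + t • b)) +
      (2 * Real.log (dd (e + t • c) (dd (e + t • c) (dd (e + t • c) w)) (x + t • b)) +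
      (-3) * Real.log (dd (e + t • c) (dd (e + t • c) w) (x + t • b)))) 0) :
    2 * (dd b η x / η x) + (2 * ((dd b (dd e (dd e (dd e w))) x + 3 * dd e (dd e (dd c w)) x) / dd e (dd e (dd e w)) x)
      + (-3) * (dd b (dd e (dd e w)) x + 2 * dd e (dd c w) x)) = 0 ∧
    2 * (dd b (dd b η) x / η x - (dd b η x / η x) ^ 2) +
     (2 * ((dd b (dd b (dd e (dd e (dd e w)))) x + 6 * dd b (dd e (dd e (dd c w))) x + 6 * dd c (dd c (dd e w)) x) / dd e (dd e (dd e w)) x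
       - ((dd b (dd e (dd e (dd e w))) x + 3 * dd e (dd e (dd c w)) x) / dd e (dd e (dd e w)) x) ^ 2) +
      (-3) * ((dd b (dd b (dd e (dd e w))) x + 4 * dd b (dd e (dd c w)) x + 2 * dd c (dd c w) x) -
        (dd b (dd e (dd e w)) x + 2 * dd e (dd c w) x) ^ 2)) ≤ 0 := by
  have hev := (line_tendsto x b).eventually hs.ev
  have j1 := ((J2.line hη b).log hη0.ne').smul 2
  have t2 := J2.id.mul J2.id
  have t3 := J2.id.mul t2
  have sm3 : ∀ p q r, Sm (dd p (dd q (dd r w))) x := fun p q r => ((hs.dd r).dd q).dd p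
  have sm2 : ∀ p q, Sm (dd p (dd q w)) x := fun p q => ((hs.dd q)).dd p
  have ja := (((J2.line (sm3 e e e) b).add ((J2.id.smul 3).mul (J2.line (sm3 e e c) b))).add
    ((t2.smul 3).mul (J2.line (sm3 c c e) b))).add (t3.mul (J2.line (sm3 c c c) b))
  have jg := (((J2.line (sm2 e e) b).add ((J2.id.smul 2).mul (J2.line (sm2 e c) b))).add
    (t2.mul (J2.line (sm2 c c) b)))
  have ja' := ja.congr (g := fun t => dd (e + t • c) (dd (e + t • c) (dd (e + t • c) w)) (x + t • b)) (by
    filter_upwards [hev] with t ht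
    rw [exp3 ht]; ring)
  have jg' := jg.congr (g := fun t => dd (e + t • c) (dd (e + t • c) w) (x + t • b)) (by
    filter_upwards [hev] with t ht
    rw [exp2 ht]; ring)
  simp only [mul_zero, zero_mul, mul_one, add_zero, zero_add] at ja' jg'
  have jall := (j1.add (((ja'.log hα.ne').smul 2).add ((jg'.log (by rw [hG]; norm_num)).smul (-3)))).max hmax
  obtain ⟨r1, r2⟩ := jall
  rw [hG] at r1 r2
  simp only [div_one] at r1 r2
  constructor
  · linear_combination r1
  · refine le_trans (le_of_eq ?_) r2
    ring

end MA
end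

section
namespace MA
open Filter Topology Matrix Metric

variable {n : ℕ}

theorem dd_cmul (b : Euc n) (s : ℝ) (f : Euc n → ℝ) : dd b (fun y => s * f y) = fun y => s * dd b f y := by
  ext y
  simp only [dd]
  have : (fun y => s * f y) = s • f := rfl
  rw [this, fderiv_const_smul_field]; simp

theorem dd_sdir (s : ℝ) (b : Euc n) (f : Euc n → ℝ) : dd (s • b) f = fun y => s * dd b f y := by
  ext y; rw [dd_vsmul]

theorem dd_zdir (f : Euc n → ℝ) : dd (0 : Euc n) f = fun _ => 0 := by
  ext y; simp [dd]

theorem dd_zfun (b : Euc n) : dd b (fun _ : Euc n => (0:ℝ)) = fun _ => 0 := by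
  ext y; exact dd_const _ _ _

theorem calabi_point {w η : Euc n → ℝ} {x : Euc n} (hs : Sm w x) (hd : ∀ᶠ y in 𝓝 x, hessDet w y = 1)
    (hp : (hessianMatrix w x).PosDef) (hη : Sm η x) (hη0 : 0 < η x) {e : Euc n}
    (hG : dd e (dd e w) x = 1) (hα : 0 < dd e (dd e (dd e w)) x)
    (hmax : ∀ b c : Euc n, IsLocalMax (fun t : ℝ => 2 * Real.log (η (x + t • b)) +
      (2 * Real.log (dd (e + t • c) (dd (e + t • c) (dd (e + t • c) w)) (x + t • b)) +
      (-3) * Real.log (dd (e + t • c) (dd (e + t • c) w) (x + t • b)))) 0) :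
    ∃ b, Frame (hessianMatrix w x) b ∧ (dd e (dd e (dd e w)) x) ^ 2 ≤
      8 * ∑ k, (dd (b k) η x / η x) ^ 2 - 4 * ∑ k, (dd (b k) (dd (b k) η) x / η x) := by
  have K := fun b c => calabi_jet hs hη hη0 hG hα b c (hmax b c)
  set α := dd e (dd e (dd e w)) x with hαd
  have o1 : ∀ c, dd e (dd e (dd c w)) x = α * dd e (dd c w) x := by
    intro c
    have h := (K 0 c).1
    simp only [dd_zdir] at h
    have h3 : dd e (dd e (dd c w)) x / α = dd e (dd c w) x := by linear_combination h / 6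
    rw [div_eq_iff hα.ne'] at h3
    linarith
  have o2 : ∀ c, dd e (dd c w) x = 0 → dd c (dd c (dd e w)) x ≤ α / 2 * dd c (dd c w) x := by
    intro c hc
    have h := (K 0 c).2
    have h1 := o1 c
    simp only [dd_zdir, h1, hc] at h
    norm_num at h
    rw [← sub_nonpos]
    have h2 := mul_nonpos_of_nonneg_of_nonpos (show 0 ≤ α / 12 by positivity) (sub_nonpos.2 h)
    refine le_trans (le_of_eq ?_) h2
    field_simp; ring
  have hsN : Sm (dd e w) x := hs.dd e
  obtain ⟨b, μ, hb, hμ⟩ := exists_frame (N := hessianMatrix (dd e w) x) hp (hess_symm hsN.two)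
  have hμ' : ∀ j k, dd (b j) (dd (b k) (dd e w)) x = if j = k then μ j else 0 := by
    intro j k
    rw [dd_qf hsN.two, ← fm_apply, hμ, Matrix.diagonal_apply]
  set ε : Fin n → ℝ := fun k => qf (hessianMatrix w x) (b k) e with hε
  have hexp : e = ∑ k, ε k • b k := hb.expand e
  have hek : ∀ k, dd e (dd (b k) w) x = ε k := by
    intro k; rw [dd_comm hs, dd_qf hs.two]
  have heek : ∀ k, dd e (dd e (dd (b k) w)) x = ε k * μ k := by
    intro k
    rw [dd_congr_at (dd_comm_ev hs e (b k)), ]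
    conv_lhs => rw [hexp]
    rw [dd_vsum, Finset.sum_eq_single k]
    · rw [← hexp, hμ']; simp
    · intro j _ hj
      rw [← hexp, hμ', if_neg hj, mul_zero]
    · simp
  have hμε : ∀ k, ε k ≠ 0 → μ k = α := by
    intro k hk
    have h1 := o1 (b k)
    rw [heek, hek] at h1
    apply mul_left_cancel₀ hk
    linarith
  obtain ⟨j0, hj0⟩ : ∃ j, ε j ≠ 0 := by
    by_contra hcon
    push Not at hcon
    have : e = 0 := by rw [hexp]; simp [hcon]
    rw [this, dd_zdir] at hG
    norm_num at hG
  have hε0 : ∀ k, k ≠ j0 → ε k = 0 := by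
    intro k hk
    by_contra hne
    have hc1 : dd e (dd (ε k • b j0 + (-(ε j0)) • b k) w) x = 0 := by
      rw [dd_dir, dd_sdir, dd_lin _ _ (by
        filter_upwards [hs.dd (b j0)] with z h1 using contDiffAt_const.mul h1) (hs.dd _), dd_cmul]
      simp only [hek]
      ring
    have h2 := o2 _ hc1
    rw [exp2 hsN, exp2 hs] at h2
    simp only [dd_sdir, dd_cmul] at h2
    rw [hμ', hμ', hμ', frame_one hs.two hb, frame_one hs.two hb, frame_one hs.two hb] at h2
    simp only [if_true, if_neg hk.symm, hμε k hne, hμε j0 hj0] at h2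
    have p1 : 0 < ε k ^ 2 := by positivity
    nlinarith [sq_nonneg (ε j0), mul_pos hα p1, mul_nonneg hα.le (sq_nonneg (ε j0))]
  have hej : e = ε j0 • b j0 := by
    conv_lhs => rw [hexp]
    exact Finset.sum_eq_single j0 (fun k _ hk => by rw [hε0 k hk, zero_smul]) (by simp)
  have hε1 : ε j0 ^ 2 = 1 := by
    have h1 : dd e (dd e w) x = ε j0 * ε j0 := by
      conv_lhs => rw [dd_comm hs]
      conv_lhs => arg 2; rw [hej]
      rw [dd_sdir, dd_cmul]
      simp only [hek]
    rw [hG] at h1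
    rw [sq, ← h1]
  have hμj : μ j0 = α := hμε j0 hj0
  have hμk : ∀ k, k ≠ j0 → μ k ≤ α / 2 := by
    intro k hk
    have h1 := o2 (b k) (by rw [hek, hε0 k hk])
    rw [hμ', frame_one hs.two hb] at h1
    simpa using h1
  have hbj : b j0 = ε j0 • e := by
    conv_rhs => rw [hej]
    rw [smul_smul, ← sq, hε1, one_smul]
  set W4 := dd e (dd e (dd e (dd e w))) x with hW4
  set q : Fin n → ℝ := fun k => dd e (dd e (dd (b k) (dd (b k) w))) x with hq
  set r : Fin n → ℝ := fun k => dd e (dd e (dd e (dd (b k) (dd (b k) w)))) x with hr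
  set h : Fin n → ℝ := fun k => dd (b k) η x / η x with hh
  have kr : ∀ k, dd (b k) (dd (b k) (dd e (dd e (dd e w)))) x = r k := fun k => dd_comm5 hs _ _ _ _ _
  have kq : ∀ k, dd (b k) (dd (b k) (dd e (dd e w))) x = q k := fun k => dd_comm4 hs _ _ _ _
  have kA : ∀ k, dd (b k) (dd e (dd e w)) x = ε k * μ k := fun k => by
    rw [dd_comm3 hs, dd_congr_at (dd_comm_ev hs (b k) e), heek]
  have U : ∀ k, 2 * (dd (b k) (dd (b k) η) x / η x) - 4 * h k ^ 2 + (2 / α) * (r k - 3 * (μ k * q k) + 1.5 * μ k ^ 3)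
      - 3 * q k + 4.5 * μ k ^ 2 ≤ 0 := by
    intro k
    by_cases hk : k = j0
    · subst hk
      obtain ⟨k1, k2⟩ := K (b k) 0
      have kp : dd (b k) (dd e (dd e (dd e w))) x = ε k * W4 := by
        conv_lhs => rw [hbj]
        rw [dd_vsmul]
      have kW : q k = W4 := by
        simp only [hq]
        rw [hbj]
        simp only [dd_sdir, dd_cmul]
        rw [← mul_assoc, ← sq, hε1, one_mul]
      simp only [dd_zdir, dd_zfun, kr, kq, kA, kp, hμj] at k1 k2
      have k3 : h k = 1.5 * (ε k * α) - ε k * W4 / α := by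
        simp only [hh]; field_simp at k1 ⊢; linarith
      rw [← show h k = dd (b k) η x / η x from rfl] at k2
      rw [kW] at k2 ⊢
      rw [hμj]
      refine le_trans (le_of_eq ?_) k2
      rw [k3]
      field_simp
      linear_combination (η x * (6 * α ^ 2 * W4 - 7.5 * α ^ 4)) * hε1
    · obtain ⟨k1, k2⟩ := K (b k) ((-(1/2) * μ k) • b k)
      have z1 : dd (b k) (dd e (dd e (dd (b k) w))) x = q k := by
        rw [← kq, dd_congr_at (f := dd e (dd e (dd (b k) w))) (g := dd (b k) (dd e (dd e w)))]
        filter_upwards [hs.ev] with y hy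
        exact dd_comm3 hy e e (b k)
      have z2 : dd (b k) (dd e (dd (b k) w)) x = μ k := by
        rw [dd_congr_at (dd_comm_ev hs e (b k)), hμ']; simp
      simp only [dd_sdir, dd_cmul, kr, kq, kA, hε0 k hk, hek, heek, hμ', frame_one hs.two hb, z1, z2] at k1 k2
      simp only [if_true] at k1 k2
      rw [← show h k = dd (b k) η x / η x from rfl] at k1 k2
      set p := dd (b k) (dd e (dd e (dd e w))) x with hpd
      have k3 : h k = - (p / α) := by
        have : (p + 3 * (-(1 / 2) * μ k * (0 * μ k))) / α = p / α := by ring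
        rw [this] at k1
        linarith
      refine le_trans (le_of_eq ?_) k2
      rw [k3]
      field_simp
      ring
  have Us := Finset.sum_nonpos fun k (_ : k ∈ Finset.univ) => U k
  simp only [Finset.sum_add_distrib, Finset.sum_sub_distrib, ← Finset.mul_sum] at Us
  obtain ⟨-, J2, J3⟩ := frame_jac hs hd hb e
  have kAe : ∀ j k, dd e (dd (b j) (dd (b k) w)) x = if j = k then μ j else 0 := by
    intro j k; rw [← hμ' j k]; exact (dd_comm3 hs (b j) (b k) e).symm
  have hmat : (Matrix.of fun j k => dd e (dd (b j) (dd (b k) w)) x : Mat n) = diagonal μ := by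
    ext j k; rw [Matrix.diagonal_apply]; exact kAe j k
  rw [hmat] at J3
  simp only [kAe, diagonal_mul_diagonal, trace_diagonal, ite_mul, zero_mul, Finset.sum_ite_eq, Finset.mem_univ, if_true] at J2 J3
  have J2' : ∑ k, q k = ∑ k, μ k ^ 2 := by
    rw [hq]; rw [J2]
    exact Finset.sum_congr rfl fun k _ => by ring
  have J3' : ∑ k, r k = 3 * ∑ k, μ k * q k - 2 * ∑ k, μ k ^ 3 := by
    rw [hr]; rw [J3]
    congr 2
    exact Finset.sum_congr rfl fun k _ => by ring
  rw [J2', J3'] at Us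
  have V : α ^ 2 / 2 ≤ ∑ k, (1.5 * μ k ^ 2 - μ k ^ 3 / α) := by
    have v1 : ∀ k, 0 ≤ 1.5 * μ k ^ 2 - μ k ^ 3 / α := by
      intro k
      have : 1.5 * μ k ^ 2 - μ k ^ 3 / α = μ k ^ 2 * (1.5 - μ k / α) := by field_simp
      rw [this]
      refine mul_nonneg (sq_nonneg _) ?_
      have : μ k / α ≤ 1 := by
        rw [div_le_one hα]
        by_cases hk : k = j0
        · rw [hk, hμj]
        · linarith [hμk k hk]
      linarith
    refine le_trans (le_of_eq ?_) (Finset.single_le_sum (f := fun k => 1.5 * μ k ^ 2 - μ k ^ 3 / α) (fun k _ => v1 k) (Finset.mem_univ j0))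
    simp only [hμj]; field_simp; ring
  rw [Finset.sum_sub_distrib, ← Finset.mul_sum, ← Finset.sum_div] at V
  refine ⟨b, hb, ?_⟩
  have Us2 : 2 / α * (3 * ∑ k, μ k * q k - 2 * ∑ k, μ k ^ 3 - 3 * ∑ i, μ i * q i + 1.5 * ∑ i, μ i ^ 3) =
     - ((∑ k, μ k ^ 3) / α) := by field_simp; ring
  rw [Us2] at Us
  simp only [hh] at Us
  linarith

end MA
end

section
namespace MA
open Filter Topology Matrix Metric

variable {n : ℕ}

/-- the cutoff function -/
def cut (p : Euc n) (r : ℝ) : Euc n → ℝ := fun y => r ^ 2 - ‖y - p‖ ^ 2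

theorem sm_cut (p : Euc n) (r : ℝ) (x : Euc n) : Sm (cut p r) x :=
  Eventually.of_forall fun y => contDiffAt_const.sub (sm_nsq p y)

theorem dd_cut (p : Euc n) (r : ℝ) (b x : Euc n) : dd b (cut p r) x = -2 * ⟪x - p, b⟫ := by
  unfold cut
  rw [dd_sub _ (differentiableAt_const _) ((sm_nsq (N := 1) p x).differentiableAt (by norm_num)), dd_const, dd_nsq]; ring

theorem dd2_cut (p : Euc n) (r : ℝ) (b x : Euc n) : dd b (dd b (cut p r)) x = -2 * ‖b‖ ^ 2 := by
  unfold cut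
  rw [dd2_sub _ _ contDiffAt_const (sm_nsq p x), dd2_nsq, real_inner_self_eq_norm_sq]
  have : dd b (fun _ : Euc n => r ^ 2) = fun _ => 0 := by ext y; exact dd_const _ _ _
  rw [this, dd_const]; ring

theorem dd3_eq {f : Euc n → ℝ} {x : Euc n} (h : Sm f x) (a b c : Euc n) :
    dd a (dd b (dd c f)) x = fderiv ℝ (fderiv ℝ (fderiv ℝ f)) x a b c := by
  have e1 : dd b (dd c f) =ᶠ[𝓝 x] fun y => fderiv ℝ (fderiv ℝ f) y b c := by
    filter_upwards [h.ev] with y hy using dd2_eq hy.two b c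
  rw [dd_congr_at e1]
  have h1 : ContDiffAt ℝ 2 (fderiv ℝ f) x := (h.nat 3).fderiv_right (by norm_num)
  have h2 : ContDiffAt ℝ 1 (fderiv ℝ (fderiv ℝ f)) x := h1.fderiv_right (by norm_num)
  have h3 := (h2.differentiableAt (by norm_num)).hasFDerivAt
  have h4 := (h3.clm_apply (hasFDerivAt_const b x)).clm_apply (hasFDerivAt_const c x)
  simp only [dd]
  rw [h4.fderiv]
  simp

theorem Sm.cont3 {f : Euc n → ℝ} {x : Euc n} (h : Sm f x) : ContinuousAt (fderiv ℝ (fderiv ℝ (fderiv ℝ f))) x := by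
  have h1 : ContDiffAt ℝ 2 (fderiv ℝ f) x := (h.nat 3).fderiv_right (by norm_num)
  have h2 : ContDiffAt ℝ 1 (fderiv ℝ (fderiv ℝ f)) x := h1.fderiv_right (by norm_num)
  exact (h2.fderiv_right (m := 0) (by norm_num)).continuousAt

theorem pd_of_low {w : Euc n → ℝ} {y : Euc n} (hs : ContDiffAt ℝ 2 w y) (hd : hessDet w y = 1) {l : ℝ} (hl : 0 < l)
    (hlow : ∀ z, l * ‖z‖ ^ 2 ≤ qf (hessianMatrix w y) z z) : (hessianMatrix w y).PosDef := by
  refine PD_of_PSD_det (PSD_of_qf (hess_symm hs) fun z => le_trans (by positivity) (hlow z)) ?_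
  have : (hessianMatrix w y).det = 1 := hd
  rw [this]; norm_num

theorem tendsto_clm {α E F : Type*} [NormedAddCommGroup E] [NormedSpace ℝ E] [NormedAddCommGroup F] [NormedSpace ℝ F]
    {l : Filter α} {f : α → E →L[ℝ] F} {g : α → E} {f0 : E →L[ℝ] F} {g0 : E} (hf : Tendsto f l (𝓝 f0))
    (hg : Tendsto g l (𝓝 g0)) : Tendsto (fun t => f t (g t)) l (𝓝 (f0 g0)) :=
  ((isBoundedBilinearMap_apply (𝕜 := ℝ) (E := E) (F := F)).continuous.tendsto (f0, g0)).comp (hf.prodMk_nhds hg)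

theorem calabi_bound {w : Euc n → ℝ} {p : Euc n} {r l Λ : ℝ} (hr : 0 < r) (hl : 0 < l)
    (hs : ∀ y ∈ closedBall p r, Sm w y) (hd : ∀ y ∈ closedBall p r, hessDet w y = 1)
    (hlow : ∀ y ∈ closedBall p r, ∀ z, l * ‖z‖ ^ 2 ≤ qf (hessianMatrix w y) z z)
    (hup : ∀ y ∈ closedBall p r, ∀ z, qf (hessianMatrix w y) z z ≤ Λ * ‖z‖ ^ 2) :
    ∀ y ∈ closedBall p (r / 2), ∀ e, (dd e (dd e (dd e w)) y) ^ 2 ≤ 80 * n * Λ ^ 3 / (l * r ^ 2) * (‖e‖ ^ 2) ^ 3 := by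
  have hpd : ∀ y ∈ closedBall p r, (hessianMatrix w y).PosDef := fun y hy =>
    pd_of_low (hs y hy).two (hd y hy) hl (hlow y hy)
  have hGp : ∀ y ∈ closedBall p r, ∀ e, e ≠ 0 → 0 < dd e (dd e w) y := fun y hy e he => by
    rw [dd_qf (hs y hy).two]; exact qf_pos (hpd y hy) he
  set η := cut p r with hη
  set Ψ : Euc n → Euc n → ℝ := fun y e => (η y) ^ 2 * (dd e (dd e (dd e w)) y) ^ 2 / (dd e (dd e w) y) ^ 3 with hΨ
  have hhom : ∀ y e (s : ℝ), s ≠ 0 → Ψ y (s • e) = Ψ y e := by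
    intro y e s hs0
    simp only [hΨ, dd_sdir, dd_cmul]
    have : η y ^ 2 * (s * (s * (s * dd e (dd e (dd e w)) y))) ^ 2 / (s * (s * dd e (dd e w) y)) ^ 3 =
      (s ^ 6 * (η y ^ 2 * (dd e (dd e (dd e w)) y) ^ 2)) / (s ^ 6 * (dd e (dd e w) y) ^ 3) := by congr 1 <;> ring
    rw [this, mul_div_mul_left _ _ (pow_ne_zero 6 hs0)]
  set C : ℝ := 40 * n * r ^ 2 / l with hC
  have hC0 : 0 ≤ C := by positivity
  suffices H : ∀ y ∈ closedBall p r, ∀ e, ‖e‖ = 1 → Ψ y e ≤ C by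
    intro y hy e
    have hyr : y ∈ closedBall p r := closedBall_subset_closedBall (by linarith) hy
    by_cases he : e = 0
    · subst he; simp [dd_zdir]
    have hen : 0 < ‖e‖ := norm_pos_iff.2 he
    have h1 := H y hyr (‖e‖⁻¹ • e) (by rw [norm_smul]; simp [hen.ne'])
    rw [hhom y e _ (by positivity)] at h1
    have hG := hGp y hyr e he
    have hGu : dd e (dd e w) y ≤ Λ * ‖e‖ ^ 2 := by rw [dd_qf (hs y hyr).two]; exact hup y hyr e
    simp only [hΨ] at h1
    rw [div_le_iff₀ (by positivity)] at h1
    have hη1 : 3 / 4 * r ^ 2 ≤ η y := by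
      have : ‖y - p‖ ≤ r / 2 := by rwa [mem_closedBall, dist_eq_norm] at hy
      have h2 : ‖y - p‖ ^ 2 ≤ (r / 2) ^ 2 := pow_le_pow_left₀ (norm_nonneg _) this 2
      simp only [hη, cut]; nlinarith
    have hη2 : r ^ 4 / 2 ≤ η y ^ 2 := by
      have := pow_le_pow_left₀ (by positivity) hη1 2
      nlinarith [pow_pos hr 4]
    have h3 : dd e (dd e w) y ^ 3 ≤ (Λ * ‖e‖ ^ 2) ^ 3 := pow_le_pow_left₀ hG.le hGu 3
    have h4 : r ^ 4 / 2 * (dd e (dd e (dd e w)) y) ^ 2 ≤ C * (Λ * ‖e‖ ^ 2) ^ 3 :=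
      (mul_le_mul_of_nonneg_right hη2 (sq_nonneg _)).trans (h1.trans (mul_le_mul_of_nonneg_left h3 hC0))
    have h5 : 80 * n * Λ ^ 3 / (l * r ^ 2) * (‖e‖ ^ 2) ^ 3 = (2 / r ^ 4) * (C * (Λ * ‖e‖ ^ 2) ^ 3) := by
      rw [hC]; field_simp; ring
    rw [h5]
    have h6 := mul_le_mul_of_nonneg_left h4 (show 0 ≤ 2 / r ^ 4 by positivity)
    refine le_trans (le_of_eq ?_) h6
    field_simp
  -- the maximum
  intro y hy e he
  have hcont : ContinuousOn (fun q : Euc n × Euc n => Ψ q.1 q.2) (closedBall p r ×ˢ sphere (0 : Euc n) 1) := by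
    have a0 : ContinuousOn (fun q : Euc n × Euc n => η q.1) (closedBall p r ×ˢ sphere (0 : Euc n) 1) := by
      intro q hq
      exact (ContinuousAt.comp (f := Prod.fst) (sm_cut p r q.1).diff.continuousAt continuousAt_fst).continuousWithinAt
    have a2 : ContinuousOn (fun q : Euc n × Euc n => fderiv ℝ (fderiv ℝ w) q.1) (closedBall p r ×ˢ sphere (0 : Euc n) 1) := by
      intro q hq
      exact (ContinuousAt.comp (f := Prod.fst) (hs q.1 hq.1).cont2 continuousAt_fst).continuousWithinAt
    have a1 : ContinuousOn (fun q : Euc n × Euc n => fderiv ℝ (fderiv ℝ (fderiv ℝ w)) q.1) (closedBall p r ×ˢ sphere (0 : Euc n) 1) := by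
      intro q hq
      exact (ContinuousAt.comp (f := Prod.fst) (hs q.1 hq.1).cont3 continuousAt_fst).continuousWithinAt
    have a3 : ContinuousOn (fun p : Euc n × Euc n => p.2) (closedBall p r ×ˢ sphere (0 : Euc n) 1) := continuousOn_snd
    have b3 : ContinuousOn (fun q : Euc n × Euc n => dd q.2 (dd q.2 (dd q.2 w)) q.1) (closedBall p r ×ˢ sphere (0 : Euc n) 1) :=
      (((a1.clm_apply a3).clm_apply a3).clm_apply a3).congr fun q hq => dd3_eq (hs q.1 hq.1) _ _ _
    have b2 : ContinuousOn (fun q : Euc n × Euc n => dd q.2 (dd q.2 w) q.1) (closedBall p r ×ˢ sphere (0 : Euc n) 1) :=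
      ((a2.clm_apply a3).clm_apply a3).congr fun q hq => dd2_eq (hs q.1 hq.1).two _ _
    refine ((a0.pow 2).mul (b3.pow 2)).div (b2.pow 3) ?_
    intro q hq
    have : q.2 ≠ 0 := by intro h; have := hq.2; rw [h] at this; simp at this
    exact (pow_pos (hGp q.1 hq.1 q.2 this) 3).ne'
  obtain ⟨⟨x0, e0⟩, ⟨hx0, he0⟩, hmax⟩ := ((isCompact_closedBall p r).prod (isCompact_sphere (0 : Euc n) 1)).exists_isMaxOn
    ⟨(y, e), hy, by simpa using he⟩ hcont
  have hmax' : ∀ z ∈ closedBall p r, ∀ e, e ≠ 0 → Ψ z e ≤ Ψ x0 e0 := by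
    intro z hz e he
    have hen : 0 < ‖e‖ := norm_pos_iff.2 he
    rw [← hhom z e (‖e‖⁻¹) (by positivity)]
    exact hmax (a := (z, ‖e‖⁻¹ • e)) (Set.mk_mem_prod hz (by simp [norm_smul, hen.ne']))
  have hene : e ≠ 0 := by intro h; rw [h] at he; simp at he
  refine (hmax' y hy e hene).trans ?_
  have he0' : ‖e0‖ = 1 := by simpa using he0
  have he0n : e0 ≠ 0 := by intro h; rw [h] at he0'; simp at he0'
  by_cases hM : Ψ x0 e0 ≤ 0
  · exact hM.trans hC0
  push Not at hM
  have hG0 := hGp x0 hx0 e0 he0n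
  have hηne : η x0 ≠ 0 := by
    intro h; simp only [hΨ, h] at hM; norm_num at hM
  have hA0 : dd e0 (dd e0 (dd e0 w)) x0 ≠ 0 := by
    intro h; simp only [hΨ, h] at hM; norm_num at hM
  have hx0' : ‖x0 - p‖ ≤ r := by rwa [mem_closedBall, dist_eq_norm] at hx0
  have hη0 : 0 < η x0 := by
    refine lt_of_le_of_ne ?_ hηne.symm
    simp only [hη, cut, sub_nonneg]
    exact pow_le_pow_left₀ (norm_nonneg _) hx0' 2
  have hx0b : x0 ∈ ball p r := by
    rw [mem_ball, dist_eq_norm]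
    refine lt_of_le_of_ne hx0' fun h => hηne ?_
    simp [hη, cut, h]
  -- normalize the direction
  obtain ⟨s, hs0, hs1, hs2⟩ : ∃ s : ℝ, s ≠ 0 ∧ s ^ 2 * dd e0 (dd e0 w) x0 = 1 ∧ 0 < s ^ 3 * dd e0 (dd e0 (dd e0 w)) x0 := by
    set G := dd e0 (dd e0 w) x0
    have hsq : Real.sqrt G ^ 2 = G := Real.sq_sqrt hG0.le
    have hsp : 0 < Real.sqrt G := Real.sqrt_pos.2 hG0
    rcases lt_or_gt_of_ne hA0 with h | h
    · refine ⟨-(Real.sqrt G)⁻¹, by simpa using hsp.ne', ?_, ?_⟩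
      · rw [neg_sq, inv_pow, hsq]; field_simp
      · have : 0 < ((Real.sqrt G)⁻¹) ^ 3 := by positivity
        nlinarith
    · refine ⟨(Real.sqrt G)⁻¹, by simpa using hsp.ne', ?_, by positivity⟩
      · rw [inv_pow, hsq]; field_simp
  set e1 : Euc n := s • e0 with he1
  have he1n : e1 ≠ 0 := smul_ne_zero hs0 he0n
  have hG1 : dd e1 (dd e1 w) x0 = 1 := by
    simp only [he1, dd_sdir, dd_cmul]; rw [← hs1]; ring
  have hA1 : 0 < dd e1 (dd e1 (dd e1 w)) x0 := by
    simp only [he1, dd_sdir, dd_cmul]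
    refine lt_of_lt_of_eq hs2 (by ring)
  have hΨ1 : Ψ x0 e1 = Ψ x0 e0 := hhom x0 e0 s hs0
  have hM1 : Ψ x0 e1 = η x0 ^ 2 * (dd e1 (dd e1 (dd e1 w)) x0) ^ 2 := by
    simp only [hΨ, hG1]; ring
  have hlm : ∀ b c : Euc n, IsLocalMax (fun t : ℝ => 2 * Real.log (η (x0 + t • b)) +
      (2 * Real.log (dd (e1 + t • c) (dd (e1 + t • c) (dd (e1 + t • c) w)) (x0 + t • b)) +
      (-3) * Real.log (dd (e1 + t • c) (dd (e1 + t • c) w) (x0 + t • b)))) 0 := by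
    intro b c
    have hsx := hs x0 hx0
    have t1 := line_tendsto x0 b
    have ev1 : ∀ᶠ t in 𝓝 (0:ℝ), x0 + t • b ∈ ball p r := t1.eventually (isOpen_ball.mem_nhds hx0b)
    have ev2 : ∀ᶠ t in 𝓝 (0:ℝ), 0 < η (x0 + t • b) := t1.eventually
      ((sm_cut p r x0).diff.continuousAt.eventually (lt_mem_nhds hη0))
    have tc : Tendsto (fun t : ℝ => e1 + t • c) (𝓝 0) (𝓝 e1) := line_tendsto e1 c
    have ev3 : ∀ᶠ t in 𝓝 (0:ℝ), e1 + t • c ≠ 0 := tc.eventually_ne he1n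
    have ev4 : ∀ᶠ t in 𝓝 (0:ℝ), 0 < dd (e1 + t • c) (dd (e1 + t • c) (dd (e1 + t • c) w)) (x0 + t • b) := by
      have c3 : Tendsto (fun t : ℝ => fderiv ℝ (fderiv ℝ (fderiv ℝ w)) (x0 + t • b) (e1 + t • c) (e1 + t • c) (e1 + t • c)) (𝓝 0)
        (𝓝 (fderiv ℝ (fderiv ℝ (fderiv ℝ w)) x0 e1 e1 e1)) :=
        by
          have T3 : Tendsto (fun t : ℝ => fderiv ℝ (fderiv ℝ (fderiv ℝ w)) (x0 + t • b)) (𝓝 0) (𝓝 (fderiv ℝ (fderiv ℝ (fderiv ℝ w)) x0)) := hsx.cont3.tendsto.comp t1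
          exact tendsto_clm (tendsto_clm (tendsto_clm T3 tc) tc) tc
      rw [dd3_eq hsx] at hA1
      filter_upwards [c3.eventually (lt_mem_nhds hA1), t1.eventually hsx.ev] with t h1 h2
      rw [dd3_eq h2]; exact h1
    have hlog : ∀ (z e' : Euc n), 0 < η z → 0 < dd e' (dd e' w) z → 0 < dd e' (dd e' (dd e' w)) z →
       2 * Real.log (η z) + (2 * Real.log (dd e' (dd e' (dd e' w)) z) + (-3) * Real.log (dd e' (dd e' w) z)) = Real.log (Ψ z e') := by
      intro z e' h1 h2 h3
      simp only [hΨ]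
      rw [Real.log_div (by positivity) (by positivity), Real.log_mul (by positivity) (by positivity),
        Real.log_pow, Real.log_pow, Real.log_pow]
      push_cast; ring
    filter_upwards [ev1, ev2, ev3, ev4] with t h1 h2 h3 h4
    have h5 := hGp _ (ball_subset_closedBall h1) _ h3
    rw [hlog _ _ h2 h5 h4]
    have h6 := hlog x0 e1 hη0 (by rw [hG1]; norm_num) hA1
    simp only [zero_smul, add_zero]
    rw [h6]
    refine Real.log_le_log (by simp only [hΨ]; positivity) ?_
    rw [hΨ1]
    exact hmax' _ (ball_subset_closedBall h1) _ h3
  obtain ⟨b, hb, hfin⟩ := calabi_point (hs x0 hx0) (by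
    filter_upwards [isOpen_ball.mem_nhds hx0b] with z hz using hd z (ball_subset_closedBall hz))
    (hpd x0 hx0) (sm_cut p r x0) hη0 hG1 hA1 hlm
  rw [← hΨ1, hM1]
  have hbk := frame_upper hb hl (hlow x0 hx0)
  have hg := frame_gamma_le hbk (x0 - p)
  have m := mul_le_mul_of_nonneg_left hfin (sq_nonneg (η x0))
  refine m.trans ?_
  have i1 : ∀ k, (dd (b k) (cut p r) x0 / cut p r x0) ^ 2 = 4 * (η x0 ^ 2)⁻¹ * ⟪b k, x0 - p⟫ ^ 2 := by
    intro k
    rw [dd_cut, real_inner_comm, ← hη]; field_simp; ring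
  have i2 : ∀ k, dd (b k) (dd (b k) (cut p r)) x0 / cut p r x0 = -2 * (η x0)⁻¹ * ‖b k‖ ^ 2 := by
    intro k
    rw [dd2_cut, ← hη]; field_simp
  simp only [i1, i2, ← Finset.mul_sum]
  have i3 : ∑ k, ‖b k‖ ^ 2 ≤ n * l⁻¹ := by
    refine (Finset.sum_le_sum fun k _ => hbk k).trans (by simp)
  have i4 : η x0 ≤ r ^ 2 := by simp only [hη, cut]; nlinarith [sq_nonneg ‖x0 - p‖]
  have i5 : ‖x0 - p‖ ^ 2 ≤ r ^ 2 := pow_le_pow_left₀ (norm_nonneg _) hx0' 2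
  have i6 : η x0 ^ 2 * (8 * (4 * (η x0 ^ 2)⁻¹ * ∑ k, ⟪b k, x0 - p⟫ ^ 2) - 4 * (-2 * (η x0)⁻¹ * ∑ k, ‖b k‖ ^ 2)) =
    32 * ∑ k, ⟪b k, x0 - p⟫ ^ 2 + 8 * (η x0 * ∑ k, ‖b k‖ ^ 2) := by field_simp; ring
  rw [i6]
  have i7 : η x0 * ∑ k, ‖b k‖ ^ 2 ≤ r ^ 2 * (n * l⁻¹) := mul_le_mul i4 i3 (Finset.sum_nonneg fun k _ => sq_nonneg _) (by positivity)
  have i8 : ∑ k, ⟪b k, x0 - p⟫ ^ 2 ≤ n * l⁻¹ * r ^ 2 := hg.trans (mul_le_mul_of_nonneg_left i5 (by positivity))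
  have : C = 32 * (n * l⁻¹ * r ^ 2) + 8 * (r ^ 2 * (n * l⁻¹)) := by rw [hC]; field_simp; ring
  rw [this]; linarith

end MA
end

section
namespace MA
open Filter Topology Matrix Metric

variable {n : ℕ}

set_option maxHeartbeats 1000000 in
theorem bern (n : ℕ) {B lam C r : ℝ} (hB : 0 ≤ B) (hlam : 0 < lam) (hC : 0 < C) (hr : 0 < r) :
    ∃ C' : ℝ, 0 ≤ C' ∧ ∀ (p q : Euc n → ℝ) (c : Euc n), (∀ x ∈ closedBall c r, Sm p x) → (∀ x ∈ closedBall c r, Sm q x) →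
      (∀ x ∈ closedBall c r, 0 ≤ p x ∧ p x ≤ C) → (∀ x ∈ closedBall c r, 0 ≤ q x) →
      (∀ x ∈ ball c r, 1 ≤ q x → ∃ b : Fin n → Euc n, (∀ k, ‖b k‖ ^ 2 ≤ B) ∧
        lam * q x ≤ ∑ k, dd (b k) (dd (b k) p) x + C ∧ ∑ k, (dd (b k) p x) ^ 2 ≤ C * q x ∧
        -(C * (q x * Real.sqrt (q x))) ≤ ∑ k, dd (b k) (dd (b k) q) x) →
      ∀ y ∈ closedBall c (r / 2), q y ≤ C' := by
  set β := lam / (4 * C) with hβ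
  have hβ0 : 0 < β := by positivity
  set D : ℝ := 4 / (β * lam) * ((C ^ 2 / (β * lam) + β * C) * r ^ 4 + 44 * n * B * r ^ 2) with hD
  have hD0 : 0 ≤ D := by positivity
  refine ⟨2 / r ^ 4 * ((D + r ^ 4) * Real.exp (β * C)), by positivity, ?_⟩
  intro p q c hp hq hpC hq0 H
  set η := cut c r with hη
  set Ψ : Euc n → ℝ := fun x => η x ^ 2 * q x * Real.exp (β * p x) with hΨ
  have hηle : ∀ x, η x ≤ r ^ 2 := fun x => by simp only [hη, cut]; nlinarith [sq_nonneg ‖x - c‖]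
  have hη0' : ∀ x ∈ closedBall c r, 0 ≤ η x := fun x hx => by
    have hx' : ‖x - c‖ ≤ r := by rwa [mem_closedBall, dist_eq_norm] at hx
    simp only [hη, cut, sub_nonneg]
    exact pow_le_pow_left₀ (norm_nonneg _) hx' 2
  have hη4 : ∀ x ∈ closedBall c r, η x ^ 2 ≤ r ^ 4 := fun x hx => by
    have := pow_le_pow_left₀ (hη0' x hx) (hηle x) 2
    nlinarith
  have hexp : ∀ x ∈ closedBall c r, Real.exp (β * p x) ≤ Real.exp (β * C) := fun x hx =>
    Real.exp_le_exp.2 (mul_le_mul_of_nonneg_left (hpC x hx).2 hβ0.le)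
  suffices HM : ∀ y ∈ closedBall c r, Ψ y ≤ (D + r ^ 4) * Real.exp (β * C) by
    intro y hy
    have hyr : y ∈ closedBall c r := closedBall_subset_closedBall (by linarith) hy
    have h1 := HM y hyr
    have hη1 : 3 / 4 * r ^ 2 ≤ η y := by
      have : ‖y - c‖ ≤ r / 2 := by rwa [mem_closedBall, dist_eq_norm] at hy
      have h2 : ‖y - c‖ ^ 2 ≤ (r / 2) ^ 2 := pow_le_pow_left₀ (norm_nonneg _) this 2
      simp only [hη, cut]; nlinarith
    have hη2 : r ^ 4 / 2 ≤ η y ^ 2 := by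
      have := pow_le_pow_left₀ (by positivity) hη1 2
      nlinarith [pow_pos hr 4]
    have h2 : r ^ 4 / 2 * q y ≤ Ψ y := by
      simp only [hΨ]
      have e1 : 1 ≤ Real.exp (β * p y) := Real.one_le_exp (mul_nonneg hβ0.le (hpC y hyr).1)
      have e2 : r ^ 4 / 2 * q y ≤ η y ^ 2 * q y := mul_le_mul_of_nonneg_right hη2 (hq0 y hyr)
      have e3 : 0 ≤ η y ^ 2 * q y := mul_nonneg (sq_nonneg _) (hq0 y hyr)
      nlinarith
    have h3 := mul_le_mul_of_nonneg_left (h2.trans h1) (show 0 ≤ 2 / r ^ 4 by positivity)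
    refine le_trans (le_of_eq ?_) h3
    field_simp
  have hcont : ContinuousOn Ψ (closedBall c r) := by
    intro x hx
    refine ContinuousAt.continuousWithinAt ?_
    exact (((sm_cut c r x).diff.continuousAt.pow 2).mul (hq x hx).diff.continuousAt).mul
      (Real.continuous_exp.continuousAt.comp (continuousAt_const.mul (hp x hx).diff.continuousAt))
  obtain ⟨x, hx, hmax⟩ := (isCompact_closedBall c r).exists_isMaxOn ⟨c, by simp [hr.le]⟩ hcont
  intro y hy
  refine (hmax hy : Ψ y ≤ Ψ x).trans ?_
  suffices HQ : η x ^ 2 * q x ≤ D + r ^ 4 by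
    exact mul_le_mul HQ (hexp x hx) (Real.exp_pos _).le (by positivity)
  by_cases hq1 : q x < 1
  · have : η x ^ 2 * q x ≤ r ^ 4 * 1 := mul_le_mul (hη4 x hx) hq1.le (hq0 x hx) (by positivity)
    linarith
  push Not at hq1
  by_cases hηz : η x = 0
  · rw [hηz]; simp; positivity
  have hηx : 0 < η x := lt_of_le_of_ne (hη0' x hx) (Ne.symm hηz)
  have hx' : ‖x - c‖ ≤ r := by rwa [mem_closedBall, dist_eq_norm] at hx
  have hxb : x ∈ ball c r := by
    rw [mem_ball, dist_eq_norm]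
    refine lt_of_le_of_ne hx' fun h => hηz ?_
    simp [hη, cut, h]
  have hqx : 0 < q x := by linarith
  obtain ⟨b, hb, h1, h2, h3⟩ := H x hxb hq1
  have sη : ContDiffAt ℝ 2 η x := (sm_cut c r x).two
  have sq := (hq x hx).two
  have sp := (hp x hx).two
  have slη : ContDiffAt ℝ 2 (fun y => Real.log (η y)) x := sη.log hηz
  have slq : ContDiffAt ℝ 2 (fun y => Real.log (q y)) x := sq.log hqx.ne'
  have hlm : IsLocalMax (fun y => (Real.log (q y) + β * p y) + 2 * Real.log (η y)) x := by
    filter_upwards [isOpen_ball.mem_nhds hxb, (sm_cut c r x).diff.continuousAt.eventually (lt_mem_nhds hηx),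
      (hq x hx).diff.continuousAt.eventually (lt_mem_nhds hqx)] with z hz1 hz2 hz3
    have hl : ∀ z, 0 < η z → 0 < q z → (Real.log (q z) + β * p z) + 2 * Real.log (η z) = Real.log (Ψ z) := by
      intro z h1 h2
      simp only [hΨ]
      rw [Real.log_mul (by positivity) (by positivity), Real.log_mul (by positivity) (by positivity), Real.log_exp, Real.log_pow]
      push_cast; ring
    rw [hl z hz2 hz3, hl x hηx hqx]
    exact Real.log_le_log (by simp only [hΨ]; positivity) (hmax (ball_subset_closedBall hz1))
  have spc : ContDiffAt ℝ 2 (fun y => β * p y) x := contDiffAt_const.mul sp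
  have sec : ContDiffAt ℝ 2 (fun y => 2 * Real.log (η y)) x := contDiffAt_const.mul slη
  have one_ne : (2 : WithTop ℕ∞) ≠ 0 := by norm_num
  have key : ∀ k, dd (b k) (dd (b k) q) x / q x + β * dd (b k) (dd (b k) p) x ≤
      2 * β ^ 2 * (dd (b k) p x) ^ 2 + (4 * B * r ^ 2 + 40 * B * r ^ 2) / η x ^ 2 := by
    intro k
    obtain ⟨m1, m2⟩ := max_dd ((slq.add spc).add sec) hlm (b k)
    rw [dd_add _ ((slq.add spc).differentiableAt one_ne) (sec.differentiableAt one_ne),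
      dd_add _ (slq.differentiableAt one_ne) (spc.differentiableAt one_ne), dd_const_mul _ _ (sp.differentiableAt one_ne),
      dd_const_mul _ _ (slη.differentiableAt one_ne), dd_log _ (sq.differentiableAt one_ne) hqx.ne',
      dd_log _ (sη.differentiableAt one_ne) hηz] at m1
    rw [dd2_add _ _ (slq.add spc) sec, dd2_add _ _ slq spc, dd2_const_mul _ _ _ sp, dd2_const_mul _ _ _ slη,
      dd2_log _ sq hqx.ne', dd2_log _ sη hηz] at m2
    have e1 : dd (b k) η x = -2 * ⟪x - c, b k⟫ := dd_cut _ _ _ _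
    have e2 : dd (b k) (dd (b k) η) x = -2 * ‖b k‖ ^ 2 := dd2_cut _ _ _ _
    set Q := dd (b k) q x / q x
    set P := dd (b k) p x
    set E := dd (b k) η x / η x with hE
    have f1 : Q ^ 2 ≤ 2 * (β * P) ^ 2 + 8 * E ^ 2 := by
      have : Q = -(β * P + 2 * E) := by linarith
      rw [this]; nlinarith [sq_nonneg (β * P - 2 * E)]
    have f2 : E ^ 2 ≤ 4 * B * r ^ 2 / η x ^ 2 := by
      rw [hE, div_pow, e1]
      have i1 : ⟪x - c, b k⟫ ^ 2 ≤ r ^ 2 * B := by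
        have := abs_real_inner_le_norm (x - c) (b k)
        rw [← sq_abs]
        calc |⟪x - c, b k⟫| ^ 2 ≤ (‖x - c‖ * ‖b k‖) ^ 2 := pow_le_pow_left₀ (abs_nonneg _) this 2
          _ = ‖x - c‖ ^ 2 * ‖b k‖ ^ 2 := by ring
          _ ≤ r ^ 2 * B := mul_le_mul (pow_le_pow_left₀ (norm_nonneg _) hx' 2) (hb k) (sq_nonneg _) (by positivity)
      gcongr
      nlinarith
    have f3 : -(2 * B * r ^ 2 / η x ^ 2) ≤ dd (b k) (dd (b k) η) x / η x := by
      rw [e2, neg_le, ← neg_div]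
      have : -(-2 * ‖b k‖ ^ 2) / η x = 2 * ‖b k‖ ^ 2 * η x / η x ^ 2 := by field_simp
      rw [this]
      gcongr
      · exact hb k
      · exact hηle x
    have f4 : (4 * B * r ^ 2 + 40 * B * r ^ 2) / η x ^ 2 = 2 * (2 * B * r ^ 2 / η x ^ 2) + 10 * (4 * B * r ^ 2 / η x ^ 2) := by ring
    rw [f4]
    rw [mul_pow] at f1
    linarith
  have hsum := Finset.sum_le_sum fun k (_ : k ∈ Finset.univ) => key k
  rw [Finset.sum_add_distrib, Finset.sum_add_distrib, ← Finset.sum_div, ← Finset.mul_sum, ← Finset.mul_sum, Finset.sum_const, Finset.card_univ, Fintype.card_fin, nsmul_eq_mul] at hsum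
  set S := Real.sqrt (q x) with hS
  have hSS : S ^ 2 = q x := Real.sq_sqrt hqx.le
  have hS0 : 0 < S := Real.sqrt_pos.2 hqx
  have g1 : -(C * S) ≤ (∑ k, dd (b k) (dd (b k) q) x) / q x := by
    rw [le_div_iff₀ hqx]; linarith
  have g2 : β * (lam * q x - C) ≤ β * ∑ k, dd (b k) (dd (b k) p) x := mul_le_mul_of_nonneg_left (by linarith) hβ0.le
  have g3 : 2 * β ^ 2 * ∑ k, (dd (b k) p x) ^ 2 ≤ 2 * β ^ 2 * (C * q x) := mul_le_mul_of_nonneg_left h2 (by positivity)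
  have g4 : 2 * β ^ 2 * (C * q x) = β * lam / 2 * q x := by rw [hβ]; field_simp; ring
  have g5 : C * S ≤ β * lam / 4 * q x + C ^ 2 / (β * lam) := by
    rw [← hSS]
    have : 0 ≤ (β * lam * S / 2 - C) ^ 2 / (β * lam) := by positivity
    have e : (β * lam * S / 2 - C) ^ 2 / (β * lam) = β * lam / 4 * S ^ 2 + C ^ 2 / (β * lam) - C * S := by field_simp; ring
    linarith
  have g6 : β * lam / 4 * q x ≤ C ^ 2 / (β * lam) + β * C + n * ((4 * B * r ^ 2 + 40 * B * r ^ 2) / η x ^ 2) := by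
    nlinarith
  have g7 := mul_le_mul_of_nonneg_left g6 (show 0 ≤ 4 / (β * lam) * η x ^ 2 by positivity)
  have g8 : 4 / (β * lam) * η x ^ 2 * (β * lam / 4 * q x) = η x ^ 2 * q x := by field_simp
  have g9 : 4 / (β * lam) * η x ^ 2 * (C ^ 2 / (β * lam) + β * C + n * ((4 * B * r ^ 2 + 40 * B * r ^ 2) / η x ^ 2)) =
     4 / (β * lam) * ((C ^ 2 / (β * lam) + β * C) * η x ^ 2 + 44 * n * B * r ^ 2) := by field_simp; ring
  rw [g8, g9] at g7
  have g10 : 4 / (β * lam) * ((C ^ 2 / (β * lam) + β * C) * η x ^ 2 + 44 * n * B * r ^ 2) ≤ D := by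
    rw [hD]
    have := hη4 x hx
    gcongr
  have : 0 < r ^ 4 := by positivity
  linarith

end MA
end

section
namespace MA
open Filter Topology Matrix Metric

variable {n : ℕ}

theorem Sm.add {f g : Euc n → ℝ} {x : Euc n} (hf : Sm f x) (hg : Sm g x) : Sm (fun y => f y + g y) x :=
  (Filter.Eventually.and hf hg).mono fun _ h => h.1.add h.2
theorem Sm.sub {f g : Euc n → ℝ} {x : Euc n} (hf : Sm f x) (hg : Sm g x) : Sm (fun y => f y - g y) x :=
  (Filter.Eventually.and hf hg).mono fun _ h => h.1.sub h.2
theorem Sm.mul {f g : Euc n → ℝ} {x : Euc n} (hf : Sm f x) (hg : Sm g x) : Sm (fun y => f y * g y) x :=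
  (Filter.Eventually.and hf hg).mono fun _ h => h.1.mul h.2
theorem sm_const (c : ℝ) (x : Euc n) : Sm (fun _ : Euc n => c) x := Eventually.of_forall fun _ => contDiffAt_const
theorem Sm.cmul {f : Euc n → ℝ} {x : Euc n} (hf : Sm f x) (c : ℝ) : Sm (fun y => c * f y) x := (sm_const c x).mul hf
theorem Sm.congr {f g : Euc n → ℝ} {x : Euc n} (hf : Sm f x) (h : f =ᶠ[𝓝 x] g) : Sm g x := by
  have := h.eventuallyEq_nhds
  unfold Sm at *
  filter_upwards [hf, this] with y h1 h2 using h1.congr_of_eventuallyEq h2.symm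
theorem Sm.sum {ι : Type*} {s : Finset ι} {f : ι → Euc n → ℝ} {x : Euc n} (hf : ∀ i ∈ s, Sm (f i) x) :
    Sm (fun y => ∑ i ∈ s, f i y) x := by
  have : ∀ᶠ y in 𝓝 x, ∀ i ∈ s, ContDiffAt ℝ (⊤ : ℕ∞) (f i) y := (s.eventually_all).2 hf
  exact this.mono fun y hy => ContDiffAt.sum hy
theorem Sm.prod {ι : Type*} {s : Finset ι} {f : ι → Euc n → ℝ} {x : Euc n} (hf : ∀ i ∈ s, Sm (f i) x) :
    Sm (fun y => ∏ i ∈ s, f i y) x := by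
  have : ∀ᶠ y in 𝓝 x, ∀ i ∈ s, ContDiffAt ℝ (⊤ : ℕ∞) (f i) y := (s.eventually_all).2 hf
  exact this.mono fun y hy => contDiffAt_prod hy

/-- iterated basis derivatives -/
def ddl (l : List (Fin n)) (f : Euc n → ℝ) : Euc n → ℝ := l.foldr (fun i g => dd (bas i) g) f

theorem ddl_nil (f : Euc n → ℝ) : ddl [] f = f := rfl
theorem ddl_cons (i : Fin n) (l : List (Fin n)) (f : Euc n → ℝ) : ddl (i :: l) f = dd (bas i) (ddl l f) := rfl
theorem ddl_snoc (i : Fin n) (l : List (Fin n)) (f : Euc n → ℝ) : ddl (l ++ [i]) f = ddl l (dd (bas i) f) := by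
  simp [ddl, List.foldr_append]
theorem ddl_append (l l' : List (Fin n)) (f : Euc n → ℝ) : ddl (l ++ l') f = ddl l (ddl l' f) := by
  simp [ddl, List.foldr_append]

theorem Sm.ddl {f : Euc n → ℝ} {x : Euc n} (h : Sm f x) (l : List (Fin n)) : Sm (ddl l f) x := by
  induction l with
  | nil => exact h
  | cons i l ih => exact ih.dd _

theorem ddl_congr {f g : Euc n → ℝ} {x : Euc n} (h : f =ᶠ[𝓝 x] g) (l : List (Fin n)) : ddl l f =ᶠ[𝓝 x] ddl l g := by
  induction l with
  | nil => exact h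
  | cons i l ih => exact dd_congr ih _

theorem dd_ddl_comm {f : Euc n → ℝ} {x : Euc n} (h : Sm f x) (b : Euc n) (l : List (Fin n)) :
    dd b (ddl l f) =ᶠ[𝓝 x] ddl l (dd b f) := by
  induction l with
  | nil => exact Filter.EventuallyEq.rfl
  | cons i l ih =>
    exact (dd_comm_ev (h.ddl l) b (bas i)).trans (dd_congr ih _)

theorem ddl_add {f g : Euc n → ℝ} {x : Euc n} (hf : Sm f x) (hg : Sm g x) (l : List (Fin n)) :
    ddl l (fun y => f y + g y) =ᶠ[𝓝 x] fun y => ddl l f y + ddl l g y := by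
  induction l with
  | nil => exact Filter.EventuallyEq.rfl
  | cons i l ih =>
    refine (dd_congr ih _).trans ?_
    filter_upwards [(hf.ddl l).ev, (hg.ddl l).ev] with y h1 h2 using dd_add _ h1.diff h2.diff

theorem ddl_sub {f g : Euc n → ℝ} {x : Euc n} (hf : Sm f x) (hg : Sm g x) (l : List (Fin n)) :
    ddl l (fun y => f y - g y) =ᶠ[𝓝 x] fun y => ddl l f y - ddl l g y := by
  induction l with
  | nil => exact Filter.EventuallyEq.rfl
  | cons i l ih =>
    refine (dd_congr ih _).trans ?_
    filter_upwards [(hf.ddl l).ev, (hg.ddl l).ev] with y h1 h2 using dd_sub _ h1.diff h2.diff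

theorem ddl_cmul (s : ℝ) (f : Euc n → ℝ) (l : List (Fin n)) :
    ddl l (fun y => s * f y) = fun y => s * ddl l f y := by
  induction l with
  | nil => rfl
  | cons i l ih => rw [ddl_cons, ih, dd_cmul]; rfl

theorem ddl_const (c : ℝ) (i : Fin n) (l : List (Fin n)) : ddl (i :: l) (fun _ : Euc n => c) = fun _ => 0 := by
  induction l generalizing i with
  | nil => ext x; exact dd_const _ _ _
  | cons j l ih => rw [ddl_cons, ih, dd_zfun]

theorem ddl_sum {ι : Type*} (s : Finset ι) {f : ι → Euc n → ℝ} {x : Euc n} (hf : ∀ i ∈ s, Sm (f i) x) (l : List (Fin n)) :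
    ddl l (fun y => ∑ i ∈ s, f i y) =ᶠ[𝓝 x] fun y => ∑ i ∈ s, ddl l (f i) y := by
  induction l with
  | nil => exact Filter.EventuallyEq.rfl
  | cons i l ih =>
    refine (dd_congr ih _).trans ?_
    have : ∀ᶠ y in 𝓝 x, ∀ i ∈ s, Sm (ddl l (f i)) y := (s.eventually_all).2 fun i hi => ((hf i hi).ddl l).ev
    filter_upwards [this] with y h using dd_sum s _ fun i hi => (h i hi).diff

/-- weighted bounds on derivatives at a point -/
def Bd (N : ℕ) (x : Euc n) (C Θ : ℝ) (f : Euc n → ℝ) : Prop :=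
  ∀ l : List (Fin n), l.length ≤ N → |ddl l f x| ≤ C * Θ ^ l.length

section
variable {N : ℕ} {x : Euc n} {C C' Θ : ℝ} {f g : Euc n → ℝ}

theorem Bd.val (h : Bd N x C Θ f) : |f x| ≤ C := by simpa [ddl_nil] using h [] (by simp)

theorem Bd.congr (h : Bd N x C Θ f) (e : f =ᶠ[𝓝 x] g) : Bd N x C Θ g := fun l hl => by
  rw [← (ddl_congr e l).eq_of_nhds]; exact h l hl

theorem Bd.mono (h : Bd N x C Θ f) (hΘ : 0 ≤ Θ) (hC : C ≤ C') : Bd N x C' Θ f := fun l hl =>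
  (h l hl).trans (mul_le_mul_of_nonneg_right hC (pow_nonneg hΘ _))

theorem Bd.le {N' : ℕ} (h : Bd N x C Θ f) (hN : N' ≤ N) : Bd N' x C Θ f := fun l hl => h l (hl.trans hN)

theorem Bd.dd (h : Bd (N + 1) x C Θ f) (i : Fin n) : Bd N x (C * Θ) Θ (dd (bas i) f) := fun l hl => by
  have := h (l ++ [i]) (by simpa using hl)
  rw [ddl_snoc] at this
  simpa [pow_succ, mul_assoc, mul_comm, mul_left_comm] using this

theorem Bd.of_succ (h0 : |f x| ≤ C) (h : ∀ i, Bd N x (C * Θ) Θ (MA.dd (bas i) f)) : Bd (N + 1) x C Θ f := fun l hl => by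
  rcases List.eq_nil_or_concat l with rfl | ⟨l', i, rfl⟩
  · simpa [ddl_nil] using h0
  · rw [List.concat_eq_append] at hl ⊢
    rw [ddl_snoc]
    have := h i l' (by simpa using hl)
    simpa [pow_succ, mul_assoc, mul_comm, mul_left_comm] using this

theorem Bd.add (hf : Sm f x) (hg : Sm g x) (h : Bd N x C Θ f) (h' : Bd N x C' Θ g) : Bd N x (C + C') Θ (fun y => f y + g y) :=
  fun l hl => by
  rw [(ddl_add hf hg l).eq_of_nhds, add_mul]
  exact (abs_add_le _ _).trans (add_le_add (h l hl) (h' l hl))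

theorem Bd.sub (hf : Sm f x) (hg : Sm g x) (h : Bd N x C Θ f) (h' : Bd N x C' Θ g) : Bd N x (C + C') Θ (fun y => f y - g y) :=
  fun l hl => by
  rw [(ddl_sub hf hg l).eq_of_nhds, add_mul]
  exact (abs_sub _ _).trans (add_le_add (h l hl) (h' l hl))

theorem Bd.cmul (h : Bd N x C Θ f) (c : ℝ) : Bd N x (|c| * C) Θ (fun y => c * f y) := fun l hl => by
  rw [ddl_cmul, abs_mul, mul_assoc]; exact mul_le_mul_of_nonneg_left (h l hl) (abs_nonneg _)

theorem Bd.sum {ι : Type*} {s : Finset ι} {f : ι → Euc n → ℝ} (hs : ∀ i ∈ s, Sm (f i) x) (h : ∀ i ∈ s, Bd N x C Θ (f i)) :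
    Bd N x (s.card * C) Θ (fun y => ∑ i ∈ s, f i y) := fun l hl => by
  rw [(ddl_sum s hs l).eq_of_nhds]
  refine (Finset.abs_sum_le_sum_abs _ _).trans ?_
  refine (Finset.sum_le_sum fun i hi => h i hi l hl).trans ?_
  simp [mul_assoc]

theorem Bd.const (c : ℝ) (hC : |c| ≤ C) (hΘ : 0 ≤ Θ) : Bd N x C Θ (fun _ => c) := fun l _ => by
  have hC0 : 0 ≤ C := (abs_nonneg c).trans hC
  cases l with
  | nil => simpa [ddl_nil] using hC
  | cons i l => rw [ddl_const]; simp; positivity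

theorem Bd.mul (hf : Sm f x) (hg : Sm g x) (hΘ : 0 ≤ Θ) (h : Bd N x C Θ f) (h' : Bd N x C' Θ g) :
    Bd N x (2 ^ N * (C * C')) Θ (fun y => f y * g y) := by
  induction N generalizing f g C C' with
  | zero =>
    intro l hl
    have : l = [] := by simpa using hl
    subst this
    simp only [ddl_nil, List.length_nil, pow_zero, one_mul, mul_one, abs_mul]
    exact mul_le_mul h.val h'.val (abs_nonneg _) ((abs_nonneg _).trans h.val)
  | succ N ih =>
    have hC : 0 ≤ C := (abs_nonneg _).trans h.val
    have hC' : 0 ≤ C' := (abs_nonneg _).trans h'.val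
    refine Bd.of_succ ?_ fun i => ?_
    · rw [abs_mul]
      refine (mul_le_mul h.val h'.val (abs_nonneg _) hC).trans ?_
      exact le_mul_of_one_le_left (by positivity) (one_le_pow₀ (by norm_num))
    · have e : (fun y => MA.dd (bas i) f y * g y + f y * MA.dd (bas i) g y) =ᶠ[𝓝 x] MA.dd (bas i) (fun y => f y * g y) := by
        filter_upwards [hf.ev, hg.ev] with y h1 h2 using (dd_mul _ h1.diff h2.diff).symm
      refine Bd.congr ?_ e
      refine ((ih (hf.dd _) hg (h.dd i) (h'.le (Nat.le_succ N))).add ((hf.dd _).mul hg) (hf.mul (hg.dd _))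
        (ih hf (hg.dd _) (h.le (Nat.le_succ N)) (h'.dd i))).mono hΘ (le_of_eq ?_)
      ring

/-- product with a factor vanishing at the point: one derivative less is needed on the other factor -/
theorem Bd.mulZ (hf : Sm f x) (hg : Sm g x) (hΘ : 0 ≤ Θ) (hz : f x = 0) (h : Bd (N + 1) x C Θ f) (h' : Bd N x C' Θ g) :
    Bd (N + 1) x (2 ^ (N + 1) * (C * C')) Θ (fun y => f y * g y) := by
  induction N generalizing f g C C' with
  | zero =>
    have hC : 0 ≤ C := (abs_nonneg _).trans h.val
    have hC' : 0 ≤ C' := (abs_nonneg _).trans h'.val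
    refine Bd.of_succ (by rw [hz]; simp; positivity) fun i => ?_
    have e : (fun y => MA.dd (bas i) f y * g y + f y * MA.dd (bas i) g y) =ᶠ[𝓝 x] MA.dd (bas i) (fun y => f y * g y) := by
        filter_upwards [hf.ev, hg.ev] with y h1 h2 using (dd_mul _ h1.diff h2.diff).symm
    refine Bd.congr ?_ e
    intro l hl
    have : l = [] := by simpa using hl
    subst this
    simp only [ddl_nil, hz, List.length_nil, pow_zero, zero_mul, add_zero, abs_mul, mul_one]
    have := mul_le_mul (h.dd i).val h'.val (abs_nonneg _) (by positivity)
    refine this.trans ?_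
    have : 0 ≤ C * C' * Θ := by positivity
    rw [zero_add, pow_one]
    linarith
  | succ N ih =>
    have hC : 0 ≤ C := (abs_nonneg _).trans h.val
    have hC' : 0 ≤ C' := (abs_nonneg _).trans h'.val
    refine Bd.of_succ (by rw [hz]; simp; positivity) fun i => ?_
    have e : (fun y => MA.dd (bas i) f y * g y + f y * MA.dd (bas i) g y) =ᶠ[𝓝 x] MA.dd (bas i) (fun y => f y * g y) := by
        filter_upwards [hf.ev, hg.ev] with y h1 h2 using (dd_mul _ h1.diff h2.diff).symm
    refine Bd.congr ?_ e
    refine (((h.dd i).mul (hf.dd _) hg hΘ h').add ((hf.dd _).mul hg) (hf.mul (hg.dd _))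
        (ih hf (hg.dd _) hz (h.le (Nat.le_succ _)) (h'.dd i))).mono hΘ (le_of_eq ?_)
    ring

end

/-- bounds for a pair of functions and their difference -/
structure Bp (N : ℕ) (x : Euc n) (C Θ M : ℝ) (f f0 : Euc n → ℝ) : Prop where
  s : Sm f x
  s0 : Sm f0 x
  b : Bd N x C Θ f
  b0 : Bd N x C Θ f0
  bd : Bd N x (C * M) Θ (fun y => f y - f0 y)

section
variable {N : ℕ} {x : Euc n} {C C' Θ M : ℝ} {f g f0 g0 : Euc n → ℝ}

theorem Bp.C0 (h : Bp N x C Θ M f f0) : 0 ≤ C := (abs_nonneg _).trans h.b.val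

theorem Bp.mono (h : Bp N x C Θ M f f0) (hΘ : 0 ≤ Θ) (hM : 0 ≤ M) (hC : C ≤ C') : Bp N x C' Θ M f f0 :=
  ⟨h.s, h.s0, h.b.mono hΘ hC, h.b0.mono hΘ hC, h.bd.mono hΘ (mul_le_mul_of_nonneg_right hC hM)⟩

theorem Bp.const (c : ℝ) (hC : |c| ≤ C) (hΘ : 0 ≤ Θ) (hM : 0 ≤ M) : Bp N x C Θ M (fun _ => c) (fun _ => c) :=
  ⟨sm_const _ _, sm_const _ _, Bd.const c hC hΘ, Bd.const c hC hΘ, Bd.const _ (by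
    simp; exact mul_nonneg ((abs_nonneg _).trans hC) hM) hΘ⟩

theorem Bp.mul (hΘ : 0 ≤ Θ) (h : Bp N x C Θ M f f0) (h' : Bp N x C' Θ M g g0) :
    Bp N x (2 ^ (N + 1) * (C * C')) Θ M (fun y => f y * g y) (fun y => f0 y * g0 y) := by
  have hC := h.C0
  have hC' := h'.C0
  have le : 2 ^ N * (C * C') ≤ 2 ^ (N + 1) * (C * C') := by
    refine mul_le_mul_of_nonneg_right (pow_le_pow_right₀ (by norm_num) (Nat.le_succ N)) (by positivity)
  refine ⟨h.s.mul h'.s, h.s0.mul h'.s0, (h.b.mul h.s h'.s hΘ h'.b).mono hΘ le, (h.b0.mul h.s0 h'.s0 hΘ h'.b0).mono hΘ le, ?_⟩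
  have e : (fun y => (f y - f0 y) * g y + f0 y * (g y - g0 y)) =ᶠ[𝓝 x] fun y => f y * g y - f0 y * g0 y :=
    Eventually.of_forall fun y => by simp only; ring
  refine Bd.congr ?_ e
  refine ((h.bd.mul (h.s.sub h.s0) h'.s hΘ h'.b).add ((h.s.sub h.s0).mul h'.s) (h.s0.mul (h'.s.sub h'.s0))
    (h.b0.mul h.s0 (h'.s.sub h'.s0) hΘ h'.bd)).mono hΘ (le_of_eq ?_)
  ring

theorem Bp.sum {ι : Type*} {s : Finset ι} {f f0 : ι → Euc n → ℝ} (h : ∀ i ∈ s, Bp N x C Θ M (f i) (f0 i)) :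
    Bp N x (s.card * C) Θ M (fun y => ∑ i ∈ s, f i y) (fun y => ∑ i ∈ s, f0 i y) := by
  refine ⟨Sm.sum fun i hi => (h i hi).s, Sm.sum fun i hi => (h i hi).s0, Bd.sum (fun i hi => (h i hi).s) fun i hi => (h i hi).b,
    Bd.sum (fun i hi => (h i hi).s0) fun i hi => (h i hi).b0, ?_⟩
  have := Bd.sum (fun i hi => (h i hi).s.sub (h i hi).s0) fun i hi => (h i hi).bd
  simp only [Finset.sum_sub_distrib] at this
  rwa [mul_assoc]

end

theorem Bp_prod {n : ℕ} {ι : Type*} [DecidableEq ι] (N : ℕ) (C : ℝ) (s : Finset ι) : ∃ C' : ℝ, 0 ≤ C' ∧ ∀ (x : Euc n) (Θ M : ℝ), 0 ≤ Θ → 0 ≤ M →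
    ∀ f f0 : ι → Euc n → ℝ, (∀ i, Bp N x C Θ M (f i) (f0 i)) →
    Bp N x C' Θ M (fun y => ∏ i ∈ s, f i y) (fun y => ∏ i ∈ s, f0 i y) := by
  induction s using Finset.induction_on with
  | empty =>
    refine ⟨1, by norm_num, fun x Θ M hΘ hM f f0 h => ?_⟩
    simpa using Bp.const (N := N) (x := x) (C := 1) 1 (by simp) hΘ hM
  | insert a s ha ih =>
    obtain ⟨C', hC', H⟩ := ih
    refine ⟨2 ^ (N + 1) * (|C| * C'), by positivity, fun x Θ M hΘ hM f f0 h => ?_⟩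
    simp only [Finset.prod_insert ha]
    exact Bp.mul hΘ ((h a).mono hΘ hM (le_abs_self C)) (H x Θ M hΘ hM f f0 h)

theorem Bp_det (n m N : ℕ) (C : ℝ) : ∃ C' : ℝ, 0 ≤ C' ∧ ∀ (x : Euc n) (Θ M : ℝ), 0 ≤ Θ → 0 ≤ M →
    ∀ A A0 : Fin m → Fin m → Euc n → ℝ, (∀ i j, Bp N x C Θ M (A i j) (A0 i j)) →
    Bp N x C' Θ M (fun y => (Matrix.of fun i j => A i j y).det) (fun y => (Matrix.of fun i j => A0 i j y).det) := by
  obtain ⟨C', hC', H⟩ := Bp_prod (n := n) N C (Finset.univ : Finset (Fin m))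
  refine ⟨(Finset.univ : Finset (Equiv.Perm (Fin m))).card * (2 ^ (N + 1) * (1 * C')), by positivity, fun x Θ M hΘ hM A A0 h => ?_⟩
  simp only [Matrix.det_apply', Matrix.of_apply]
  refine Bp.sum fun σ _ => ?_
  refine Bp.mul hΘ (Bp.const _ ?_ hΘ hM) (H x Θ M hΘ hM (fun i => A (σ i) i) (fun i => A0 (σ i) i) fun i => h _ _)
  rcases Int.units_eq_one_or (Equiv.Perm.sign σ) with h | h <;> simp [h]

theorem Bp_adj (n N : ℕ) (C : ℝ) : ∃ C' : ℝ, 0 ≤ C' ∧ ∀ (x : Euc n) (Θ M : ℝ), 0 ≤ Θ → 0 ≤ M →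
    ∀ A A0 : Fin n → Fin n → Euc n → ℝ, (∀ i j, Bp N x C Θ M (A i j) (A0 i j)) → ∀ i j,
    Bp N x C' Θ M (fun y => (Matrix.of fun i j => A i j y).adjugate i j) (fun y => (Matrix.of fun i j => A0 i j y).adjugate i j) := by
  obtain ⟨C', hC', H⟩ := Bp_det n n N (max C 1)
  refine ⟨C', hC', fun x Θ M hΘ hM A A0 h i j => ?_⟩
  simp only [Matrix.adjugate_apply]
  have key : ∀ (A : Fin n → Fin n → Euc n → ℝ) y, (Matrix.of fun i j => A i j y).updateRow j (Pi.single i 1) =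
     Matrix.of fun i' j' => (fun i' j' => if i' = j then (fun _ => (Pi.single i 1 : Fin n → ℝ) j') else A i' j') i' j' y := by
    intro A y; ext i' j'
    by_cases hi : i' = j
    · subst hi; simp
    · simp [hi]
  simp only [key A, key A0]
  refine H x Θ M hΘ hM _ _ fun i' j' => ?_
  by_cases hi : i' = j
  · simp only [hi, if_true]
    refine Bp.const _ (le_trans ?_ (le_max_right C 1)) hΘ hM
    by_cases hj : j' = i
    · subst hj; simp
    · simp [hj]
  · simp only [hi, if_false]
    exact (h i' j').mono hΘ hM (le_max_left _ _)

end MA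
end

section
namespace MA
open Filter Topology Matrix Metric

variable {n : ℕ}

/-- sum of squares of all basis derivatives of order `k` -/
def Pk (k : ℕ) (f : Euc n → ℝ) : Euc n → ℝ := fun x => ∑ I : Fin k → Fin n, (ddl (List.ofFn I) f x) ^ 2

theorem Pk_nonneg (k : ℕ) (f : Euc n → ℝ) (x : Euc n) : 0 ≤ Pk k f x := Finset.sum_nonneg fun _ _ => sq_nonneg _

theorem sq_le_Pk (f : Euc n → ℝ) (x : Euc n) (l : List (Fin n)) : (ddl l f x) ^ 2 ≤ Pk l.length f x := by
  have := Finset.single_le_sum (f := fun I : Fin l.length → Fin n => (ddl (List.ofFn I) f x) ^ 2) (fun _ _ => sq_nonneg _) (Finset.mem_univ l.get)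
  simpa [Pk] using this

theorem abs_le_Pk (f : Euc n → ℝ) (x : Euc n) (l : List (Fin n)) : |ddl l f x| ≤ Real.sqrt (Pk l.length f x) :=
  Real.abs_le_sqrt (sq_le_Pk f x l)

theorem Pk_le {k : ℕ} {f : Euc n → ℝ} {x : Euc n} {M : ℝ} (h : ∀ l : List (Fin n), l.length = k → |ddl l f x| ≤ M) :
    Pk k f x ≤ n ^ k * M ^ 2 := by
  have : ∀ I : Fin k → Fin n, (ddl (List.ofFn I) f x) ^ 2 ≤ M ^ 2 := fun I => by
    rw [← sq_abs]; exact pow_le_pow_left₀ (abs_nonneg _) (h _ (by simp)) 2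
  refine (Finset.sum_le_sum fun I _ => this I).trans ?_
  simp

theorem Pk_succ (k : ℕ) (f : Euc n → ℝ) (x : Euc n) :
    Pk (k + 1) f x = ∑ I : Fin k → Fin n, ∑ i, (dd (bas i) (ddl (List.ofFn I) f) x) ^ 2 := by
  unfold Pk
  rw [Finset.sum_comm, ← Fintype.sum_prod_type' (f := fun (i : Fin n) (I : Fin k → Fin n) => (dd (bas i) (ddl (List.ofFn I) f) x) ^ 2)]
  refine (Fintype.sum_equiv (Fin.consEquiv fun _ => Fin n) _ _ fun p => ?_).symm
  simp [Fin.consEquiv, List.ofFn_succ, ddl_cons]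

theorem Sm.pk {f : Euc n → ℝ} {x : Euc n} (h : Sm f x) (k : ℕ) : Sm (Pk k f) x := by
  unfold Pk
  refine Sm.sum fun I _ => ?_
  simp only [pow_two]
  exact (h.ddl _).mul (h.ddl _)

theorem dd_grad (f : Euc n → ℝ) (x b : Euc n) : dd b f x = ⟪b, WithLp.toLp 2 fun i => dd (bas i) f x⟫ := by
  conv_lhs => rw [bas_expand b]
  rw [dd_vsum, PiLp.inner_apply]
  simp [mul_comm]

section
variable {G : Mat n} {b : Fin n → Euc n} {l L : ℝ}

theorem grad_lower (h : Frame G b) (hs : G.PosSemidef) (hL : 0 < L) (hG : ∀ z, qf G z z ≤ L * ‖z‖ ^ 2) (f : Euc n → ℝ) (x : Euc n) :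
    (∑ i, (dd (bas i) f x) ^ 2) / L ≤ ∑ k, (dd (b k) f x) ^ 2 := by
  have := frame_lower h hs hL hG (WithLp.toLp 2 fun i => dd (bas i) f x)
  rw [EuclideanSpace.norm_sq_eq] at this
  simpa only [← dd_grad, Real.norm_eq_abs, sq_abs] using this

theorem grad_upper {m : ℝ} (hb : ∀ k, ‖b k‖ ^ 2 ≤ m) (f : Euc n → ℝ) (x : Euc n) :
    ∑ k, (dd (b k) f x) ^ 2 ≤ n * m * ∑ i, (dd (bas i) f x) ^ 2 := by
  have := frame_gamma_le hb (WithLp.toLp 2 fun i => dd (bas i) f x)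
  rw [EuclideanSpace.norm_sq_eq] at this
  simpa only [← dd_grad, Real.norm_eq_abs, sq_abs] using this

theorem dd2_sq {f : Euc n → ℝ} {x : Euc n} (h : Sm f x) (b : Euc n) :
    dd b (dd b (fun y => f y ^ 2)) x = 2 * (f x * dd b (dd b f) x) + 2 * (dd b f x) ^ 2 := by
  simp only [pow_two]
  rw [dd2_mul _ h.two h.two]; ring

theorem dd_sq {f : Euc n → ℝ} {x : Euc n} (h : Sm f x) (b : Euc n) :
    dd b (fun y => f y ^ 2) x = 2 * (f x * dd b f x) := by
  simp only [pow_two]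
  rw [dd_mul _ h.diff h.diff]; ring

theorem Sm.sq {f : Euc n → ℝ} {x : Euc n} (h : Sm f x) : Sm (fun y => f y ^ 2) x := by
  simp only [pow_two]; exact h.mul h

/-- Bochner type inequality -/
theorem L_pk (h : Frame G b) (hs : G.PosSemidef) (hL : 0 < L) (hG : ∀ z, qf G z z ≤ L * ‖z‖ ^ 2) {f : Euc n → ℝ} {x : Euc n}
    (hf : Sm f x) (k : ℕ) {Y : ℝ} (hY : ∀ I : List (Fin n), I.length = k → |∑ j, dd (b j) (dd (b j) (ddl I f)) x| ≤ Y) :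
    2 / L * Pk (k + 1) f x - 2 * n ^ k * (Real.sqrt (Pk k f x) * Y) ≤ ∑ j, dd (b j) (dd (b j) (Pk k f)) x := by
  have e1 : ∀ j, dd (b j) (dd (b j) (Pk k f)) x = ∑ I : Fin k → Fin n, (2 * (ddl (List.ofFn I) f x * dd (b j) (dd (b j) (ddl (List.ofFn I) f)) x)
      + 2 * (dd (b j) (ddl (List.ofFn I) f) x) ^ 2) := fun j => by
    unfold Pk
    rw [dd2_sum _ _ _ fun I _ => (hf.ddl _).sq.two]
    exact Finset.sum_congr rfl fun I _ => dd2_sq (hf.ddl _) _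
  simp only [e1]
  rw [Finset.sum_comm, Pk_succ]
  have e2 : ∀ I : Fin k → Fin n, 2 / L * ∑ i, (dd (bas i) (ddl (List.ofFn I) f) x) ^ 2 - 2 * (Real.sqrt (Pk k f x) * Y) ≤
      ∑ j, (2 * (ddl (List.ofFn I) f x * dd (b j) (dd (b j) (ddl (List.ofFn I) f)) x) + 2 * (dd (b j) (ddl (List.ofFn I) f) x) ^ 2) := by
    intro I
    rw [Finset.sum_add_distrib, ← Finset.mul_sum, ← Finset.mul_sum, ← Finset.mul_sum]
    have a1 := grad_lower h hs hL hG (ddl (List.ofFn I) f) x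
    have a2 : |ddl (List.ofFn I) f x * ∑ j, dd (b j) (dd (b j) (ddl (List.ofFn I) f)) x| ≤ Real.sqrt (Pk k f x) * Y := by
      rw [abs_mul]
      have := abs_le_Pk f x (List.ofFn I)
      rw [List.length_ofFn] at this
      exact mul_le_mul this (hY _ (by simp)) (abs_nonneg _) (Real.sqrt_nonneg _)
    have a3 := neg_abs_le (ddl (List.ofFn I) f x * ∑ j, dd (b j) (dd (b j) (ddl (List.ofFn I) f)) x)
    have a4 : 2 / L * ∑ i, (dd (bas i) (ddl (List.ofFn I) f) x) ^ 2 = 2 * ((∑ i, (dd (bas i) (ddl (List.ofFn I) f) x) ^ 2) / L) := by ring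
    rw [a4]; linarith
  have e3 := Finset.sum_le_sum fun I (_ : I ∈ Finset.univ) => e2 I
  rw [Finset.sum_sub_distrib, ← Finset.mul_sum, Finset.sum_const, Finset.card_univ] at e3
  simp only [Fintype.card_pi, Fintype.card_fin, Finset.prod_const, Finset.card_univ, nsmul_eq_mul] at e3
  push_cast at e3
  refine le_trans (le_of_eq ?_) e3
  ring

theorem G_pk {m : ℝ} (hb : ∀ k, ‖b k‖ ^ 2 ≤ m) {f : Euc n → ℝ} {x : Euc n}
    (hf : Sm f x) (k : ℕ) : ∑ j, (dd (b j) (Pk k f) x) ^ 2 ≤ 4 * n * m * Pk k f x * Pk (k + 1) f x := by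
  have e1 : ∀ j, (dd (b j) (Pk k f) x) ^ 2 ≤ 4 * Pk k f x * ∑ I : Fin k → Fin n, (dd (b j) (ddl (List.ofFn I) f) x) ^ 2 := fun j => by
    have : dd (b j) (Pk k f) x = 2 * ∑ I : Fin k → Fin n, ddl (List.ofFn I) f x * dd (b j) (ddl (List.ofFn I) f) x := by
      unfold Pk
      rw [dd_sum _ _ fun I _ => (hf.ddl _).sq.diff, Finset.mul_sum]
      exact Finset.sum_congr rfl fun I _ => dd_sq (hf.ddl _) _
    rw [this, mul_pow]
    have := Finset.sum_mul_sq_le_sq_mul_sq Finset.univ (fun I : Fin k → Fin n => ddl (List.ofFn I) f x) (fun I => dd (b j) (ddl (List.ofFn I) f) x)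
    unfold Pk
    linarith
  refine (Finset.sum_le_sum fun j _ => e1 j).trans ?_
  rw [← Finset.mul_sum, Finset.sum_comm, Pk_succ]
  have e2 := Finset.sum_le_sum fun (I : Fin k → Fin n) (_ : I ∈ Finset.univ) => grad_upper hb (ddl (List.ofFn I) f) x
  rw [← Finset.mul_sum] at e2
  refine (mul_le_mul_of_nonneg_left e2 (by have := Pk_nonneg k f x; positivity)).trans (le_of_eq ?_)
  ring

theorem L_adj (h : Frame G b) (hd : G.det = 1) {f : Euc n → ℝ} {x : Euc n} (hf : ContDiffAt ℝ 2 f x) :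
    ∑ k, dd (b k) (dd (b k) f) x = ∑ i, ∑ j, G.adjugate i j * dd (bas i) (dd (bas j) f) x := by
  simp only [dd_qf hf]
  rw [h.trace hd]
  simp only [Matrix.trace, Matrix.diag, Matrix.mul_apply, qf_bas]
  refine Finset.sum_congr rfl fun i _ => Finset.sum_congr rfl fun j _ => ?_
  have := congrFun (congrFun (hess_symm hf) i) j
  rw [← this]; rfl

end

/-- standing hypotheses on a ball -/
structure Reg (w : Euc n → ℝ) (c : Euc n) (r l L : ℝ) : Prop where
  sm : ∀ y ∈ closedBall c r, Sm w y
  det : ∀ y ∈ closedBall c r, hessDet w y = 1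
  low : ∀ y ∈ closedBall c r, ∀ z, l * ‖z‖ ^ 2 ≤ qf (hessianMatrix w y) z z
  up : ∀ y ∈ closedBall c r, ∀ z, qf (hessianMatrix w y) z z ≤ L * ‖z‖ ^ 2

theorem Reg.sub {w : Euc n → ℝ} {c c' : Euc n} {r r' l L : ℝ} (h : Reg w c r l L) (hs : closedBall c' r' ⊆ closedBall c r) :
    Reg w c' r' l L :=
  ⟨fun y hy => h.sm y (hs hy), fun y hy => h.det y (hs hy), fun y hy => h.low y (hs hy), fun y hy => h.up y (hs hy)⟩

theorem Reg.pd {w : Euc n → ℝ} {c : Euc n} {r l L : ℝ} (h : Reg w c r l L) (hl : 0 < l) {y : Euc n} (hy : y ∈ closedBall c r) :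
    (hessianMatrix w y).PosDef := pd_of_low (h.sm y hy).two (h.det y hy) hl (h.low y hy)

/-- coefficients of the linearized operator -/
def co (w : Euc n → ℝ) (i j : Fin n) : Euc n → ℝ := fun y => (Matrix.of fun i j => dd (bas i) (dd (bas j) w) y : Mat n).adjugate i j

theorem hess_of {w : Euc n → ℝ} {x : Euc n} (h : ContDiffAt ℝ 2 w x) : (Matrix.of fun i j => dd (bas i) (dd (bas j) w) x : Mat n) = hessianMatrix w x := by
  ext i j; rw [hess_apply h]; rfl

theorem Reg.frame {w : Euc n → ℝ} {c : Euc n} {r l L : ℝ} (h : Reg w c r l L) (hl : 0 < l) {x : Euc n} (hx : x ∈ closedBall c r) :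
    ∃ b, Frame (hessianMatrix w x) b ∧ (∀ k, ‖b k‖ ^ 2 ≤ l⁻¹) ∧ ∀ f : Euc n → ℝ, ContDiffAt ℝ 2 f x →
      ∑ k, dd (b k) (dd (b k) f) x = ∑ i, ∑ j, co w i j x * dd (bas i) (dd (bas j) f) x := by
  obtain ⟨b, d, hb, -⟩ := exists_frame (h.pd hl hx) (hess_symm (h.sm x hx).two)
  refine ⟨b, hb, frame_upper hb hl (h.low x hx), fun f hf => ?_⟩
  rw [L_adj hb (h.det x hx) hf]
  simp only [co, hess_of (h.sm x hx).two]

theorem Reg.eqn {w : Euc n → ℝ} {c : Euc n} {r l L : ℝ} (h : Reg w c r l L) (hl : 0 < l) (e : Euc n) {x : Euc n} (hx : x ∈ ball c r) :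
    (fun y => ∑ i, ∑ j, co w i j y * dd (bas i) (dd (bas j) (dd e w)) y) =ᶠ[𝓝 x] fun _ => 0 := by
  filter_upwards [isOpen_ball.mem_nhds hx] with y hy
  have hyc := ball_subset_closedBall hy
  obtain ⟨b, hb, -, h2⟩ := h.frame hl hyc
  have hs := h.sm y hyc
  rw [← h2 _ (hs.dd e).two]
  have := (frame_jac hs (by filter_upwards [isOpen_ball.mem_nhds hy] with z hz using h.det z (ball_subset_closedBall hz)) hb e).1
  rw [← this]
  exact Finset.sum_congr rfl fun k _ => dd_comm3 hs _ _ _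

/-- commuting derivatives through a linear operator -/
theorem comm_bound {A : Fin n → Fin n → Euc n → ℝ} {φ F : Euc n → ℝ} {x : Euc n} {N : ℕ} {CA Cφ CF Θ : ℝ} (hΘ : 0 ≤ Θ)
    (hφ : Sm φ x) (hA : ∀ i j, Sm (A i j) x) (hF : Sm F x)
    (heq : (fun y => ∑ i, ∑ j, A i j y * dd (bas i) (dd (bas j) φ) y) =ᶠ[𝓝 x] F)
    (bA : ∀ i j, Bd (N + 1) x CA Θ (A i j)) (bφ : ∀ i j, Bd N x Cφ Θ (dd (bas i) (dd (bas j) φ))) (bF : Bd (N + 1) x CF Θ F)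
    {I : List (Fin n)} (hI : I.length = N + 1) :
    |∑ i, ∑ j, A i j x * dd (bas i) (dd (bas j) (ddl I φ)) x| ≤ (CF + n * (n * (2 ^ (N + 1) * (2 * CA * Cφ)))) * Θ ^ (N + 1) := by
  have e1 : (fun y => F y - ∑ i, ∑ j, (A i j y - A i j x) * dd (bas i) (dd (bas j) φ) y) =ᶠ[𝓝 x]
      fun y => ∑ i, ∑ j, A i j x * dd (bas i) (dd (bas j) φ) y := by
    filter_upwards [heq] with y hy
    rw [← hy, ← Finset.sum_sub_distrib]
    refine Finset.sum_congr rfl fun i _ => ?_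
    rw [← Finset.sum_sub_distrib]
    exact Finset.sum_congr rfl fun j _ => by ring
  have sA : ∀ i j, Sm (fun y => A i j y - A i j x) x := fun i j => (hA i j).sub (sm_const _ _)
  have sp : ∀ i j, Sm (dd (bas i) (dd (bas j) φ)) x := fun i j => (hφ.dd _).dd _
  have b1 : ∀ i j, Bd (N + 1) x (2 ^ (N + 1) * (2 * CA * Cφ)) Θ (fun y => (A i j y - A i j x) * dd (bas i) (dd (bas j) φ) y) := by
    intro i j
    refine Bd.mulZ (sA i j) (sp i j) hΘ (by simp) ?_ (bφ i j)
    refine ((bA i j).sub (hA i j) (sm_const _ _) (Bd.const (C := CA) _ (bA i j).val hΘ)).mono hΘ (le_of_eq (by ring))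
  have b2 := Bd.sum (s := Finset.univ) (fun i _ => Sm.sum (s := Finset.univ) fun j _ => (sA i j).mul (sp i j)) fun i _ =>
    Bd.sum (s := Finset.univ) (fun j _ => (sA i j).mul (sp i j)) fun j _ => b1 i j
  simp only [Finset.card_univ, Fintype.card_fin] at b2
  have b3 := (bF.sub hF (Sm.sum fun i _ => Sm.sum fun j _ => (sA i j).mul (sp i j)) b2).congr e1
  have b4 := b3 I hI.le
  rw [hI, (ddl_sum _ (fun i _ => Sm.sum fun j _ => (sp i j).cmul _) I).eq_of_nhds] at b4
  refine le_trans (le_of_eq ?_) b4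
  congr 1
  refine Finset.sum_congr rfl fun i _ => ?_
  rw [(ddl_sum _ (fun j _ => (sp i j).cmul _) I).eq_of_nhds]
  refine Finset.sum_congr rfl fun j _ => ?_
  rw [ddl_cmul]
  simp only
  congr 1
  have t1 : dd (bas j) (ddl I φ) =ᶠ[𝓝 x] ddl I (dd (bas j) φ) := dd_ddl_comm hφ _ _
  rw [dd_congr_at t1]
  exact (dd_ddl_comm (hφ.dd _) _ _).eq_of_nhds

end MA
end

section
namespace MA
open Filter Topology Matrix Metric

variable {n : ℕ}

theorem Bp.same {N : ℕ} {x : Euc n} {C Θ : ℝ} {f : Euc n → ℝ} (hs : Sm f x) (h : Bd N x C Θ f) (hΘ : 0 ≤ Θ) : Bp N x C Θ 0 f f := by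
  refine ⟨hs, hs, h, h, ?_⟩
  simp only [sub_self]
  exact Bd.const 0 (by simp) hΘ

theorem L_bound (n N : ℕ) (K : ℝ) : ∃ C : ℝ, 0 ≤ C ∧ ∀ (w : Euc n → ℝ) (c : Euc n) (r l L : ℝ) (x : Euc n) (Θ : ℝ),
    Reg w c r l L → 0 < l → x ∈ ball c r → 1 ≤ Θ →
    (∀ I : List (Fin n), 2 ≤ I.length → I.length ≤ N + 3 → |ddl I w x| ≤ K * Θ ^ (I.length - 2)) →
    ∀ I : List (Fin n), I.length = N + 2 → |∑ i, ∑ j, co w i j x * dd (bas i) (dd (bas j) (ddl I w)) x| ≤ C * Θ ^ (N + 2) := by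
  obtain ⟨CA, hCA, H⟩ := Bp_adj n (N + 1) K
  refine ⟨n * (n * (2 ^ (N + 1) * (2 * CA * |K|))), by positivity, ?_⟩
  intro w c r l L x Θ hR hl hx hΘ hb I hI
  have hΘ0 : 0 ≤ Θ := by linarith
  have hs := hR.sm x (ball_subset_closedBall hx)
  match I, hI with
  | [], hI => simp at hI
  | e :: J, hI =>
    have hJ : J.length = N + 1 := by simpa using hI
    have b2 : ∀ i j, Bd (N + 1) x K Θ (dd (bas i) (dd (bas j) w)) := by
      intro i j l hl
      have := hb (l ++ [i, j]) (by simp) (by simp; omega)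
      rw [ddl_append] at this
      simpa [ddl_cons, ddl_nil] using this
    have b3 : ∀ i j, Bd N x (|K| * Θ) Θ (dd (bas i) (dd (bas j) (dd (bas e) w))) := by
      intro i j l hl
      have := hb (l ++ [i, j, e]) (by simp) (by simp; omega)
      rw [ddl_append] at this
      have e1 : (l ++ [i, j, e]).length - 2 = l.length + 1 := by simp
      rw [e1, pow_succ] at this
      refine this.trans ?_
      have := mul_le_mul_of_nonneg_right (le_abs_self K) (show 0 ≤ Θ ^ l.length * Θ by positivity)
      linarith
    have bA : ∀ i j, Bp (N + 1) x CA Θ 0 (co w i j) (co w i j) := fun i j =>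
      H x Θ 0 hΘ0 le_rfl _ _ (fun i j => Bp.same ((hs.dd _).dd _) (b2 i j) hΘ0) i j
    have := comm_bound hΘ0 (hs.dd (bas e)) (fun i j => (bA i j).s) (sm_const 0 x) (hR.eqn hl (bas e) hx)
      (fun i j => (bA i j).b) b3 (Bd.const (C := 0) 0 (by simp) hΘ0) hJ
    have e2 : ∀ i j, dd (bas i) (dd (bas j) (ddl (e :: J) w)) x = dd (bas i) (dd (bas j) (ddl J (dd (bas e) w))) x := fun i j => by
      rw [ddl_cons]
      exact dd_congr_at (dd_congr (dd_ddl_comm hs _ _) _) _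
    simp only [e2]
    refine this.trans (le_of_eq ?_)
    ring

theorem young1 {X L s t : ℝ} (hX : 0 ≤ X) (hL : 0 < L) (ht : 0 ≤ t) (hs : s = t ^ 2) : X * (s * t) ≤ s ^ 2 / L + X * (X * L) ^ 3 := by
  subst hs
  by_cases h : X * L ≤ t
  · have : X * (t ^ 2 * t) ≤ (t ^ 2) ^ 2 / L := by
      rw [le_div_iff₀ hL]
      have := mul_le_mul_of_nonneg_right h (show 0 ≤ t ^ 3 by positivity)
      linarith
    have : 0 ≤ X * (X * L) ^ 3 := by positivity
    linarith
  · push Not at h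
    have : X * (t ^ 2 * t) ≤ X * (X * L) ^ 3 := by
      have := pow_le_pow_left₀ ht h.le 3
      refine mul_le_mul_of_nonneg_left (le_trans (le_of_eq (by ring)) this) hX
    have : 0 ≤ (t ^ 2) ^ 2 / L := by positivity
    linarith

theorem reg_step (n N : ℕ) (hN : 1 ≤ N) {l L K r : ℝ} (hl : 0 < l) (hL : 0 < L) (hK : 1 ≤ K) (hr : 0 < r) :
    ∃ K' : ℝ, 1 ≤ K' ∧ ∀ (w : Euc n → ℝ) (c : Euc n), Reg w c r l L →
    (∀ y ∈ closedBall c r, ∀ I : List (Fin n), 2 ≤ I.length → I.length ≤ N + 2 → |ddl I w y| ≤ K) →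
    ∀ y ∈ closedBall c (r / 2), ∀ I : List (Fin n), I.length = N + 3 → |ddl I w y| ≤ K' := by
  obtain ⟨C1, hC1, H1⟩ := L_bound n N K
  obtain ⟨C2, hC2, H2⟩ := L_bound n (N + 1) K
  set P := (n : ℝ) ^ (N + 2) * K ^ 2 with hP
  have hP0 : 0 ≤ P := by positivity
  set X1 := 2 * n ^ (N + 2) * (Real.sqrt P * C1) with hX1
  have hX10 : 0 ≤ X1 := by positivity
  set X2 := 2 * (n : ℝ) ^ (N + 3) * C2 with hX2
  have hX20 : 0 ≤ X2 := by positivity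
  set C := 1 + P + X1 * (X1 * L) ^ 3 + 4 * n * l⁻¹ * P + X2 + X2 * (X2 * L / 2) ^ 2 with hC
  have q1 : 0 ≤ X1 * (X1 * L) ^ 3 := by positivity
  have q2 : 0 ≤ 4 * n * l⁻¹ * P := by positivity
  have q3 : 0 ≤ X2 * (X2 * L / 2) ^ 2 := by positivity
  obtain ⟨C', hC', H⟩ := bern n (B := l⁻¹) (lam := 1 / L) (C := C) (r := r) (by positivity) (by positivity) (by linarith) hr
  refine ⟨max 1 (Real.sqrt C'), le_max_left _ _, fun w c hR hb y hy I hI => ?_⟩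
  have hsm := hR.sm
  have hmain := H (Pk (N + 2) w) (Pk (N + 3) w) c (fun x hx => (hsm x hx).pk _) (fun x hx => (hsm x hx).pk _) ?_
    (fun x _ => Pk_nonneg _ _ _) ?_ y hy
  · have h1 := abs_le_Pk w y I
    rw [hI] at h1
    exact h1.trans ((Real.sqrt_le_sqrt hmain).trans (le_max_right _ _))
  · intro x hx
    refine ⟨Pk_nonneg _ _ _, ?_⟩
    have : Pk (N + 2) w x ≤ P := Pk_le fun I hI => hb x hx I (by omega) (by omega)
    linarith
  intro x hx hq1
  have hxc := ball_subset_closedBall hx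
  have hpP : Pk (N + 2) w x ≤ P := Pk_le fun I hI => hb x hxc I (by omega) (by omega)
  have hsx := hsm x hxc
  obtain ⟨b, hbf, hbn, hbL⟩ := hR.frame hl hxc
  have hpsd := (hR.pd hl hxc).posSemidef
  set q := Pk (N + 3) w x with hq
  set s := Real.sqrt q with hs
  have hs1 : 1 ≤ s := Real.one_le_sqrt.2 hq1
  have hss : s ^ 2 = q := Real.sq_sqrt (by linarith)
  set T : ℝ := s ^ (((N + 1 : ℕ) : ℝ)⁻¹) with hT
  have hT1 : 1 ≤ T := Real.one_le_rpow hs1 (by positivity)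
  have hTs : T ^ (N + 1) = s := Real.rpow_inv_natCast_pow (by linarith) (by omega)
  refine ⟨b, hbn, ?_, ?_, ?_⟩
  · -- first inequality
    have hY := H1 w c r l L x T hR hl hx hT1 (by
      intro I h2 h3
      by_cases h : I.length ≤ N + 2
      · refine (hb x hxc I h2 h).trans ?_
        exact le_mul_of_one_le_right (by linarith) (one_le_pow₀ hT1)
      · have h4 : I.length = N + 3 := by omega
        have h5 := abs_le_Pk w x I
        rw [h4] at h5 ⊢
        have e : N + 3 - 2 = N + 1 := by omega
        rw [e, hTs]
        exact h5.trans (le_mul_of_one_le_left (by linarith) hK))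
    have hLp := L_pk hbf hpsd hL (hR.up x hxc) hsx (N + 2) (Y := C1 * T ^ (N + 2)) (by
      intro I hI
      rw [hbL _ (hsx.ddl I).two]
      exact hY I hI)
    have t1 : T ≤ Real.sqrt s := by
      refine Real.le_sqrt_of_sq_le ?_
      rw [← hTs]; exact pow_le_pow_right₀ hT1 (by omega)
    have t2 : T ^ (N + 2) ≤ s * Real.sqrt s := by
      rw [pow_succ, hTs]; exact mul_le_mul_of_nonneg_left t1 (by linarith)
    have t3 : 2 * (n : ℝ) ^ (N + 2) * (Real.sqrt (Pk (N + 2) w x) * (C1 * T ^ (N + 2))) ≤ X1 * (s * Real.sqrt s) := by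
      have : Real.sqrt (Pk (N + 2) w x) ≤ Real.sqrt P := Real.sqrt_le_sqrt hpP
      calc 2 * (n : ℝ) ^ (N + 2) * (Real.sqrt (Pk (N + 2) w x) * (C1 * T ^ (N + 2))) ≤ 2 * (n : ℝ) ^ (N + 2) * (Real.sqrt P * (C1 * (s * Real.sqrt s))) := by gcongr
        _ = X1 * (s * Real.sqrt s) := by rw [hX1]; ring
    have t4 := young1 hX10 hL (Real.sqrt_nonneg s) (Real.sq_sqrt (by linarith : 0 ≤ s)).symm
    rw [hss] at t4
    have t5 : 2 / L * Pk (N + 2 + 1) w x = 2 * (q / L) := by rw [hq]; ring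
    rw [t5] at hLp
    have t6 : 1 / L * q = q / L := by ring
    rw [t6]
    linarith
  · have := G_pk hbn hsx (N + 2)
    refine this.trans ?_
    change _ * q ≤ C * q
    refine mul_le_mul_of_nonneg_right ?_ (by linarith)
    have : 4 * n * l⁻¹ * Pk (N + 2) w x ≤ 4 * n * l⁻¹ * P := mul_le_mul_of_nonneg_left hpP (by positivity)
    linarith
  · set R := Pk (N + 4) w x with hRR
    set ρ := Real.sqrt R with hρ
    have hρ0 : 0 ≤ ρ := Real.sqrt_nonneg _
    have hρR : ρ ^ 2 = R := Real.sq_sqrt (Pk_nonneg _ _ _)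
    set T2 : ℝ := ρ ^ (((N + 2 : ℕ) : ℝ)⁻¹) with hT2
    have hT20 : 0 ≤ T2 := Real.rpow_nonneg hρ0 _
    have hTρ : T2 ^ (N + 2) = ρ := Real.rpow_inv_natCast_pow hρ0 (by omega)
    set Θ := max T T2 with hΘ
    have hΘ1 : 1 ≤ Θ := hT1.trans (le_max_left _ _)
    have hY := H2 w c r l L x Θ hR hl hx hΘ1 (by
      intro I h2 h3
      by_cases h : I.length ≤ N + 2
      · refine (hb x hxc I h2 h).trans ?_
        exact le_mul_of_one_le_right (by linarith) (one_le_pow₀ hΘ1)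
      · have h5 := abs_le_Pk w x I
        by_cases h4 : I.length = N + 3
        · rw [h4] at h5 ⊢
          have e : N + 3 - 2 = N + 1 := by omega
          rw [e]
          have h6 : s ≤ Θ ^ (N + 1) := by rw [← hTs]; exact pow_le_pow_left₀ (by linarith) (le_max_left _ _) _
          exact (h5.trans h6).trans (le_mul_of_one_le_left (by positivity) hK)
        · have h4 : I.length = N + 4 := by omega
          rw [h4] at h5 ⊢
          have e : N + 4 - 2 = N + 2 := by omega
          rw [e]
          have h6 : ρ ≤ Θ ^ (N + 2) := by rw [← hTρ]; exact pow_le_pow_left₀ hT20 (le_max_right _ _) _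
          exact (h5.trans h6).trans (le_mul_of_one_le_left (by positivity) hK))
    have hLp := L_pk hbf hpsd hL (hR.up x hxc) hsx (N + 3) (Y := C2 * Θ ^ (N + 3)) (by
      intro I hI
      rw [hbL _ (hsx.ddl I).two]
      exact hY I hI)
    have e0 : 2 * (n : ℝ) ^ (N + 3) * (Real.sqrt (Pk (N + 3) w x) * (C2 * Θ ^ (N + 3))) = X2 * s * Θ ^ (N + 3) := by
      rw [hX2]; ring
    rw [e0] at hLp
    have e1 : q * s = s ^ 3 := by rw [← hss]; ring
    rw [e1]
    have hs3 : 0 ≤ s ^ 3 := by positivity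
    have hbig : ∀ t : ℝ, 1 ≤ t → t ^ (N + 3) ≤ (t ^ (N + 1)) ^ 2 := fun t ht => by
      rw [← pow_mul]; exact pow_le_pow_right₀ ht (by omega)
    suffices hf : X2 * s * Θ ^ (N + 3) ≤ 2 / L * R + C * s ^ 3 by
      change 2 / L * R - _ ≤ _ at hLp
      linarith
    have hR0 : 0 ≤ 2 / L * R := mul_nonneg (by positivity) (Pk_nonneg _ _ _)
    rcases le_total T2 T with h | h
    · rw [hΘ, max_eq_left h]
      have a1 := hbig T hT1
      rw [hTs] at a1
      have a2 : X2 * s * T ^ (N + 3) ≤ X2 * s * s ^ 2 := mul_le_mul_of_nonneg_left a1 (by positivity)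
      have a3 : X2 * s ^ 3 ≤ C * s ^ 3 := mul_le_mul_of_nonneg_right (by linarith) hs3
      linarith [show X2 * s * s ^ 2 = X2 * s ^ 3 by ring]
    · rw [hΘ, max_eq_right h]
      have hT21 : 1 ≤ T2 := hT1.trans h
      have a0 : R = T2 ^ (N + 3) * T2 ^ (N + 1) := by rw [← hρR, ← hTρ]; ring
      by_cases h6 : X2 * s * L / 2 ≤ T2 ^ (N + 1)
      · have a1 := mul_le_mul_of_nonneg_left h6 (show 0 ≤ 2 / L * T2 ^ (N + 3) by positivity)
        have a2 : 2 / L * T2 ^ (N + 3) * (X2 * s * L / 2) = X2 * s * T2 ^ (N + 3) := by field_simp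
        have a3 : 0 ≤ C * s ^ 3 := mul_nonneg (by linarith) hs3
        rw [a0]; linarith
      · push Not at h6
        have a1 := (hbig T2 hT21).trans (pow_le_pow_left₀ (by positivity) h6.le 2)
        have a2 := mul_le_mul_of_nonneg_left a1 (show 0 ≤ X2 * s by positivity)
        have a3 : X2 * s * (X2 * s * L / 2) ^ 2 = X2 * (X2 * L / 2) ^ 2 * s ^ 3 := by ring
        have a4 : X2 * (X2 * L / 2) ^ 2 * s ^ 3 ≤ C * s ^ 3 := mul_le_mul_of_nonneg_right (by linarith) hs3
        linarith

end MA
end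

section
namespace MA
open Filter Topology Matrix Metric

variable {n : ℕ}

theorem reg_two {w : Euc n → ℝ} {c : Euc n} {r l L : ℝ} (h : Reg w c r l L) (hl : 0 < l) {y : Euc n} (hy : y ∈ closedBall c r)
    (i j : Fin n) : |dd (bas i) (dd (bas j) w) y| ≤ L := by
  have hs := (h.sm y hy).two
  have hp := (h.pd hl hy).posSemidef
  have hsym := hess_symm hs
  rw [dd_qf hs]
  set G := hessianMatrix w y
  have h1 := qf_nonneg hp (bas i + bas j)
  have h2 := qf_nonneg hp (bas i + (-1 : ℝ) • bas j)
  have h3 := h.up y hy (bas i)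
  have h4 := h.up y hy (bas j)
  have hs' := qf_symm hsym (bas j) (bas i)
  rw [bas_norm] at h3 h4
  simp only [qf_add_left, qf_add_right, qf_smul_left, qf_smul_right] at h1 h2
  rw [abs_le]
  constructor <;> linarith

theorem cubic_le {T Q a : ℝ} (hQ : 0 ≤ Q) (h : T ^ 2 ≤ Q * (a ^ 2) ^ 3) (ha : 0 ≤ a) (ha3 : a ≤ 3) : |T| ≤ Real.sqrt Q * 27 := by
  have : T ^ 2 ≤ (Real.sqrt Q * 27) ^ 2 := by
    rw [mul_pow, Real.sq_sqrt hQ]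
    refine h.trans (mul_le_mul_of_nonneg_left ?_ hQ)
    have := pow_le_pow_left₀ ha ha3 6
    calc (a ^ 2) ^ 3 = a ^ 6 := by ring
      _ ≤ 3 ^ 6 := this
      _ = 27 ^ 2 := by norm_num
  exact abs_le_of_sq_le_sq this (by positivity)

theorem reg_three {w : Euc n → ℝ} {c : Euc n} {r l L : ℝ} (h : Reg w c r l L) (hr : 0 < r) (hl : 0 < l) (hL : 0 < L) {y : Euc n} (hy : y ∈ closedBall c (r / 2))
    (i j k : Fin n) : |dd (bas i) (dd (bas j) (dd (bas k) w)) y| ≤ 32 * Real.sqrt (80 * n * L ^ 3 / (l * r ^ 2)) := by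
  set Q := 80 * n * L ^ 3 / (l * r ^ 2) with hQ
  have hQ0 : 0 ≤ Q := by positivity
  have hB := calabi_bound hr hl h.sm h.det h.low h.up y hy
  have hyc : y ∈ closedBall c r := closedBall_subset_closedBall (by linarith) hy
  have hs := h.sm y hyc
  set D := fderiv ℝ (fderiv ℝ (fderiv ℝ w)) y with hD
  have hT : ∀ a b c, dd a (dd b (dd c w)) y = D a b c := fun a b c => dd3_eq hs a b c
  have s1 : ∀ a b c, D a b c = D b a c := fun a b c => by
    rw [← hT, ← hT]; exact dd_comm2 (hs.dd c).two a b
  have s2 : ∀ a b c, D a b c = D a c b := fun a b c => by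
    rw [← hT, ← hT]; exact dd_congr_at (dd_comm_ev hs b c) a
  have hT3 : ∀ e, ‖e‖ ≤ 3 → |D e e e| ≤ Real.sqrt Q * 27 := fun e he => by
    rw [← hT]; exact cubic_le hQ0 (hB e) (norm_nonneg _) he
  rw [hT]
  set a := (bas i : Euc n)
  set b := (bas j : Euc n)
  set c := (bas k : Euc n)
  have na : ‖a‖ = 1 := bas_norm i
  have nb : ‖b‖ = 1 := bas_norm j
  have nc : ‖c‖ = 1 := bas_norm k
  have nab := norm_add_le a b
  have nbc := norm_add_le b c
  have nac := norm_add_le a c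
  have nabc := norm_add_le (a + b) c
  have e1 := hT3 (a + b + c) (by linarith)
  have e2 := hT3 (a + b) (by linarith)
  have e3 := hT3 (b + c) (by linarith)
  have e4 := hT3 (a + c) (by linarith)
  have e5 := hT3 a (by linarith)
  have e6 := hT3 b (by linarith)
  have e7 := hT3 c (by linarith)
  have key : 6 * D a b c = D (a + b + c) (a + b + c) (a + b + c) - D (a + b) (a + b) (a + b) - D (b + c) (b + c) (b + c) - D (a + c) (a + c) (a + c)
      + D a a a + D b b b + D c c c := by
    simp only [map_add, _root_.add_apply]
    have f1 := s1 b a c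
    have f2 := s2 a c b
    have f3 : D b c a = D a b c := by rw [s2, s1]
    have f4 : D c a b = D a b c := by rw [s1, s2]
    have f5 : D c b a = D a b c := by rw [s2, f4]
    linarith [s1 a b a, s2 a a b, s1 b a b, s2 b b a, s1 a c a, s2 a a c, s1 c a c, s2 c c a, s1 b c b, s2 b b c, s1 c b c, s2 c c b]
  rw [abs_le] at *
  constructor <;> linarith

theorem interior_reg (n : ℕ) {l L r : ℝ} (hl : 0 < l) (hL : 0 < L) (hr : 0 < r) :
    ∃ K : ℝ, 1 ≤ K ∧ ∀ (w : Euc n → ℝ) (c : Euc n), Reg w c r l L →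
    ∀ y ∈ closedBall c (r / 8), ∀ I : List (Fin n), 2 ≤ I.length → I.length ≤ 5 → |ddl I w y| ≤ K := by
  set K1 := max 1 (max L (32 * Real.sqrt (80 * n * L ^ 3 / (l * r ^ 2)))) with hK1
  obtain ⟨K2, hK2, H2⟩ := reg_step n 1 le_rfl hl hL (K := K1) (le_max_left _ _) (half_pos hr)
  obtain ⟨K3, hK3, H3⟩ := reg_step n 2 (by norm_num) hl hL (K := max K1 K2) ((le_max_left _ _).trans (le_max_left _ _)) (half_pos (half_pos hr))
  refine ⟨max (max K1 K2) K3, hK3.trans (le_max_right _ _), fun w c hR => ?_⟩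
  have s1 : closedBall c (r / 2) ⊆ closedBall c r := closedBall_subset_closedBall (by linarith)
  have s2 : closedBall c (r / 2 / 2) ⊆ closedBall c (r / 2) := closedBall_subset_closedBall (by linarith)
  have s3 : closedBall c (r / 2 / 2 / 2) ⊆ closedBall c (r / 2 / 2) := closedBall_subset_closedBall (by linarith)
  have b1 : ∀ y ∈ closedBall c (r / 2), ∀ I : List (Fin n), 2 ≤ I.length → I.length ≤ 1 + 2 → |ddl I w y| ≤ K1 := by
    intro y hy I h2 h3
    match I, h2, h3 with
    | [], h2, h3 => simp at h2
    | [_], h2, h3 => simp at h2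
    | [i, j], _, _ => exact (reg_two hR hl (s1 hy) i j).trans ((le_max_left _ _).trans (le_max_right _ _))
    | [i, j, k], _, _ => exact (reg_three hR hr hl hL hy i j k).trans ((le_max_right _ _).trans (le_max_right _ _))
    | _ :: _ :: _ :: _ :: _, h2, h3 => simp only [List.length_cons] at h3; omega
  have b2 := H2 w c (hR.sub s1) b1
  have b3 := H3 w c (hR.sub (s2.trans s1)) (by
    intro y hy I h2 h3
    by_cases h : I.length ≤ 1 + 2
    · exact (b1 y (s2 hy) I h2 h).trans (le_max_left _ _)
    · exact (b2 y hy I (by omega)).trans (le_max_right _ _))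
  intro y hy I h2 h3
  have hy : y ∈ closedBall c (r / 2 / 2 / 2) := by convert hy using 2; ring
  by_cases h : I.length ≤ 1 + 2
  · exact (b1 y (s2 (s3 hy)) I h2 h).trans ((le_max_left _ _).trans (le_max_left _ _))
  by_cases h' : I.length = 1 + 3
  · exact (b2 y (s3 hy) I h').trans ((le_max_right _ _).trans (le_max_left _ _))
  · exact (b3 y hy I (by omega)).trans (le_max_right _ _)

end MA
end

section
namespace MA
open Filter Topology Matrix Metric

variable {n : ℕ}

theorem F_eq {v v0 : Euc n → ℝ} {c : Euc n} {r l L : ℝ} (hv : Reg v c r l L) (hv0 : Reg v0 c r l L) (hl : 0 < l) (e : Euc n)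
    {x : Euc n} (hx : x ∈ ball c r) :
    (fun y => ∑ i, ∑ j, co v i j y * dd (bas i) (dd (bas j) (dd e (fun z => v z - v0 z))) y) =ᶠ[𝓝 x]
      fun y => ∑ i, ∑ j, (co v0 i j y - co v i j y) * dd (bas i) (dd (bas j) (dd e v0)) y := by
  have hs := hv.sm x (ball_subset_closedBall hx)
  have hs0 := hv0.sm x (ball_subset_closedBall hx)
  filter_upwards [hv.eqn hl e hx, hv0.eqn hl e hx, hs.ev, hs0.ev] with y h1 h2 h3 h4
  have e1 : ∀ i j, dd (bas i) (dd (bas j) (dd e (fun z => v z - v0 z))) y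
      = dd (bas i) (dd (bas j) (dd e v)) y - dd (bas i) (dd (bas j) (dd e v0)) y := fun i j => by
    have : dd e (fun z => v z - v0 z) =ᶠ[𝓝 y] fun z => dd e v z - dd e v0 z := by
      filter_upwards [h3.ev, h4.ev] with z h5 h6 using dd_sub e h5.diff h6.diff
    rw [dd_congr_at (dd_congr this _), dd2_sub _ _ (h3.dd e).two (h4.dd e).two]
  simp only [e1, mul_sub, sub_mul, Finset.sum_sub_distrib] at *
  linarith

theorem L_phi (n N : ℕ) (hN : N ≤ 2) (K : ℝ) (hK : 1 ≤ K) : ∃ C : ℝ, 0 ≤ C ∧ ∀ (v v0 : Euc n → ℝ) (c : Euc n) (r l L : ℝ) (x : Euc n) (M : ℝ),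
    Reg v c r l L → Reg v0 c r l L → 0 < l → x ∈ ball c r → 0 ≤ M →
    (∀ I : List (Fin n), 2 ≤ I.length → I.length ≤ 5 → |ddl I v x| ≤ K ∧ |ddl I v0 x| ≤ K) →
    (∀ I : List (Fin n), 2 ≤ I.length → I.length ≤ N + 2 → |ddl I (fun z => v z - v0 z) x| ≤ M) →
    ∀ I : List (Fin n), I.length = N + 1 → |∑ i, ∑ j, co v i j x * dd (bas i) (dd (bas j) (ddl I (fun z => v z - v0 z))) x| ≤ C * M := by
  obtain ⟨CA, hCA, H⟩ := Bp_adj n N K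
  refine ⟨n * (n * (2 ^ N * (CA * K))) + n * (n * (2 ^ N * (2 * CA))), by positivity, ?_⟩
  intro v v0 c r l L x M hv hv0 hl hx hM hK2 hMφ I hI
  have hs := hv.sm x (ball_subset_closedBall hx)
  have hs0 := hv0.sm x (ball_subset_closedBall hx)
  have hsφ := hs.sub hs0
  match I, hI with
  | [], hI => simp at hI
  | e :: J, hI =>
    have hJ : J.length = N := by simpa using hI
    have bA : ∀ i j, Bp N x CA 1 M (co v i j) (co v0 i j) := fun i j =>
      H x 1 M zero_le_one hM _ _ (fun i j => by
        refine ⟨(hs.dd _).dd _, (hs0.dd _).dd _, fun J hJ => ?_, fun J hJ => ?_, fun J hJ => ?_⟩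
        · have := (hK2 (J ++ [i, j]) (by simp) (by simp; omega)).1
          rw [ddl_append] at this
          rw [one_pow, mul_one]; exact this
        · have := (hK2 (J ++ [i, j]) (by simp) (by simp; omega)).2
          rw [ddl_append] at this
          rw [one_pow, mul_one]; exact this
        · have := (hMφ (J ++ [i, j]) (by simp) (by simp; omega))
          rw [ddl_append] at this
          rw [one_pow, mul_one]
          have e1 : ddl [i, j] (fun z => v z - v0 z) =ᶠ[𝓝 x] fun y => dd (bas i) (dd (bas j) v) y - dd (bas i) (dd (bas j) v0) y :=
            ddl_sub hs hs0 [i, j]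
          rw [(ddl_congr e1 J).eq_of_nhds] at this
          exact this.trans (le_mul_of_one_le_left hM hK)) i j
    have bF : Bd N x (n * (n * (2 ^ N * (CA * M * K)))) 1 (fun y => ∑ i, ∑ j, (co v0 i j y - co v i j y) * dd (bas i) (dd (bas j) (dd (bas e) v0)) y) := by
      have b0 : ∀ i j, Bd N x (2 ^ N * (CA * M * K)) 1 (fun y => (co v0 i j y - co v i j y) * dd (bas i) (dd (bas j) (dd (bas e) v0)) y) := fun i j => by
        refine Bd.mul ((bA i j).s0.sub (bA i j).s) (((hs0.dd _).dd _).dd _) zero_le_one ?_ ?_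
        · have := (bA i j).bd.cmul (-1)
          simp only [abs_neg, abs_one, one_mul] at this
          refine this.congr (Eventually.of_forall fun y => ?_)
          ring
        · intro J hJ
          have := (hK2 (J ++ [i, j, e]) (by simp) (by simp; omega)).2
          rw [ddl_append] at this
          rw [one_pow, mul_one]; exact this
      have hsij : ∀ i j, Sm (fun y => (co v0 i j y - co v i j y) * dd (bas i) (dd (bas j) (dd (bas e) v0)) y) x := fun i j =>
        ((bA i j).s0.sub (bA i j).s).mul (((hs0.dd _).dd _).dd _)
      have := Bd.sum (s := Finset.univ) (fun i _ => Sm.sum fun j _ => hsij i j) fun i _ => Bd.sum (s := Finset.univ) (fun j _ => hsij i j) fun j _ => b0 i j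
      simpa using this
    have hsF : Sm (fun y => ∑ i, ∑ j, (co v0 i j y - co v i j y) * dd (bas i) (dd (bas j) (dd (bas e) v0)) y) x :=
      Sm.sum fun i _ => Sm.sum fun j _ => ((bA i j).s0.sub (bA i j).s).mul (((hs0.dd _).dd _).dd _)
    have e2 : ∀ i j, dd (bas i) (dd (bas j) (ddl (e :: J) (fun z => v z - v0 z))) x = dd (bas i) (dd (bas j) (ddl J (dd (bas e) (fun z => v z - v0 z)))) x := fun i j => by
      rw [ddl_cons]
      exact dd_congr_at (dd_congr (dd_ddl_comm hsφ _ _) _) _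
    simp only [e2]
    have hF := F_eq hv hv0 hl (bas e) hx
    cases N with
    | zero =>
      rw [List.length_eq_zero_iff] at hJ
      subst hJ
      have h1 := hF.eq_of_nhds
      simp only [ddl_nil]
      rw [h1]
      refine bF.val.trans ?_
      have : 0 ≤ n * (n * (2 ^ 0 * (2 * CA))) * M := by positivity
      linarith
    | succ N' =>
      have := comm_bound zero_le_one (hsφ.dd (bas e)) (fun i j => (bA i j).s) hsF hF (fun i j => (bA i j).b) (Cφ := M) (fun i j J hJ => by
        have := (hMφ (J ++ [i, j, e]) (by simp) (by simp; omega))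
        rw [ddl_append] at this
        rw [one_pow, mul_one]; exact this) bF hJ
      refine this.trans (le_of_eq ?_)
      ring

/-- trace form of the arithmetic-geometric inequality -/
theorem trace_ge (hn : n ≠ 0) {M : Mat n} (h : M.PosSemidef) (hd : M.det = 1) : (n : ℝ) ≤ M.trace := by
  by_contra hlt
  push Not at hlt
  have hn0 : (0:ℝ) < n := by positivity
  have ht := h.trace_nonneg
  obtain ⟨s, hs1, hs2⟩ : ∃ s : ℝ, 1 < s ∧ s * M.trace ≤ n := by
    rcases eq_or_lt_of_le ht with h0 | h0
    · exact ⟨2, by norm_num, by rw [← h0]; simp⟩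
    · refine ⟨n / M.trace, (one_lt_div h0).2 hlt, ?_⟩
      rw [div_mul_cancel₀ _ h0.ne']
  have h1 := det_le_one (h.smul (show 0 ≤ s by linarith)) (by rw [Matrix.trace_smul]; exact hs2)
  rw [Matrix.det_smul, hd, mul_one, Fintype.card_fin] at h1
  exact absurd h1 (not_le.2 (one_lt_pow₀ hs1 hn))

theorem L_neg (hn : n ≠ 0) {v v0 : Euc n → ℝ} {c : Euc n} {r l L : ℝ} (hv : Reg v c r l L) (hv0 : Reg v0 c r l L) (hl : 0 < l)
    {x : Euc n} (hx : x ∈ closedBall c r) {b : Fin n → Euc n} (hb : Frame (hessianMatrix v x) b) :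
    ∑ k, dd (b k) (dd (b k) (fun z => v z - v0 z)) x ≤ 0 := by
  have h1 := (hv.sm x hx).two
  have h2 := (hv0.sm x hx).two
  have e1 : ∀ k, dd (b k) (dd (b k) (fun z => v z - v0 z)) x = 1 - qf (hessianMatrix v0 x) (b k) (b k) := fun k => by
    rw [dd2_sub _ _ h1 h2, dd_qf h1, dd_qf h2, hb.qf, if_pos rfl]
  simp only [e1]
  rw [Finset.sum_sub_distrib]
  have e2 : ∑ k, qf (hessianMatrix v0 x) (b k) (b k) = (fm b * hessianMatrix v0 x * (fm b)ᵀ).trace := by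
    simp only [Matrix.trace, Matrix.diag_apply, fm_apply]
  have hp : (fm b * hessianMatrix v0 x * (fm b)ᵀ).PosSemidef := by
    have := (hv0.pd hl hx).posSemidef.mul_mul_conjTranspose_same (fm b)
    simpa using this
  have hd := hb.det
  have d1 : (hessianMatrix v x).det = 1 := hv.det x hx
  have d2 : (hessianMatrix v0 x).det = 1 := hv0.det x hx
  rw [d1, mul_one] at hd
  have := trace_ge hn hp (by rw [Matrix.det_mul, Matrix.det_mul, Matrix.det_transpose, d2, mul_one, ← pow_two, hd])
  rw [e2]
  simp
  exact this

end MA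
end

section
namespace MA
open Filter Topology Matrix Metric

variable {n : ℕ}

theorem young2 {A L ρ σ X : ℝ} (hA : 0 ≤ A) (hL : 0 < L) (hσ : 0 ≤ σ) (hX : 0 ≤ X) :
    A * (σ * (ρ + σ + X)) ≤ ρ ^ 2 / L + (A ^ 2 * L / 4 + A + A * X) * (σ ^ 2 + 1) := by
  have h1 : A * σ * ρ ≤ ρ ^ 2 / L + A ^ 2 * L / 4 * σ ^ 2 := by
    have : 0 ≤ (ρ - A * L * σ / 2) ^ 2 / L := by positivity
    have e : (ρ - A * L * σ / 2) ^ 2 / L = ρ ^ 2 / L - A * σ * ρ + A ^ 2 * L / 4 * σ ^ 2 := by field_simp; ring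
    linarith
  have h2 : A * X * σ ≤ A * X * (σ ^ 2 + 1) := mul_le_mul_of_nonneg_left (by linarith [sq_nonneg (σ - 1)]) (by positivity)
  have h3 : 0 ≤ A ^ 2 * L / 4 := by positivity
  linarith

theorem L_q (n k : ℕ) (hk1 : 1 ≤ k) (hk3 : k ≤ 3) {K L X : ℝ} (hK : 1 ≤ K) (hL : 0 < L) (hX : 0 ≤ X) :
    ∃ C : ℝ, 0 ≤ C ∧ ∀ (v v0 : Euc n → ℝ) (c : Euc n) (r l : ℝ) (x : Euc n) (s : ℝ),
    Reg v c r l L → Reg v0 c r l L → 0 < l → x ∈ ball c r → 0 < s →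
    (∀ I : List (Fin n), 2 ≤ I.length → I.length ≤ 5 → |ddl I v x| ≤ K ∧ |ddl I v0 x| ≤ K) →
    (∀ I : List (Fin n), 1 ≤ I.length → I.length < k → |ddl I (fun z => s * (v z - v0 z)) x| ≤ X) →
    ∀ b, Frame (hessianMatrix v x) b → (∀ f : Euc n → ℝ, ContDiffAt ℝ 2 f x →
      ∑ k, dd (b k) (dd (b k) f) x = ∑ i, ∑ j, co v i j x * dd (bas i) (dd (bas j) f) x) →
    1 / L * Pk (k + 1) (fun z => s * (v z - v0 z)) x - C * (Pk k (fun z => s * (v z - v0 z)) x + 1)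
      ≤ ∑ j, dd (b j) (dd (b j) (Pk k (fun z => s * (v z - v0 z)))) x := by
  obtain ⟨C, hC, H⟩ := L_phi n (k - 1) (by omega) K hK
  set A := 2 * (n : ℝ) ^ k * C with hA
  have hA0 : 0 ≤ A := by positivity
  refine ⟨A ^ 2 * L / 4 + A + A * X, by positivity, ?_⟩
  intro v v0 c r l x s hv hv0 hl hx hs hK2 hXψ b hb hbL
  have hxc := ball_subset_closedBall hx
  have hsφ := (hv.sm x hxc).sub (hv0.sm x hxc)
  set ψ : Euc n → ℝ := fun z => s * (v z - v0 z) with hψ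
  have hsψ : Sm ψ x := hsφ.cmul s
  set ρ := Real.sqrt (Pk (k + 1) ψ x) with hρ
  set σ := Real.sqrt (Pk k ψ x) with hσ
  have hρ0 : 0 ≤ ρ := Real.sqrt_nonneg _
  have hσ0 : 0 ≤ σ := Real.sqrt_nonneg _
  have hρ2 : ρ ^ 2 = Pk (k + 1) ψ x := Real.sq_sqrt (Pk_nonneg _ _ _)
  have hσ2 : σ ^ 2 = Pk k ψ x := Real.sq_sqrt (Pk_nonneg _ _ _)
  have hdl : ∀ I : List (Fin n), ddl I ψ = fun y => s * ddl I (fun z => v z - v0 z) y := fun I => ddl_cmul s _ I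
  have hY : ∀ I : List (Fin n), I.length = k → |∑ j, dd (b j) (dd (b j) (ddl I ψ)) x| ≤ C * (ρ + σ + X) := by
    intro I hI
    have h1 := H v v0 c r l L x ((ρ + σ + X) / s) hv hv0 hl hx (by positivity) hK2 (by
      intro J hJ2 hJ3
      rw [le_div_iff₀ hs]
      have : |ddl J ψ x| ≤ ρ + σ + X := by
        by_cases h : J.length < k
        · have := hXψ J (by omega) h; linarith
        · have h5 := abs_le_Pk ψ x J
          by_cases h4 : J.length = k
          · rw [h4] at h5; linarith
          · have h4 : J.length = k + 1 := by omega
            rw [h4] at h5; linarith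
      rw [hdl, abs_mul, abs_of_pos hs] at this
      linarith) I (by omega)
    rw [hbL _ (hsψ.ddl I).two]
    simp only [hdl, dd_cmul]
    have e : ∑ i, ∑ j, co v i j x * (s * dd (bas i) (dd (bas j) (ddl I fun z => v z - v0 z)) x)
        = s * ∑ i, ∑ j, co v i j x * dd (bas i) (dd (bas j) (ddl I fun z => v z - v0 z)) x := by
      simp only [Finset.mul_sum]
      refine Finset.sum_congr rfl fun i _ => Finset.sum_congr rfl fun j _ => by ring
    rw [e, abs_mul, abs_of_pos hs]
    have h2 := mul_le_mul_of_nonneg_left h1 hs.le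
    refine h2.trans (le_of_eq ?_)
    field_simp
  have hLp := L_pk hb (hv.pd hl hxc).posSemidef hL (hv.up x hxc) hsψ k hY
  have hy := young2 (ρ := ρ) hA0 hL hσ0 hX
  have e3 : 2 * (n : ℝ) ^ k * (σ * (C * (ρ + σ + X))) = A * (σ * (ρ + σ + X)) := by rw [hA]; ring
  rw [← hρ2, ← hσ2] at *
  change 2 / L * ρ ^ 2 - 2 * (n : ℝ) ^ k * (Real.sqrt (σ ^ 2) * (C * (ρ + σ + X))) ≤ _ at hLp
  rw [Real.sqrt_sq hσ0, e3] at hLp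
  have e4 : 2 / L * ρ ^ 2 = 2 * (ρ ^ 2 / L) := by ring
  have e5 : 1 / L * ρ ^ 2 = ρ ^ 2 / L := by ring
  rw [e5]; linarith

theorem bern_q (n k : ℕ) (hk1 : 1 ≤ k) (hk3 : k ≤ 3) {K l L X C0 r : ℝ} (hK : 1 ≤ K) (hl : 0 < l) (hL : 0 < L) (hX : 0 ≤ X) (hC0 : 0 < C0) (hr : 0 < r) :
    ∃ X' : ℝ, 0 ≤ X' ∧ ∀ (v v0 : Euc n → ℝ) (c : Euc n) (s : ℝ),
    Reg v c r l L → Reg v0 c r l L → 0 < s →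
    (∀ x ∈ closedBall c r, ∀ I : List (Fin n), 2 ≤ I.length → I.length ≤ 5 → |ddl I v x| ≤ K ∧ |ddl I v0 x| ≤ K) →
    (∀ x ∈ closedBall c r, ∀ I : List (Fin n), 1 ≤ I.length → I.length < k → |ddl I (fun z => s * (v z - v0 z)) x| ≤ X) →
    ∀ p : Euc n → ℝ, (∀ x ∈ closedBall c r, Sm p x) → (∀ x ∈ closedBall c r, 0 ≤ p x ∧ p x ≤ C0) →
    (∀ x ∈ ball c r, ∀ b, Frame (hessianMatrix v x) b → (∀ i, ‖b i‖ ^ 2 ≤ l⁻¹) → (∀ f : Euc n → ℝ, ContDiffAt ℝ 2 f x →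
      ∑ k, dd (b k) (dd (b k) f) x = ∑ i, ∑ j, co v i j x * dd (bas i) (dd (bas j) f) x) →
      1 / L * Pk k (fun z => s * (v z - v0 z)) x ≤ ∑ j, dd (b j) (dd (b j) p) x + C0 ∧
      ∑ j, (dd (b j) p x) ^ 2 ≤ C0 * Pk k (fun z => s * (v z - v0 z)) x) →
    ∀ y ∈ closedBall c (r / 2), ∀ I : List (Fin n), I.length = k → |ddl I (fun z => s * (v z - v0 z)) y| ≤ X' := by
  obtain ⟨C, hC, H⟩ := L_q n k hk1 hk3 (L := L) hK hL hX
  obtain ⟨C', hC', HB⟩ := bern n (B := l⁻¹) (lam := 1 / L) (C := C0 + 2 * C) (r := r) (by positivity) (by positivity) (by positivity) hr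
  refine ⟨Real.sqrt C', Real.sqrt_nonneg _, ?_⟩
  intro v v0 c s hv hv0 hs hK2 hXψ p hp hpC hpp y hy I hI
  set ψ : Euc n → ℝ := fun z => s * (v z - v0 z) with hψ
  have hsψ : ∀ x ∈ closedBall c r, Sm ψ x := fun x hx => ((hv.sm x hx).sub (hv0.sm x hx)).cmul s
  have := HB p (Pk k ψ) c hp (fun x hx => (hsψ x hx).pk k) (fun x hx => ⟨(hpC x hx).1, by linarith [(hpC x hx).2]⟩)
    (fun x hx => Pk_nonneg _ _ _) (fun x hx hq => by
      have hxc := ball_subset_closedBall hx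
      obtain ⟨b, hb, hbn, hbL⟩ := hv.frame hl hxc
      obtain ⟨h1, h2⟩ := hpp x hx b hb hbn hbL
      have h3 := H v v0 c r l x s hv hv0 hl hx hs (hK2 x hxc) (hXψ x hxc) b hb hbL
      have hP := Pk_nonneg (k + 1) ψ x
      refine ⟨b, hbn, by linarith, ?_, ?_⟩
      · refine h2.trans ?_
        exact mul_le_mul_of_nonneg_right (by linarith) (by linarith)
      · have hsq : 1 ≤ Real.sqrt (Pk k ψ x) := Real.one_le_sqrt.2 hq
        have h4 : Pk k ψ x ≤ Pk k ψ x * Real.sqrt (Pk k ψ x) := le_mul_of_one_le_right (by linarith) hsq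
        have h5 : 0 ≤ 1 / L * Pk (k + 1) ψ x := by positivity
        have h6 : C * (Pk k ψ x + 1) ≤ (2 * C) * (Pk k ψ x * Real.sqrt (Pk k ψ x)) := by
          have := mul_le_mul_of_nonneg_left (show Pk k ψ x + 1 ≤ 2 * (Pk k ψ x * Real.sqrt (Pk k ψ x)) by linarith) hC
          linarith
        have h7 : 0 ≤ C0 * (Pk k ψ x * Real.sqrt (Pk k ψ x)) := by positivity
        linarith) y hy
  have h1 := abs_le_Pk ψ y I
  rw [hI] at h1
  exact h1.trans (Real.sqrt_le_sqrt this)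

theorem diff_main (hn : n ≠ 0) {K l L r : ℝ} (hK : 1 ≤ K) (hl : 0 < l) (hL : 0 < L) (hr : 0 < r) :
    ∃ X' : ℝ, 0 ≤ X' ∧ ∀ (v v0 : Euc n → ℝ) (c : Euc n) (s : ℝ),
    Reg v c r l L → Reg v0 c r l L → 0 < s →
    (∀ x ∈ closedBall c r, ∀ I : List (Fin n), 2 ≤ I.length → I.length ≤ 5 → |ddl I v x| ≤ K ∧ |ddl I v0 x| ≤ K) →
    (∀ x ∈ closedBall c r, |s * (v x - v0 x)| ≤ 1) →
    ∀ I : List (Fin n), 1 ≤ I.length → I.length ≤ 3 → |ddl I (fun z => s * (v z - v0 z)) c| ≤ X' := by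
  have hli : 0 < l⁻¹ := by positivity
  obtain ⟨X1, hX1, H1⟩ := bern_q n 1 le_rfl (by norm_num) hK hl hL (X := 0) le_rfl (C0 := 9 + 36 * (n * l⁻¹)) (by positivity) hr
  obtain ⟨D2, hD2, G2⟩ := L_q n 1 le_rfl (by norm_num) (L := L) hK hL hX1
  set p1 := (n : ℝ) ^ 1 * X1 ^ 2 with hp1
  have hp10 : 0 ≤ p1 := by positivity
  obtain ⟨X2, hX2, H2⟩ := bern_q n 2 (by norm_num) (by norm_num) hK hl hL (X := X1) hX1 (C0 := 1 + p1 + D2 * (p1 + 1) + 4 * n * l⁻¹ * p1) (by positivity) (half_pos hr)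
  set X12 := max X1 X2
  have hX12 : 0 ≤ X12 := hX1.trans (le_max_left _ _)
  obtain ⟨D3, hD3, G3⟩ := L_q n 2 (by norm_num) (by norm_num) (L := L) hK hL hX12
  set p2 := (n : ℝ) ^ 2 * X2 ^ 2 with hp2
  have hp20 : 0 ≤ p2 := by positivity
  obtain ⟨X3, hX3, H3⟩ := bern_q n 3 (by norm_num) (by norm_num) hK hl hL (X := X12) hX12 (C0 := 1 + p2 + D3 * (p2 + 1) + 4 * n * l⁻¹ * p2) (by positivity) (half_pos (half_pos hr))
  refine ⟨max X12 X3, hX12.trans (le_max_left _ _), ?_⟩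
  intro v v0 c s hv hv0 hs hK2 hb
  set ψ : Euc n → ℝ := fun z => s * (v z - v0 z) with hψ
  have hsψ : ∀ x ∈ closedBall c r, Sm ψ x := fun x hx => ((hv.sm x hx).sub (hv0.sm x hx)).cmul s
  have s1 : closedBall c (r / 2) ⊆ closedBall c r := closedBall_subset_closedBall (by linarith)
  have s2 : closedBall c (r / 2 / 2) ⊆ closedBall c (r / 2) := closedBall_subset_closedBall (by linarith)
  have s3 : closedBall c (r / 2 / 2 / 2) ⊆ closedBall c (r / 2 / 2) := closedBall_subset_closedBall (by linarith)
  have b1 := H1 v v0 c s hv hv0 hs hK2 (fun x hx I h1 h2 => by omega) (fun y => (ψ y - 2) ^ 2)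
    (fun x hx => ((hsψ x hx).sub (sm_const 2 x)).sq) (fun x hx => by
      refine ⟨sq_nonneg _, ?_⟩
      have h1 := hb x hx
      change |ψ x| ≤ 1 at h1
      rw [abs_le] at h1
      have h2 : (ψ x - 2) ^ 2 ≤ 9 := by nlinarith [h1.1, h1.2]
      have : 0 ≤ 36 * (n * l⁻¹) := by positivity
      linarith) (fun x hx b hbf hbn hbL => by
      have hxc := ball_subset_closedBall hx
      have h1 := hb x hxc
      change |ψ x| ≤ 1 at h1
      rw [abs_le] at h1
      have hsx := (hsψ x hxc).sub (sm_const 2 x)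
      have e0 : ∀ j, dd (b j) (fun y => ψ y - 2) = dd (b j) ψ := fun j => by
        ext y
        simp only [dd]
        rw [fderiv_sub_const]
      have hg := grad_lower hbf (hv.pd hl hxc).posSemidef hL (hv.up x hxc) ψ x
      have hg2 := grad_upper hbn ψ x
      have hP1 : Pk 1 ψ x = ∑ i, (dd (bas i) ψ x) ^ 2 := by
        rw [Pk_succ]; simp [ddl_nil]
      have hneg : ∑ j, dd (b j) (dd (b j) ψ) x ≤ 0 := by
        have := L_neg hn hv hv0 hl hxc hbf
        simp only [hψ, dd_cmul]
        rw [← Finset.mul_sum]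
        exact mul_nonpos_of_nonneg_of_nonpos hs.le this
      constructor
      · simp only [dd2_sq hsx, e0]
        rw [Finset.sum_add_distrib, ← Finset.mul_sum, ← Finset.mul_sum, ← Finset.mul_sum, hP1]
        have : 0 ≤ (ψ x - 2) * ∑ j, dd (b j) (dd (b j) ψ) x := mul_nonneg_of_nonpos_of_nonpos (by linarith) hneg
        have e : 1 / L * ∑ i, (dd (bas i) ψ x) ^ 2 = (∑ i, (dd (bas i) ψ x) ^ 2) / L := by ring
        rw [e]
        have : 0 ≤ 36 * (n * l⁻¹) := by positivity
        have : 0 ≤ (∑ i, (dd (bas i) ψ x) ^ 2) / L := div_nonneg (Finset.sum_nonneg fun _ _ => sq_nonneg _) hL.le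
        linarith
      · simp only [dd_sq hsx, e0, mul_pow]
        rw [← Finset.mul_sum, ← Finset.mul_sum, hP1]
        set Γ := ∑ j, (dd (b j) ψ x) ^ 2
        have hΓ : 0 ≤ Γ := Finset.sum_nonneg fun _ _ => sq_nonneg _
        have h2 : (ψ x - 2) ^ 2 ≤ 9 := by nlinarith [h1.1, h1.2]
        have h3 : (ψ x - 2) ^ 2 * Γ ≤ 9 * Γ := mul_le_mul_of_nonneg_right h2 hΓ
        have h4 : 0 ≤ ∑ i, (dd (bas i) ψ x) ^ 2 := Finset.sum_nonneg fun _ _ => sq_nonneg _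
        linarith)
  have P1b : ∀ x ∈ closedBall c (r / 2), Pk 1 ψ x ≤ p1 := fun x hx => Pk_le fun I hI => b1 x hx I hI
  have b1b : ∀ x ∈ closedBall c (r / 2), ∀ I : List (Fin n), 1 ≤ I.length → I.length < 2 → |ddl I ψ x| ≤ X1 :=
    fun x hx I h1 h2 => b1 x hx I (by omega)
  have b2 := H2 v v0 c s (hv.sub s1) (hv0.sub s1) hs (fun x hx => hK2 x (s1 hx)) b1b (Pk 1 ψ)
    (fun x hx => (hsψ x (s1 hx)).pk 1) (fun x hx => by
      refine ⟨Pk_nonneg _ _ _, ?_⟩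
      have := P1b x hx
      have : 0 ≤ D2 * (p1 + 1) + 4 * n * l⁻¹ * p1 := by positivity
      linarith) (fun x hx b hbf hbn hbL => by
      have hxc := ball_subset_closedBall hx
      have hP := P1b x hxc
      have q1 : 0 ≤ D2 * (p1 + 1) := by positivity
      have q2 : 0 ≤ 4 * n * l⁻¹ * p1 := by positivity
      constructor
      · have h1 := G2 v v0 c (r / 2) l x s (hv.sub s1) (hv0.sub s1) hl hx hs (hK2 x (s1 hxc)) (fun I h1 h2 => by omega) b hbf hbL
        have h2 : D2 * (Pk 1 ψ x + 1) ≤ D2 * (p1 + 1) := mul_le_mul_of_nonneg_left (by linarith) hD2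
        linarith
      · refine (G_pk hbn (hsψ x (s1 hxc)) 1).trans ?_
        refine mul_le_mul_of_nonneg_right ?_ (Pk_nonneg _ _ _)
        have : 4 * n * l⁻¹ * Pk 1 ψ x ≤ 4 * n * l⁻¹ * p1 := mul_le_mul_of_nonneg_left hP (by positivity)
        linarith)
  have P2b : ∀ x ∈ closedBall c (r / 2 / 2), Pk 2 ψ x ≤ p2 := fun x hx => Pk_le fun I hI => b2 x hx I hI
  have b2b : ∀ x ∈ closedBall c (r / 2 / 2), ∀ I : List (Fin n), 1 ≤ I.length → I.length < 3 → |ddl I ψ x| ≤ X12 :=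
    fun x hx I h1 h2 => by
      by_cases h : I.length = 1
      · exact (b1 x (s2 hx) I h).trans (le_max_left _ _)
      · exact (b2 x hx I (by omega)).trans (le_max_right _ _)
  have b3 := H3 v v0 c s (hv.sub (s2.trans s1)) (hv0.sub (s2.trans s1)) hs (fun x hx => hK2 x (s1 (s2 hx))) b2b (Pk 2 ψ)
    (fun x hx => (hsψ x (s1 (s2 hx))).pk 2) (fun x hx => by
      refine ⟨Pk_nonneg _ _ _, ?_⟩
      have := P2b x hx
      have : 0 ≤ D3 * (p2 + 1) + 4 * n * l⁻¹ * p2 := by positivity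
      linarith) (fun x hx b hbf hbn hbL => by
      have hxc := ball_subset_closedBall hx
      have hP := P2b x hxc
      have q1 : 0 ≤ D3 * (p2 + 1) := by positivity
      have q2 : 0 ≤ 4 * n * l⁻¹ * p2 := by positivity
      constructor
      · have h1 := G3 v v0 c (r / 2 / 2) l x s (hv.sub (s2.trans s1)) (hv0.sub (s2.trans s1)) hl hx hs (hK2 x (s1 (s2 hxc)))
          (fun I h1 h2 => b2b x hxc I h1 (by omega)) b hbf hbL
        have h2 : D3 * (Pk 2 ψ x + 1) ≤ D3 * (p2 + 1) := mul_le_mul_of_nonneg_left (by linarith) hD3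
        linarith
      · refine (G_pk hbn (hsψ x (s1 (s2 hxc))) 2).trans ?_
        refine mul_le_mul_of_nonneg_right ?_ (Pk_nonneg _ _ _)
        have : 4 * n * l⁻¹ * Pk 2 ψ x ≤ 4 * n * l⁻¹ * p2 := mul_le_mul_of_nonneg_left hP (by positivity)
        linarith)
  intro I h1 h3
  have hc2 : c ∈ closedBall c (r / 2 / 2) := mem_closedBall_self (by positivity)
  have hc3 : c ∈ closedBall c (r / 2 / 2 / 2) := mem_closedBall_self (by positivity)
  by_cases h : I.length < 3
  · exact (b2b c hc2 I h1 h).trans (le_max_left _ _)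
  · exact (b3 c hc3 I (by omega)).trans (le_max_right _ _)

/-- interior estimate for the difference of two solutions -/
theorem diff_bound (hn : n ≠ 0) {l L r : ℝ} (hl : 0 < l) (hL : 0 < L) (hr : 0 < r) :
    ∃ X : ℝ, 0 ≤ X ∧ ∀ (v v0 : Euc n → ℝ) (c : Euc n) (ε : ℝ),
    Reg v c r l L → Reg v0 c r l L → 
    (∀ x ∈ closedBall c r, |v x - v0 x| ≤ ε) →
    ∀ I : List (Fin n), 1 ≤ I.length → I.length ≤ 3 → |ddl I (fun z => v z - v0 z) c| ≤ X * ε := by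
  obtain ⟨K, hK, HK⟩ := interior_reg n hl hL hr
  obtain ⟨X, hX, H⟩ := diff_main hn hK hl hL (show 0 < r / 8 by positivity)
  refine ⟨X, hX, ?_⟩
  intro v v0 c ε hv hv0 hb I h1 h3
  have s1 : closedBall c (r / 8) ⊆ closedBall c r := closedBall_subset_closedBall (by linarith)
  have hε : 0 ≤ ε := (abs_nonneg _).trans (hb c (mem_closedBall_self hr.le))
  have key : ∀ t : ℝ, ε < t → |ddl I (fun z => v z - v0 z) c| ≤ X * t := by
    intro t ht
    have ht0 : 0 < t := by linarith
    have h4 := H v v0 c t⁻¹ (hv.sub s1) (hv0.sub s1) (by positivity) (fun x hx J hJ2 hJ5 => ⟨HK v c hv x hx J hJ2 hJ5, HK v0 c hv0 x hx J hJ2 hJ5⟩)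
      (fun x hx => by
        rw [abs_mul, abs_of_pos (by positivity), inv_mul_le_iff₀ ht0, mul_one]
        exact (hb x (s1 hx)).trans ht.le) I h1 h3
    rw [ddl_cmul, abs_mul, abs_of_pos (by positivity), inv_mul_le_iff₀ ht0] at h4
    linarith
  refine le_of_forall_pos_le_add fun η hη => ?_
  have := key (ε + η / (X + 1)) (by have : 0 < η / (X + 1) := by positivity
                                    linarith)
  refine this.trans ?_
  have : X * (η / (X + 1)) ≤ η := by
    rw [mul_div_assoc', div_le_iff₀ (by positivity)]; nlinarith
  linarith

end MA
end

section
namespace MA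
open Filter Topology Matrix Metric

variable {n : ℕ}

theorem taylor1 {f f' f'' : ℝ → ℝ} {M : ℝ} (h1 : ∀ t ∈ Set.Icc (0:ℝ) 1, HasDerivAt f (f' t) t)
    (h2 : ∀ t ∈ Set.Icc (0:ℝ) 1, HasDerivAt f' (f'' t) t) (h3 : ∀ t ∈ Set.Icc (0:ℝ) 1, f'' t ≤ M) :
    f 1 ≤ f 0 + f' 0 + M / 2 := by
  have m0 : (0:ℝ) ∈ Set.Icc (0:ℝ) 1 := ⟨le_rfl, zero_le_one⟩
  have m1 : (1:ℝ) ∈ Set.Icc (0:ℝ) 1 := ⟨zero_le_one, le_rfl⟩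
  have a1 : AntitoneOn (fun t => f' t - M * t) (Set.Icc 0 1) := by
    have hd : ∀ t ∈ Set.Icc (0:ℝ) 1, HasDerivAt (fun t => f' t - M * t) (f'' t - M) t := fun t ht => by
      have := (h2 t ht).sub ((hasDerivAt_id t).const_mul M)
      refine this.congr_deriv ?_
      simp
    refine antitoneOn_of_deriv_nonpos (convex_Icc 0 1) (fun t ht => (hd t ht).continuousAt.continuousWithinAt)
      (fun t ht => (hd t (interior_subset ht)).differentiableAt.differentiableWithinAt) fun t ht => ?_
    rw [(hd t (interior_subset ht)).deriv]
    linarith [h3 t (interior_subset ht)]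
  have a2 : AntitoneOn (fun t => f t - f' 0 * t - M / 2 * t ^ 2) (Set.Icc 0 1) := by
    have hd : ∀ t ∈ Set.Icc (0:ℝ) 1, HasDerivAt (fun t => f t - f' 0 * t - M / 2 * t ^ 2) (f' t - f' 0 - M * t) t := fun t ht => by
      have := ((h1 t ht).sub ((hasDerivAt_id t).const_mul (f' 0))).sub ((hasDerivAt_pow 2 t).const_mul (M / 2))
      refine this.congr_deriv ?_
      simp; ring
    refine antitoneOn_of_deriv_nonpos (convex_Icc 0 1) (fun t ht => (hd t ht).continuousAt.continuousWithinAt)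
      (fun t ht => (hd t (interior_subset ht)).differentiableAt.differentiableWithinAt) fun t ht => ?_
    rw [(hd t (interior_subset ht)).deriv]
    have := a1 m0 (interior_subset ht) (interior_subset ht).1
    simp only [mul_zero, sub_zero] at this
    linarith
  have := a2 m0 m1 zero_le_one
  simp at this
  linarith

theorem taylor_up {f : Euc n → ℝ} {ρ M : ℝ} (hs : ∀ y ∈ closedBall (0 : Euc n) ρ, Sm f y)
    (hM : ∀ y ∈ closedBall (0 : Euc n) ρ, ∀ z, qf (hessianMatrix f y) z z ≤ M * ‖z‖ ^ 2) {y : Euc n} (hy : y ∈ closedBall (0 : Euc n) ρ) :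
    f y ≤ f 0 + dd y f 0 + M / 2 * ‖y‖ ^ 2 := by
  have hm : ∀ t ∈ Set.Icc (0:ℝ) 1, (0 : Euc n) + t • y ∈ closedBall (0 : Euc n) ρ := fun t ht => by
    rw [mem_closedBall_zero_iff] at *
    rw [zero_add, norm_smul, Real.norm_of_nonneg ht.1]
    exact (mul_le_of_le_one_left (norm_nonneg _) ht.2).trans hy
  have := taylor1 (f := fun t => f (0 + t • y)) (f' := fun t => dd y f (0 + t • y)) (f'' := fun t => dd y (dd y f) (0 + t • y)) (M := M * ‖y‖ ^ 2)
    (fun t ht => line_hasDerivAt (hs _ (hm t ht)).diff) (fun t ht => line_hasDerivAt ((hs _ (hm t ht)).dd y).diff)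
    (fun t ht => by rw [dd_qf (hs _ (hm t ht)).two]; exact hM _ (hm t ht) y)
  simp only [zero_smul, one_smul, zero_add] at this
  linarith

theorem taylor_low {f : Euc n → ℝ} {ρ M : ℝ} (hs : ∀ y ∈ closedBall (0 : Euc n) ρ, Sm f y)
    (hM : ∀ y ∈ closedBall (0 : Euc n) ρ, ∀ z, M * ‖z‖ ^ 2 ≤ qf (hessianMatrix f y) z z) {y : Euc n} (hy : y ∈ closedBall (0 : Euc n) ρ) :
    f 0 + dd y f 0 + M / 2 * ‖y‖ ^ 2 ≤ f y := by
  have := taylor_up (f := fun y => (-1) * f y) (M := -M) (fun y hy => (hs y hy).cmul (-1)) (fun y hy z => by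
    rw [hess_const_mul _ (hs y hy).two, qf_smul_mat]
    linarith [hM y hy z]) hy
  rw [dd_cmul] at this
  linarith

theorem ddl_add_const (f : Euc n → ℝ) (c : ℝ) {I : List (Fin n)} (hI : 1 ≤ I.length) : ddl I (fun z => f z - c) = ddl I f := by
  rcases List.eq_nil_or_concat I with rfl | ⟨l', i, rfl⟩
  · simp at hI
  · rw [List.concat_eq_append, ddl_snoc, ddl_snoc]
    congr 1
    ext y
    simp only [dd]
    rw [fderiv_sub_const]

theorem Reg.mono {w : Euc n → ℝ} {c : Euc n} {r l L l' L' : ℝ} (h : Reg w c r l L) (h1 : l' ≤ l) (h2 : L ≤ L') : Reg w c r l' L' :=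
  ⟨h.sm, h.det, fun y hy z => (mul_le_mul_of_nonneg_right h1 (sq_nonneg _)).trans (h.low y hy z),
    fun y hy z => (h.up y hy z).trans (mul_le_mul_of_nonneg_right h2 (sq_nonneg _))⟩

theorem Sol.reg {Ω : Set (Euc n)} {ξ c : Euc n} {v : Euc n → ℝ} {r Λ : ℝ} (S : Sol Ω ξ v) (hΛ : 1 ≤ Λ)
    (hP : ∀ x ∈ Ω, v x ≤ -(1 / 8) → ∀ z, qf (hessianMatrix v x) z z ≤ Λ * ‖z‖ ^ 2)
    (hs : closedBall c r ⊆ Ω) (hv : ∀ y ∈ closedBall c r, v y ≤ -(1 / 8)) : Reg v c r (Λ ^ n)⁻¹ Λ :=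
  ⟨fun y hy => S.sm y (hs hy), fun y hy => S.det y (hs hy),
    fun y hy z => eig_lower (S.pd (hs hy)) (S.det y (hs hy)) hΛ (hP y (hs hy) (hv y hy)) z,
    fun y hy z => hP y (hs hy) (hv y hy) z⟩

theorem scaled_core (hn : 2 ≤ n) : ∃ X : ℝ, 0 ≤ X ∧ ∀ (D : Set (Euc n)) (U v0 v : Euc n → ℝ) (η : ℝ), IsOpen D →
    closedBall 0 3 ⊆ D → ConvexOn ℝ D U → ContinuousOn U D → U 0 = 0 → (∀ y ∈ D, 0 ≤ U y) → η ≤ 1 / 100 →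
    (∀ y ∈ closedBall (0 : Euc n) 3, Sm v0 y) → (∀ y ∈ closedBall (0 : Euc n) 3, hessDet v0 y = 1) →
    (∀ y ∈ closedBall (0 : Euc n) 3, ∀ z, 99 / 100 * ‖z‖ ^ 2 ≤ qf (hessianMatrix v0 y) z z) →
    (∀ y ∈ closedBall (0 : Euc n) 3, ∀ z, qf (hessianMatrix v0 y) z z ≤ 101 / 100 * ‖z‖ ^ 2) →
    (∀ y ∈ closedBall (0 : Euc n) 3, |U y - (v0 y - v0 0)| ≤ η) →
    ∀ Ω : Set (Euc n), Ω = {y | y ∈ D ∧ U y < 1} →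
    ConvexOn ℝ Ω v → (∀ y ∈ Ω, Sm v y) → ContinuousOn v (closure Ω) → (∀ y ∈ Ω, hessDet v y = 1) → (∀ y ∈ frontier Ω, v y = 0) →
    ∀ y ∈ closedBall (0 : Euc n) (1 / 4), y ∈ Ω ∧ ∀ I : List (Fin n), 1 ≤ I.length → I.length ≤ 3 → |ddl I (fun z => v z - v0 z) y| ≤ X * η := by
  have hn0 : n ≠ 0 := by omega
  obtain ⟨Λ, hΛ, HP⟩ := pogorelov (n := n) hn0
  have hΛ0 : 0 < Λ := by linarith
  set l := min (Λ ^ n)⁻¹ (99 / 100) with hl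
  have hl0 : 0 < l := lt_min (by positivity) (by norm_num)
  set L := max Λ (101 / 100) with hL
  have hL0 : 0 < L := lt_of_lt_of_le hΛ0 (le_max_left _ _)
  obtain ⟨X, hX, HX⟩ := diff_bound hn0 hl0 hL0 (show (0:ℝ) < 1 / 4 by norm_num)
  refine ⟨X, hX, ?_⟩
  intro D U v0 v η hDo hD hUc hUcont hU0 hUn hη hs0 hd0 hlow hup hUv Ω hΩ hvc hvs hvcont hvd hvb
  have hm0 : (0 : Euc n) ∈ closedBall (0 : Euc n) 3 := mem_closedBall_self (by norm_num)
  have hη0 : 0 ≤ η := (abs_nonneg _).trans (hUv 0 hm0)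
  have tu := fun y hy => taylor_up hs0 hup (y := y) hy
  have tl := fun y hy => taylor_low hs0 hlow (y := y) hy
  have hp1 : ∀ e : Euc n, ‖e‖ = 1 → dd e v0 0 ≤ 1 / 5 := by
    intro e he
    have hy : (-(1 / 10 : ℝ)) • e ∈ closedBall (0 : Euc n) 3 := by
      rw [mem_closedBall_zero_iff, norm_smul, he]; norm_num
    have h1 := tu _ hy
    have h2 := hUn _ (hD hy)
    have h3 := (abs_le.1 (hUv _ hy)).2
    have e1 : ‖(-(1 / 10 : ℝ))‖ = 1 / 10 := by rw [norm_neg]; norm_num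
    rw [dd_vsmul, norm_smul, he, e1] at h1
    have e2 : (101 / 100 / 2 * (1 / 10 * 1) ^ 2 : ℝ) ≤ 51 / 10000 := by norm_num
    linarith
  have hp : ∀ y : Euc n, |dd y v0 0| ≤ 1 / 5 * ‖y‖ := by
    have : ∀ y : Euc n, dd y v0 0 ≤ 1 / 5 * ‖y‖ := by
      intro y
      by_cases h : y = 0
      · subst h; rw [dd_zdir]; simp
      · have h0 : 0 < ‖y‖ := norm_pos_iff.2 h
        have h1 := hp1 (‖y‖⁻¹ • y) (by rw [norm_smul, norm_inv, norm_norm, inv_mul_cancel₀ h0.ne'])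
        rw [dd_vsmul, inv_mul_le_iff₀ h0] at h1
        linarith
    intro y
    rw [abs_le]
    refine ⟨?_, this y⟩
    have := this (-y)
    rw [show -y = (-1 : ℝ) • y by simp, dd_vsmul, norm_smul] at this
    norm_num at this
    linarith
  have hΩo : IsOpen Ω := by
    have := hUcont.isOpen_inter_preimage hDo (isOpen_Iio (a := (1:ℝ)))
    rw [hΩ]; exact this
  have hΩc : Convex ℝ Ω := by rw [hΩ]; exact hUc.convex_lt 1
  have h1Ω : ball (0 : Euc n) 1 ⊆ Ω := by
    intro y hy
    rw [mem_ball_zero_iff] at hy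
    have hy3 : y ∈ closedBall (0 : Euc n) 3 := by rw [mem_closedBall_zero_iff]; linarith
    rw [hΩ]
    refine ⟨hD hy3, ?_⟩
    have h1 := tu y hy3
    have h2 := (abs_le.1 (hUv y hy3)).2
    have h3 := (abs_le.1 (hp y)).2
    have h4 : ‖y‖ ^ 2 ≤ 1 := by have := norm_nonneg y; nlinarith
    linarith
  have h2Ω : Ω ⊆ ball (0 : Euc n) 2 := by
    intro y hy
    rw [hΩ] at hy
    rw [mem_ball_zero_iff]
    by_contra hge
    push Not at hge
    have h0 : 0 < ‖y‖ := by linarith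
    set t := 2 / ‖y‖ with ht
    have ht0 : 0 ≤ t := by positivity
    have ht1 : t ≤ 1 := (div_le_one h0).2 hge
    have hn2 : ‖t • y‖ = 2 := by rw [norm_smul, Real.norm_of_nonneg ht0, ht]; field_simp
    have hy3 : t • y ∈ closedBall (0 : Euc n) 3 := by rw [mem_closedBall_zero_iff, hn2]; norm_num
    have h1 := hUc.2 (hD hm0) hy.1 (show 0 ≤ 1 - t by linarith) ht0 (by ring)
    rw [smul_zero, zero_add, hU0, smul_eq_mul, smul_eq_mul, mul_zero, zero_add] at h1
    have h2 : t * U y ≤ 1 := mul_le_one₀ ht1 (hUn y hy.1) hy.2.le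
    have h3 := tl _ hy3
    have h4 := (abs_le.1 (hUv _ hy3)).1
    have h5 := (abs_le.1 (hp (t • y))).1
    rw [hn2] at h3 h5
    linarith
  have hclo : closure Ω ⊆ closedBall (0 : Euc n) 3 := by
    refine closure_minimal (h2Ω.trans (ball_subset_closedBall.trans (closedBall_subset_closedBall (by norm_num)))) isClosed_closedBall
  have hfr : ∀ y ∈ frontier Ω, U y = 1 := by
    intro y hy
    have hyc : y ∈ closure Ω := frontier_subset_closure hy
    have hyD := hD (hclo hyc)
    refine le_antisymm ?_ ?_
    · have hc := (hUcont y hyD).mono (show Ω ⊆ D by rw [hΩ]; exact fun z hz => hz.1)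
      have := mem_closure_iff_nhdsWithin_neBot.1 hyc
      refine le_of_tendsto hc (eventually_nhdsWithin_of_forall fun z hz => ?_)
      rw [hΩ] at hz; exact hz.2.le
    · by_contra hlt
      push Not at hlt
      have : y ∈ Ω := by rw [hΩ]; exact ⟨hyD, hlt⟩
      rw [hΩo.frontier_eq] at hy
      exact hy.2 this
  have S : Sol Ω 0 v := ⟨hΩo, hΩc, h1Ω, h2Ω.trans (ball_subset_ball (by exact_mod_cast hn)), hvc, hvs, hvcont, hvd, hvb⟩
  have hΩb : Bornology.IsBounded Ω := isBounded_ball.subset h2Ω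
  have hΩ3 : Ω ⊆ closedBall (0 : Euc n) 3 := subset_closure.trans hclo
  have hpd0 : ∀ y ∈ closedBall (0 : Euc n) 3, (hessianMatrix v0 y).PosDef := fun y hy =>
    pd_of_low (hs0 y hy).two (hd0 y hy) (by norm_num) (hlow y hy)
  have hcont0 : ContinuousOn v0 (closure Ω) := fun y hy => (hs0 y (hclo hy)).diff.continuousAt.continuousWithinAt
  have c1 := comparison hn0 hΩo hΩb (a := v) (b := fun y => v0 y - (v0 0 + 1 - η)) hvcont (hcont0.sub continuousOn_const)
    (fun y hy => (hvs y hy).two) (fun y hy => (hs0 y (hΩ3 hy)).two.sub contDiffAt_const) (fun y hy => (S.pd hy).posSemidef)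
    (fun y hy => by rw [hess_sub_const _ (hs0 y (hΩ3 hy)).two]; exact hpd0 y (hΩ3 hy))
    (fun y hy => by
      rw [hvd y hy, hessDet, hess_sub_const _ (hs0 y (hΩ3 hy)).two]
      exact (hd0 y (hΩ3 hy)).le)
    (fun y hy => by
      have := (abs_le.1 (hUv y (hclo (frontier_subset_closure hy)))).2
      rw [hvb y hy]
      rw [hfr y hy] at this
      linarith)
  have c2 := comparison hn0 hΩo hΩb (b := v) (a := fun y => v0 y - (v0 0 + 1 + η)) (hcont0.sub continuousOn_const) hvcont
    (fun y hy => (hs0 y (hΩ3 hy)).two.sub contDiffAt_const) (fun y hy => (hvs y hy).two)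
    (fun y hy => by rw [hess_sub_const _ (hs0 y (hΩ3 hy)).two]; exact (hpd0 y (hΩ3 hy)).posSemidef)
    (fun y hy => S.pd hy)
    (fun y hy => by
      rw [hvd y hy, hessDet, hess_sub_const _ (hs0 y (hΩ3 hy)).two]
      exact (hd0 y (hΩ3 hy)).ge)
    (fun y hy => by
      have := (abs_le.1 (hUv y (hclo (frontier_subset_closure hy)))).1
      rw [hvb y hy]
      rw [hfr y hy] at this
      linarith)
  intro y hy
  rw [mem_closedBall_zero_iff] at hy
  have hyΩ : y ∈ Ω := h1Ω (by rw [mem_ball_zero_iff]; linarith)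
  refine ⟨hyΩ, fun I hI1 hI3 => ?_⟩
  have hsub : ∀ x ∈ closedBall y (1 / 4), ‖x‖ ≤ 1 / 2 := fun x hx => by
    rw [mem_closedBall, dist_eq_norm] at hx
    have := norm_add_le (x - y) y
    rw [sub_add_cancel] at this
    linarith
  have hsΩ : closedBall y (1 / 4) ⊆ Ω := fun x hx => h1Ω (by rw [mem_ball_zero_iff]; linarith [hsub x hx])
  have R1 : Reg v y (1 / 4) l L := (S.reg hΛ (HP Ω 0 v S) hsΩ (fun x hx => by
    have h1 := S.upper hn0 x (subset_closure (hsΩ hx))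
    have h2 := hsub x hx
    have h3 := norm_nonneg x
    rw [sub_zero] at h1
    nlinarith)).mono (min_le_left _ _) (le_max_left _ _)
  have R2 : Reg (fun z => v0 z - (v0 0 + 1)) y (1 / 4) l L := by
    have h3 : ∀ x ∈ closedBall y (1 / 4), x ∈ closedBall (0 : Euc n) 3 := fun x hx => hΩ3 (hsΩ hx)
    refine Reg.mono (l := 99 / 100) (L := 101 / 100) ⟨fun x hx => (hs0 x (h3 x hx)).sub (sm_const _ x), fun x hx => ?_, fun x hx => ?_, fun x hx => ?_⟩ (min_le_right _ _) (le_max_right _ _)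
    · rw [hessDet, hess_sub_const _ (hs0 x (h3 x hx)).two]; exact hd0 x (h3 x hx)
    · rw [hess_sub_const _ (hs0 x (h3 x hx)).two]; exact hlow x (h3 x hx)
    · rw [hess_sub_const _ (hs0 x (h3 x hx)).two]; exact hup x (h3 x hx)
  have := HX v _ y η R1 R2 (fun x hx => by
    have h1 := c1 x (subset_closure (hsΩ hx))
    have h2 := c2 x (subset_closure (hsΩ hx))
    rw [abs_le]
    constructor <;> linarith) I hI1 hI3
  have e : (fun z => v z - (v0 z - (v0 0 + 1))) = fun z => (v z - v0 z) - (-(v0 0 + 1)) := by ext z; ring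
  rw [e, ddl_add_const _ _ hI1] at this
  exact this

end MA
end

section
namespace MA
open Filter Topology Matrix Metric

variable {n : ℕ}

def sc (h : ℝ) (P : Euc n →L[ℝ] Euc n) (f : Euc n → ℝ) : Euc n → ℝ := fun y => h⁻¹ * f (P y)

theorem dd_sc {h : ℝ} {P : Euc n →L[ℝ] Euc n} {f : Euc n → ℝ} {y : Euc n} (hf : DifferentiableAt ℝ f (P y)) (z : Euc n) :
    dd z (sc h P f) y = h⁻¹ * dd (P z) f (P y) := by
  unfold sc
  rw [dd_cmul]
  simp only [dd]
  have h1 : HasFDerivAt (fun y => f (P y)) ((fderiv ℝ f (P y)).comp P) y :=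
    hf.hasFDerivAt.comp y P.hasFDerivAt
  rw [h1.fderiv]; rfl

theorem sm_sc {h : ℝ} {P : Euc n →L[ℝ] Euc n} {f : Euc n → ℝ} {y : Euc n} (hf : Sm f (P y)) : Sm (sc h P f) y := by
  have h1 := (P.continuous.continuousAt (x := y)).eventually hf
  exact h1.mono fun x hx => contDiffAt_const.mul (hx.comp x P.contDiff.contDiffAt)

theorem c2_sc {h : ℝ} {P : Euc n →L[ℝ] Euc n} {f : Euc n → ℝ} {y : Euc n} (hf : ContDiffAt ℝ 2 f (P y)) : ContDiffAt ℝ 2 (sc h P f) y :=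
  contDiffAt_const.mul (hf.comp y P.contDiff.contDiffAt)

theorem qf_sc {h : ℝ} {P : Euc n →L[ℝ] Euc n} {f : Euc n → ℝ} {y : Euc n} (hf : ContDiffAt ℝ 2 f (P y)) (z z' : Euc n) :
    qf (hessianMatrix (sc h P f) y) z z' = h⁻¹ * qf (hessianMatrix f (P y)) (P z) (P z') := by
  rw [← dd_qf (c2_sc hf), ← dd_qf hf]
  have h1 : dd z' (sc h P f) =ᶠ[𝓝 y] sc h P (dd (P z') f) := by
    filter_upwards [(P.continuous.continuousAt (x := y)).eventually (c2_ev hf)] with x hx using dd_sc hx z'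
  rw [dd_congr_at h1, dd_sc ((c2_dd hf (P z')).differentiableAt (by norm_num))]

theorem hess_sc {h : ℝ} {P : Euc n →L[ℝ] Euc n} {f : Euc n → ℝ} {y : Euc n} (hf : ContDiffAt ℝ 2 f (P y)) :
    hessianMatrix (sc h P f) y = h⁻¹ • (fm (fun k => P (bas k)) * hessianMatrix f (P y) * (fm (fun k => P (bas k)))ᵀ) := by
  ext i j
  rw [← qf_bas (hessianMatrix (sc h P f) y), qf_sc hf, Matrix.smul_apply, fm_apply, smul_eq_mul]

theorem hessDet_sc {h : ℝ} {P : Euc n →L[ℝ] Euc n} {f : Euc n → ℝ} {y : Euc n} (hf : ContDiffAt ℝ 2 f (P y)) (hh : 0 < h)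
    (hd : (fm (fun k => P (bas k))).det ^ 2 = h ^ n) : hessDet (sc h P f) y = hessDet f (P y) := by
  rw [hessDet, hessDet, hess_sc hf, Matrix.det_smul, Matrix.det_mul, Matrix.det_mul, Matrix.det_transpose, Fintype.card_fin]
  have : (h⁻¹) ^ n * h ^ n = 1 := by rw [← mul_pow, inv_mul_cancel₀ hh.ne', one_pow]
  linear_combination (hessianMatrix f (P y)).det * this + (h⁻¹) ^ n * (hessianMatrix f (P y)).det * hd

theorem trans_exists {R G : Mat n} (hn : n ≠ 0) (hR : R.PosSemidef) (hRR : R * R = G) (hG : G.det = 1) {h : ℝ} (hh : 0 < h) :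
    ∃ P : Euc n ≃L[ℝ] Euc n, (∀ f, affFT ((h ^ (-(1 : ℝ) / 2)) • R) f = sc h (P : Euc n →L[ℝ] Euc n) f) ∧
      (∀ z z', qf G (P z) (P z') = h * ⟪z, z'⟫) ∧ (fm (fun k => (P : Euc n →L[ℝ] Euc n) (bas k))).det ^ 2 = h ^ n := by
  have hRd : R.det = 1 := by
    have h1 := congrArg Matrix.det hRR
    rw [Matrix.det_mul, hG] at h1
    have h2 := hR.det_nonneg
    nlinarith
  have hRu : IsUnit R.det := by rw [hRd]; exact isUnit_one
  set c : ℝ := h ^ (-(1 : ℝ) / 2) with hc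
  have hc0 : 0 < c := Real.rpow_pos_of_pos hh _
  have hcc : c * c = h⁻¹ := by rw [hc, ← Real.rpow_add hh, ← Real.rpow_neg_one]; norm_num
  set A : Mat n := c • R with hA
  have hAd : A.det = c ^ n := by rw [hA, Matrix.det_smul, hRd, Fintype.card_fin, mul_one]
  have hAu : IsUnit A.det := by rw [hAd]; exact isUnit_iff_ne_zero.2 (by positivity)
  have hAp : A.det ^ ((2 : ℝ) / n) = h⁻¹ := by
    rw [hAd, ← Real.rpow_natCast, ← Real.rpow_mul hc0.le, mul_div_cancel₀ _ (by exact_mod_cast hn), ← hcc, Real.rpow_two, sq]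
  have e1 : ∀ x : Euc n, Matrix.toEuclideanCLM (𝕜 := ℝ) A (Matrix.toEuclideanCLM (𝕜 := ℝ) A⁻¹ x) = x := fun x => by
    have : Matrix.toEuclideanCLM (𝕜 := ℝ) A * Matrix.toEuclideanCLM (𝕜 := ℝ) A⁻¹ = 1 := by
      rw [← map_mul, Matrix.mul_nonsing_inv _ hAu, map_one]
    exact congrArg (fun T : Euc n →L[ℝ] Euc n => T x) this
  have e2 : ∀ x : Euc n, Matrix.toEuclideanCLM (𝕜 := ℝ) A⁻¹ (Matrix.toEuclideanCLM (𝕜 := ℝ) A x) = x := fun x => by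
    have : Matrix.toEuclideanCLM (𝕜 := ℝ) A⁻¹ * Matrix.toEuclideanCLM (𝕜 := ℝ) A = 1 := by
      rw [← map_mul, Matrix.nonsing_inv_mul _ hAu, map_one]
    exact congrArg (fun T : Euc n →L[ℝ] Euc n => T x) this
  let P : Euc n ≃L[ℝ] Euc n := ContinuousLinearEquiv.equivOfInverse (Matrix.toEuclideanCLM (𝕜 := ℝ) A⁻¹) (Matrix.toEuclideanCLM (𝕜 := ℝ) A) e1 e2
  have hP : ∀ x, P x = Matrix.toEuclideanCLM (𝕜 := ℝ) A⁻¹ x := fun x => rfl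
  have hq : ∀ z z', qf G (P z) (P z') = h * ⟪z, z'⟫ := by
    intro z z'
    have q1 : ∀ x x' : Euc n, qf G x x' = h * ⟪Matrix.toEuclideanCLM (𝕜 := ℝ) A x, Matrix.toEuclideanCLM (𝕜 := ℝ) A x'⟫ := by
      intro x x'
      have hGA : G = h • (Aᵀ * A) := by
        rw [hA, Matrix.transpose_smul, Matrix.smul_mul, Matrix.mul_smul, PSD_sym hR, hRR, smul_smul, smul_smul, mul_assoc, hcc, mul_inv_cancel₀ hh.ne', one_smul]
      rw [hGA, qf_smul_mat, qf_eq, ← Matrix.mulVec_mulVec, Matrix.dotProduct_mulVec, Matrix.vecMul_transpose]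
      congr 1
      rw [PiLp.inner_apply]
      simp [dotProduct, mul_comm]
    rw [q1, hP, hP, e1, e1]
  refine ⟨P, fun f => ?_, hq, ?_⟩
  · ext y
    rw [affFT, hAp]; rfl
  · have h1 : fm (fun k => (P : Euc n →L[ℝ] Euc n) (bas k)) * G * (fm (fun k => (P : Euc n →L[ℝ] Euc n) (bas k)))ᵀ = h • (1 : Mat n) := by
      ext i j
      rw [fm_apply, Matrix.smul_apply]
      refine (hq _ _).trans ?_
      rw [← qf_one, qf_bas, smul_eq_mul]
    have h2 := congrArg Matrix.det h1
    rw [Matrix.det_mul, Matrix.det_mul, Matrix.det_transpose, hG, Matrix.det_smul, Matrix.det_one, Fintype.card_fin] at h2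
    linarith

theorem abs_coord_le (z : Euc n) (i : Fin n) : |z i| ≤ ‖z‖ := by
  simpa using PiLp.norm_apply_le z i

theorem third_norm {φ : Euc n → ℝ} {y : Euc n} (hs : Sm φ y) {B : ℝ} (hB : ∀ I : List (Fin n), I.length = 3 → |ddl I φ y| ≤ B) (hB0 : 0 ≤ B) :
    ‖iteratedFDeriv ℝ 3 φ y‖ ≤ n ^ 3 * B := by
  refine ContinuousMultilinearMap.opNorm_le_bound (by positivity) fun m => ?_
  have e : iteratedFDeriv ℝ 3 φ y m = fderiv ℝ (fderiv ℝ (fderiv ℝ φ)) y (m 0) (m 1) (m 2) := by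
    rw [iteratedFDeriv_succ_apply_right, iteratedFDeriv_two_apply]; rfl
  have e2 : iteratedFDeriv ℝ 3 φ y m = ∑ i, ∑ j, ∑ k, m 0 i * (m 1 j * (m 2 k * ddl [i, j, k] φ y)) := by
    rw [e]
    have f1 : ∀ a b : Euc n, fderiv ℝ (fderiv ℝ (fderiv ℝ φ)) y (m 0) a b = ∑ i, m 0 i * fderiv ℝ (fderiv ℝ (fderiv ℝ φ)) y (bas i) a b := fun a b => by
      conv_lhs => rw [bas_expand (m 0)]
      simp only [map_sum, map_smul, _root_.sum_apply, _root_.smul_apply, smul_eq_mul]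
    have f2 : ∀ a b : Euc n, fderiv ℝ (fderiv ℝ (fderiv ℝ φ)) y a (m 1) b = ∑ i, m 1 i * fderiv ℝ (fderiv ℝ (fderiv ℝ φ)) y a (bas i) b := fun a b => by
      conv_lhs => rw [bas_expand (m 1)]
      simp only [map_sum, map_smul, _root_.sum_apply, _root_.smul_apply, smul_eq_mul]
    have f3 : ∀ a b : Euc n, fderiv ℝ (fderiv ℝ (fderiv ℝ φ)) y a b (m 2) = ∑ i, m 2 i * fderiv ℝ (fderiv ℝ (fderiv ℝ φ)) y a b (bas i) := fun a b => by
      conv_lhs => rw [bas_expand (m 2)]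
      simp only [map_sum, map_smul, smul_eq_mul]
    rw [f1]
    refine Finset.sum_congr rfl fun i _ => ?_
    rw [f2, Finset.mul_sum]
    refine Finset.sum_congr rfl fun j _ => ?_
    rw [f3, Finset.mul_sum, Finset.mul_sum]
    refine Finset.sum_congr rfl fun k _ => ?_
    rw [← dd3_eq hs]; rfl
  rw [e2, Fin.prod_univ_three, Real.norm_eq_abs]
  set N := ‖m 0‖ * ‖m 1‖ * ‖m 2‖ with hN
  have key : ∀ i j k, |m 0 i * (m 1 j * (m 2 k * ddl [i, j, k] φ y))| ≤ B * N := by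
    intro i j k
    rw [abs_mul, abs_mul, abs_mul]
    have := mul_le_mul (abs_coord_le (m 0) i) (mul_le_mul (abs_coord_le (m 1) j) (mul_le_mul (abs_coord_le (m 2) k) (hB [i, j, k] rfl)
      (abs_nonneg _) (norm_nonneg _)) (by positivity) (norm_nonneg _)) (by positivity) (norm_nonneg _)
    refine this.trans (le_of_eq ?_)
    rw [hN]; ring
  refine (Finset.abs_sum_le_sum_abs _ _).trans ((Finset.sum_le_sum (g := fun _ => n * (n * (B * N))) fun i _ => ?_).trans (by simp; apply le_of_eq; ring))
  refine (Finset.abs_sum_le_sum_abs _ _).trans ((Finset.sum_le_sum (g := fun _ => n * (B * N)) fun j _ => ?_).trans (by simp))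
  refine (Finset.abs_sum_le_sum_abs _ _).trans ((Finset.sum_le_sum (g := fun _ => B * N) fun k _ => key i j k).trans (by simp))

theorem matOpNorm_le {M : Mat n} {B : ℝ} (hB : ∀ i j, |M i j| ≤ B) (hB0 : 0 ≤ B) : matOpNorm M ≤ n ^ 2 * B := by
  refine ContinuousLinearMap.opNorm_le_bound _ (by positivity) fun v => ?_
  have h1 : ∀ i, |(Matrix.toEuclideanCLM (𝕜 := ℝ) M v : Euc n) i| ≤ n * (B * ‖v‖) := by
    intro i
    have : (Matrix.toEuclideanCLM (𝕜 := ℝ) M v : Euc n) i = ∑ j, M i j * v j := by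
      simp [Matrix.mulVec, dotProduct]
    rw [this]
    refine (Finset.abs_sum_le_sum_abs _ _).trans ((Finset.sum_le_sum (g := fun _ => B * ‖v‖) fun j _ => ?_).trans (by simp))
    rw [abs_mul]
    exact mul_le_mul (hB i j) (abs_coord_le v j) (abs_nonneg _) hB0
  rw [bas_expand (Matrix.toEuclideanCLM (𝕜 := ℝ) M v : Euc n)]
  refine (norm_sum_le _ _).trans ((Finset.sum_le_sum (g := fun _ => n * (B * ‖v‖)) fun j _ => ?_).trans (by simp; apply le_of_eq; ring))
  rw [norm_smul, bas_norm, mul_one]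
  exact h1 j

end MA
end

section
namespace MA
open Filter Topology Matrix Metric

variable {n : ℕ}

theorem ray_frontier {S : Set (Euc n)} {ξ e : Euc n} {ρ : ℝ} (h1 : ball ξ 1 ⊆ S) (h2 : S ⊆ ball ξ ρ) (he : ‖e‖ = 1) :
    ∃ t : ℝ, 0 < t ∧ ξ + t • e ∈ frontier S := by
  have hξ : ξ ∈ interior S := mem_interior.2 ⟨ball ξ 1, h1, isOpen_ball, mem_ball_self one_pos⟩
  have hρ : 0 < ρ := by
    have := h2 (interior_subset hξ)
    rw [mem_ball, dist_self] at this; exact this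
  have hA : IsPreconnected ((fun t : ℝ => ξ + t • e) '' Set.Ici 0) :=
    isPreconnected_Ici.image _ (by fun_prop)
  obtain ⟨t, ht, hx⟩ : ∃ t : ℝ, 0 ≤ t ∧ ξ + t • e ∈ frontier S := by
    by_contra hno
    push Not at hno
    have hr : ξ + ρ • e ∉ S := fun hm => by
      have := h2 hm
      rw [mem_ball, dist_eq_norm, add_sub_cancel_left, norm_smul, he, Real.norm_of_nonneg hρ.le] at this
      linarith
    obtain ⟨x, -, hx1, hx2⟩ := hA (interior S) (closure S)ᶜ isOpen_interior isClosed_closure.isOpen_compl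
      (by
        rintro _ ⟨t, ht, rfl⟩
        by_cases hc : ξ + t • e ∈ closure S
        · left; by_contra hi; exact hno t ht ⟨hc, hi⟩
        · right; exact hc)
      ⟨ξ, ⟨0, Set.self_mem_Ici, by simp⟩, hξ⟩
      ⟨ξ + ρ • e, ⟨ρ, hρ.le, rfl⟩, fun hc => hno ρ hρ.le ⟨hc, fun hi => hr (interior_subset hi)⟩⟩
    exact hx2 (subset_closure (interior_subset hx1))
  refine ⟨t, lt_of_le_of_ne ht fun h0 => ?_, hx⟩
  subst h0
  simp only [zero_smul, add_zero] at hx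
  exact hx.2 hξ

theorem fderiv_diff_of_hessDet {u : Euc n → ℝ} {z : Euc n} (hn : n ≠ 0) (h : hessDet u z ≠ 0) : DifferentiableAt ℝ (fderiv ℝ u) z := by
  by_contra hd
  apply h
  have : hessianMatrix u z = 0 := by
    ext i j
    simp only [hessianMatrix, Matrix.of_apply, iteratedFDeriv_two_apply, fderiv_zero_of_not_differentiableAt hd]
    rfl
  rw [hessDet, this]
  have : Nonempty (Fin n) := ⟨⟨0, Nat.pos_of_ne_zero hn⟩⟩
  exact Matrix.det_zero

theorem section_open (hn : n ≠ 0) {u : Euc n → ℝ} {c ρ : ℝ} {ξ : Euc n} (hu : StrictConvexOn ℝ (closure {z | u z < c}) u)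
    (hc2 : ContDiffOn ℝ 2 u (closure {z | u z < c})) (h1 : ball ξ 1 ⊆ {z | u z < c}) (h2 : {z | u z < c} ⊆ ball ξ ρ)
    (hb : ∀ z ∈ frontier {z | u z < c}, u z = 0) (hd : ∀ z ∈ {z | u z < c}, hessDet u z ≠ 0) :
    c = 0 ∧ IsOpen {z | u z < c} := by
  set S : Set (Euc n) := {z | u z < c} with hS
  obtain ⟨e, he⟩ : ∃ e : Euc n, ‖e‖ = 1 := ⟨bas ⟨0, Nat.pos_of_ne_zero hn⟩, bas_norm _⟩
  obtain ⟨t1, ht1, hz1⟩ := ray_frontier h1 h2 he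
  obtain ⟨t2, ht2, hz2⟩ := ray_frontier h1 h2 (e := -e) (by rw [norm_neg, he])
  have hξ : ξ ∈ interior S := mem_interior.2 ⟨ball ξ 1, h1, isOpen_ball, mem_ball_self one_pos⟩
  have hcont := hc2.continuousOn
  set z := ξ + t1 • e with hz
  have hzc : z ∈ closure S := frontier_subset_closure hz1
  have hc0 : 0 ≤ c := by
    have := mem_closure_iff_nhdsWithin_neBot.1 hzc
    have h3 := (hcont z hzc).mono subset_closure
    have h4 : u z ≤ c := le_of_tendsto h3 (eventually_nhdsWithin_of_forall fun y hy => (show u y < c from hy).le)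
    rwa [hb z hz1] at h4
  have hcle : c ≤ 0 := by
    by_contra hpos
    push Not at hpos
    have hzS : z ∈ S := by show u z < c; rw [hb z hz1]; exact hpos
    have hfd := fderiv_diff_of_hessDet hn (hd z hzS)
    have hnd : ¬ DifferentiableAt ℝ u z := by
      intro hdu
      have h3 : ∀ᶠ y in 𝓝 z, u y < c := hdu.continuousAt.eventually (gt_mem_nhds hzS)
      exact hz1.2 (mem_interior_iff_mem_nhds.2 h3)
    have hf0 : fderiv ℝ u z = 0 := fderiv_zero_of_not_differentiableAt hnd
    have hpos2 : ∀ y ∈ interior S, 0 ≤ u y := by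
      intro y hy
      have hyc : y ∈ closure S := subset_closure (interior_subset hy)
      have hlim : Tendsto (fun t : ℝ => z + t • (y - z)) (𝓝[>] 0) (𝓝 z) := (line_tendsto z (y - z)).mono_left nhdsWithin_le_nhds
      have hin : ∀ᶠ t : ℝ in 𝓝[>] 0, z + t • (y - z) ∈ interior (closure S) := by
        have : ∀ᶠ t : ℝ in 𝓝[>] 0, t < 1 := (gt_mem_nhds one_pos).filter_mono nhdsWithin_le_nhds
        filter_upwards [this, self_mem_nhdsWithin] with t ht ht0
        exact hu.1.add_smul_sub_mem_interior hzc (interior_mono subset_closure hy) ⟨ht0, ht.le⟩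
      have l1 : Tendsto (fun t : ℝ => u (z + t • (y - z))) (𝓝[>] 0) (𝓝 (u z)) :=
        (hcont z hzc).tendsto.comp (tendsto_nhdsWithin_iff.2 ⟨hlim, hin.mono fun t ht => interior_subset ht⟩)
      have l2 : Tendsto (fun t : ℝ => fderiv ℝ u (z + t • (y - z)) (y - (z + t • (y - z)))) (𝓝[>] 0) (𝓝 (fderiv ℝ u z (y - z))) := by
        have a := hfd.continuousAt.tendsto.comp hlim
        have b : Tendsto (fun t : ℝ => y - (z + t • (y - z))) (𝓝[>] 0) (𝓝 (y - z)) := tendsto_const_nhds.sub hlim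
        exact (isBoundedBilinearMap_apply.continuous.tendsto (fderiv ℝ u z, y - z)).comp (a.prodMk_nhds b)
      have l3 := l1.add l2
      rw [hf0, _root_.zero_apply, add_zero, hb z hz1] at l3
      refine ge_of_tendsto' (b := (0:ℝ)) (f := fun _ : ℕ => u y) (x := atTop) tendsto_const_nhds fun _ => ?_
      refine le_of_tendsto l3 ?_
      filter_upwards [hin] with t ht
      exact convex_tangent hu.convexOn (interior_subset ht) hyc
        ((hc2.contDiffAt (mem_interior_iff_mem_nhds.1 ht)).differentiableAt (by norm_num))
    have hne : z ≠ ξ + t2 • (-e) := by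
      intro h
      have : (t1 + t2) • e = 0 := by
        rw [hz, add_right_inj] at h
        rw [add_smul, h]; simp
      have := congrArg norm this
      rw [norm_smul, he, norm_zero, Real.norm_of_nonneg (by positivity)] at this
      linarith
    have hs := hu.2 hzc (frontier_subset_closure hz2) hne (show 0 < t2 / (t1 + t2) by positivity) (show 0 < t1 / (t1 + t2) by positivity) (by field_simp; ring)
    have e1 : (t2 / (t1 + t2)) • z + (t1 / (t1 + t2)) • (ξ + t2 • (-e)) = ξ := by
      rw [hz, smul_add, smul_add, smul_smul, smul_smul, smul_neg]
      have e2 : t2 / (t1 + t2) * t1 = t1 / (t1 + t2) * t2 := by ring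
      have e3 : t2 / (t1 + t2) + t1 / (t1 + t2) = 1 := by field_simp; ring
      rw [e2]
      calc _ = (t2 / (t1 + t2) + t1 / (t1 + t2)) • ξ := by rw [add_smul]; abel
        _ = ξ := by rw [e3, one_smul]
    rw [e1, hb z hz1, hb _ hz2] at hs
    have := hpos2 ξ hξ
    simp at hs
    linarith
  have hc : c = 0 := le_antisymm hcle hc0
  refine ⟨hc, ?_⟩
  rw [← interior_eq_iff_isOpen]
  refine subset_antisymm interior_subset fun x hx => ?_
  by_contra hxi
  have : u x = 0 := hb x ⟨subset_closure hx, hxi⟩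
  have h3 : u x < c := hx
  rw [this, hc] at h3
  exact lt_irrefl _ h3

end MA
end

section
namespace MA
open Filter Topology Matrix Metric

variable {n : ℕ}

theorem uw_close (hn : n ≠ 0) {S : Set (Euc n)} {ξ : Euc n} {u w g : Euc n → ℝ} {δ : ℝ} (W : Sol S ξ w)
    (hcu : ConvexOn ℝ S u) (hu2 : ∀ x ∈ S, ContDiffAt ℝ 2 u x) (hucont : ContinuousOn u (closure S)) (hub : ∀ z ∈ frontier S, u z = 0)
    (hud : ∀ z ∈ S, hessDet u z = g z ^ n) (hg : ∀ z ∈ S, |g z - 1| ≤ δ) (hδ0 : 0 ≤ δ) (hδ : δ ≤ 1 / 20) :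
    ∀ x ∈ closure S, (1 + δ) * w x ≤ u x ∧ u x ≤ (1 - δ) * w x := by
  have hups : ∀ x ∈ S, (hessianMatrix u x).PosSemidef := fun x hx => convex_hess hcu (W.ho.mem_nhds hx) (hu2 x hx)
  have hgp : ∀ x ∈ S, 1 - δ ≤ g x ∧ g x ≤ 1 + δ := fun x hx => by
    have := abs_le.1 (hg x hx); constructor <;> linarith
  have hupd : ∀ x ∈ S, (hessianMatrix u x).PosDef := fun x hx => PD_of_PSD_det (hups x hx) (by
    have h1 : (hessianMatrix u x).det = g x ^ n := hud x hx
    rw [h1]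
    have := (hgp x hx).1
    exact pow_ne_zero _ (by linarith))
  have c1 := comparison hn W.ho W.bdd (a := fun x => (1 + δ) * w x) (b := u) (continuousOn_const.mul W.cont) hucont
    (fun x hx => contDiffAt_const.mul (W.sm x hx).two) hu2
    (fun x hx => by
      rw [hess_const_mul _ (W.sm x hx).two]
      exact (W.pd hx).posSemidef.smul (by linarith)) hupd
    (fun x hx => by
      rw [hessDet_const_mul _ (W.sm x hx).two, W.det x hx, hud x hx, mul_one]
      exact pow_le_pow_left₀ (by linarith [(hgp x hx).1]) (hgp x hx).2 _)
    (fun x hx => by rw [hub x hx, W.bd x hx, mul_zero])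
  have c2 := comparison hn W.ho W.bdd (b := fun x => (1 - δ) * w x) (a := u) hucont (continuousOn_const.mul W.cont)
    hu2 (fun x hx => contDiffAt_const.mul (W.sm x hx).two) hups
    (fun x hx => by
      rw [hess_const_mul _ (W.sm x hx).two]
      exact (W.pd hx).smul (by linarith))
    (fun x hx => by
      rw [hessDet_const_mul _ (W.sm x hx).two, W.det x hx, hud x hx, mul_one]
      exact pow_le_pow_left₀ (by linarith) (hgp x hx).1 _)
    (fun x hx => by rw [hub x hx, W.bd x hx, mul_zero])
  exact fun x hx => ⟨c1 x hx, c2 x hx⟩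

theorem qf_abs_le {M : Mat n} {B : ℝ} (hB : ∀ i j, |M i j| ≤ B) (hB0 : 0 ≤ B) (z : Euc n) : |qf M z z| ≤ n ^ 2 * B * ‖z‖ ^ 2 := by
  unfold qf
  refine (Finset.abs_sum_le_sum_abs _ _).trans ((Finset.sum_le_sum (g := fun _ => n * (B * ‖z‖ ^ 2)) fun i _ => ?_).trans (by simp; apply le_of_eq; ring))
  refine (Finset.abs_sum_le_sum_abs _ _).trans ((Finset.sum_le_sum (g := fun _ => B * ‖z‖ ^ 2) fun j _ => ?_).trans (by simp))
  rw [abs_mul, abs_mul]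
  have := mul_le_mul (mul_le_mul (abs_coord_le z i) (hB i j) (abs_nonneg _) (norm_nonneg _)) (abs_coord_le z j) (abs_nonneg _) (by positivity)
  refine this.trans (le_of_eq (by ring))

theorem hess_osc {w : Euc n → ℝ} {r K : ℝ} (hK0 : 0 ≤ K) (hs : ∀ x ∈ closedBall (0 : Euc n) r, Sm w x)
    (hK : ∀ x ∈ closedBall (0 : Euc n) r, ∀ I : List (Fin n), I.length = 3 → |ddl I w x| ≤ K) {x : Euc n} (hx : x ∈ closedBall (0 : Euc n) r) (z : Euc n) :
    |qf (hessianMatrix w x) z z - qf (hessianMatrix w 0) z z| ≤ n ^ 3 * K * ‖x‖ * ‖z‖ ^ 2 := by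
  have h0 : (0 : Euc n) ∈ closedBall (0 : Euc n) r := by
    rw [mem_closedBall_zero_iff] at *; rw [norm_zero]; exact (norm_nonneg _).trans hx
  rw [← qf_sub_mat]
  refine (qf_abs_le (B := n * K * ‖x‖) (fun i j => ?_) (by positivity) z).trans (le_of_eq (by ring))
  rw [Matrix.sub_apply, hess_apply (hs x hx).two, hess_apply (hs 0 h0).two]
  have := (convex_closedBall (0 : Euc n) r).norm_image_sub_le_of_norm_fderiv_le (𝕜 := ℝ) (f := dd (bas i) (dd (bas j) w)) (C := n * K)
    (fun y hy => (((hs y hy).dd _).dd _).diff) (fun y hy => by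
      refine ContinuousLinearMap.opNorm_le_bound _ (by positivity) fun v => ?_
      have e : fderiv ℝ (dd (bas i) (dd (bas j) w)) y v = ∑ k, v k * ddl [k, i, j] w y := by
        conv_lhs => rw [bas_expand v]
        exact dd_vsum _ _ _ _ _
      rw [e, Real.norm_eq_abs]
      refine (Finset.abs_sum_le_sum_abs _ _).trans ((Finset.sum_le_sum (g := fun _ => K * ‖v‖) fun k _ => ?_).trans (by simp; apply le_of_eq; ring))
      rw [abs_mul, mul_comm]
      exact mul_le_mul (hK y hy _ rfl) (abs_coord_le v k) (abs_nonneg _) hK0) h0 hx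
  rw [sub_zero, Real.norm_eq_abs] at this
  exact this

end MA
end

section
namespace MA
open Filter Topology Matrix Metric

variable {n : ℕ}

theorem sm_of_open {S : Set (Euc n)} (hS : IsOpen S) {w : Euc n → ℝ} (hw : ContDiffOn ℝ (⊤ : ℕ∞) w S) : ∀ x ∈ S, Sm w x := fun x hx => by
  filter_upwards [hS.mem_nhds hx] with y hy using hw.contDiffAt (hS.mem_nhds hy)

theorem assembly (hn : 2 ≤ n) :
    ∃ C₄ hc X : ℝ, 0 < C₄ ∧ C₄ ≤ 1 ∧ 0 < hc ∧ hc ≤ 1 / 5 ∧ 0 ≤ X ∧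
      ∀ (S : Set (Euc n)) (ξ : Euc n) (u g w : Euc n → ℝ) (δ L : ℝ), Sol S ξ w → S = {z : Euc n | u z < u 0 + L} → 0 < L → u 0 + L = 0 →
        ConvexOn ℝ S u → (∀ x ∈ S, ContDiffAt ℝ 2 u x) → ContinuousOn u (closure S) → (∀ z ∈ frontier S, u z = 0) →
        (∀ z ∈ S, hessDet u z = g z ^ n) → (∀ z ∈ S, |g z - 1| ≤ δ) → 0 ≤ δ → δ ≤ 1 / 20 → fderiv ℝ u 0 = 0 →
        ∀ h : ℝ, 0 < h → h ≤ hc → δ ≤ C₄ * h → ∀ R : Matrix (Fin n) (Fin n) ℝ, R.PosSemidef → R * R = hessianMatrix w 0 →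
        ∀ (ws : Euc n → ℝ) (Sh : Set (Euc n)), Sh = {z : Euc n | u z < u 0 + h} →
          ConvexOn ℝ Sh ws → ContDiffOn ℝ (⊤ : ℕ∞) ws Sh → ContinuousOn ws (closure Sh) →
          (∀ z ∈ Sh, hessDet ws z = 1) → (∀ z ∈ frontier Sh, ws z = 0) →
          hessianMatrix (affFT ((h ^ (-(1 : ℝ) / 2)) • R) w) 0 = 1 ∧
          ∀ y ∈ closedBall (0 : Euc n) (1 / 4), Sm (affFT ((h ^ (-(1 : ℝ) / 2)) • R) ws) y ∧ Sm (affFT ((h ^ (-(1 : ℝ) / 2)) • R) w) y ∧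
            ∀ I : List (Fin n), 1 ≤ I.length → I.length ≤ 3 →
            |ddl I (fun z => affFT ((h ^ (-(1 : ℝ) / 2)) • R) ws z - affFT ((h ^ (-(1 : ℝ) / 2)) • R) w z) y| ≤ X * (n ^ 2 * δ / h) := by
  have hn0 : n ≠ 0 := by omega
  have hnp : (0:ℝ) < n := by exact_mod_cast Nat.pos_of_ne_zero hn0
  obtain ⟨Λ, hΛ, HP⟩ := pogorelov (n := n) hn0
  have hΛ0 : 0 < Λ := by linarith
  obtain ⟨d, hd0, hd1, HD⟩ := exists_radius (n := n) hn0
  set l := (Λ ^ n)⁻¹ with hl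
  have hl0 : 0 < l := by positivity
  obtain ⟨K, hK1, HK⟩ := interior_reg n hl0 hΛ0 (show (0:ℝ) < d / 4 by positivity)
  have hK0 : 0 < K := by linarith
  obtain ⟨X, hX, HX⟩ := scaled_core hn
  set κ := min (d / 4 / 8) (l / (100 * n ^ 3 * K)) with hκ
  have hκ0 : 0 < κ := lt_min (by positivity) (by positivity)
  refine ⟨min 1 (1 / (100 * n ^ 2)), min (1 / 5) (l * κ ^ 2 / 9), X, lt_min one_pos (by positivity), min_le_left _ _,
    lt_min (by norm_num) (by positivity), min_le_left _ _, hX, ?_⟩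
  intro S ξ u g w δ L W hS hL hL0 hcu hu2 hucont hub hud hg hδ0 hδ hfu h hh0 hhc hδh R hR hRR ws Sh hSh hwsc hwss hwscont hwsd hwsb
  have hh5 : h ≤ 1 / 5 := hhc.trans (min_le_left _ _)
  have hhl : h ≤ l * κ ^ 2 / 9 := hhc.trans (min_le_right _ _)
  have hcomp := uw_close hn0 W hcu hu2 hucont hub hud hg hδ0 hδ
  have h0S : (0 : Euc n) ∈ S := by rw [hS]; show u 0 < u 0 + L; linarith
  have hξS : ξ ∈ S := W.h1 (mem_ball_self one_pos)
  have hd0u : DifferentiableAt ℝ u 0 := (hu2 0 h0S).differentiableAt (by norm_num)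
  have hmin : ∀ y ∈ S, u 0 ≤ u y := fun y hy => by
    have := convex_tangent hcu h0S hy hd0u
    rw [hfu] at this; simpa using this
  have hclose : ∀ x ∈ S, |u x - w x| ≤ δ * n ^ 2 / 2 := fun x hx => by
    have h1 := hcomp x (subset_closure hx)
    have h2 := W.nonpos x (subset_closure hx)
    have h3 := W.lower hn0 x (subset_closure hx)
    have h4 : -(n ^ 2 / 2 : ℝ) ≤ w x := by have := sq_nonneg ‖x - ξ‖; linarith
    have h5 := mul_le_mul_of_nonneg_left h4 hδ0
    rw [abs_le]; constructor <;> linarith [h1.1, h1.2]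
  have hwξ : w ξ ≤ -(1 / 2) := by
    have := W.upper hn0 ξ (subset_closure hξS)
    simpa using this
  have hu0 : u 0 ≤ -(19 / 40) := by
    have h1 := hmin ξ hξS
    have h2 := (hcomp ξ (subset_closure hξS)).2
    nlinarith
  have hw0 : w 0 ≤ -(9 / 20) := by
    have h1 := (hcomp 0 (subset_closure h0S)).1
    nlinarith
  have hball : ball (0 : Euc n) d ⊆ S := HD S ξ w W 0 h0S (by linarith)
  have hcb : closedBall (0 : Euc n) (d / 4) ⊆ S := (closedBall_subset_ball (by linarith)).trans hball
  have hReg : Reg w 0 (d / 4) l Λ := W.reg hΛ (HP S ξ w W) hcb fun y hy => by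
    have := W.half hball hw0 (y := y) (closedBall_subset_ball (by linarith) hy)
    linarith
  have hsub8 : closedBall (0 : Euc n) (d / 4 / 8) ⊆ closedBall (0 : Euc n) (d / 4) := closedBall_subset_closedBall (by linarith)
  have hosc := fun x hx z => hess_osc (w := w) (r := d / 4 / 8) hK0.le (fun y hy => hReg.sm y (hsub8 hy))
    (fun y hy I hI => HK w 0 hReg y hy I (by omega) (by omega)) (x := x) hx z
  obtain ⟨P, hPf, hPq, hPd⟩ := trans_exists hn0 hR hRR (show (hessianMatrix w 0).det = 1 from W.det 0 h0S) hh0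
  have hPn : ∀ z, l * ‖P z‖ ^ 2 ≤ h * ‖z‖ ^ 2 := fun z => by
    have h1 := hReg.low 0 (mem_closedBall_self (by positivity)) (P z)
    rw [hPq, real_inner_self_eq_norm_sq] at h1
    exact h1
  have hPκ : ∀ y ∈ closedBall (0 : Euc n) 3, ‖P y‖ ≤ κ := fun y hy => by
    rw [mem_closedBall_zero_iff] at hy
    have h1 := hPn y
    have h2 : ‖y‖ ^ 2 ≤ 9 := by have := norm_nonneg y; nlinarith
    have h3 : h * ‖y‖ ^ 2 ≤ h * 9 := mul_le_mul_of_nonneg_left h2 hh0.le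
    have h4 : l * ‖P y‖ ^ 2 ≤ l * κ ^ 2 := by linarith
    exact le_of_sq_le_sq (le_of_mul_le_mul_left h4 hl0) hκ0.le
  have hP8 : ∀ y ∈ closedBall (0 : Euc n) 3, P y ∈ closedBall (0 : Euc n) (d / 4 / 8) := fun y hy => by
    rw [mem_closedBall_zero_iff]; exact (hPκ y hy).trans (min_le_left _ _)
  have hPS : ∀ y ∈ closedBall (0 : Euc n) 3, P y ∈ S := fun y hy => hcb (hsub8 (hP8 y hy))
  have hP0 : P (0 : Euc n) = 0 := map_zero P
  -- Hessian of v0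
  have hq0 : ∀ y ∈ closedBall (0 : Euc n) 3, ∀ z, |qf (hessianMatrix (sc h (P : Euc n →L[ℝ] Euc n) w) y) z z - ‖z‖ ^ 2| ≤ 1 / 100 * ‖z‖ ^ 2 := by
    intro y hy z
    have h1 := hosc (P y) (hP8 y hy) (P z)
    rw [hPq, real_inner_self_eq_norm_sq] at h1
    rw [qf_sc (W.sm _ (hPS y hy)).two]
    have e : h⁻¹ * qf (hessianMatrix w ((P : Euc n →L[ℝ] Euc n) y)) ((P : Euc n →L[ℝ] Euc n) z) ((P : Euc n →L[ℝ] Euc n) z) - ‖z‖ ^ 2 =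
        h⁻¹ * (qf (hessianMatrix w (P y)) (P z) (P z) - h * ‖z‖ ^ 2) := by
      rw [mul_sub, inv_mul_cancel_left₀ hh0.ne']; rfl
    rw [e, abs_mul, abs_of_pos (inv_pos.2 hh0), inv_mul_le_iff₀ hh0]
    have h2 : (n : ℝ) ^ 3 * K * ‖P y‖ ≤ l / 100 := by
      have h3 := (hPκ y hy).trans (min_le_right _ _)
      rw [le_div_iff₀ (by positivity)] at h3
      linarith
    have h4 := mul_le_mul_of_nonneg_right h2 (sq_nonneg ‖P z‖)
    have h5 := hPn z
    linarith
  have hU : ∀ y, h⁻¹ * (u (P y) - u 0) < 1 ↔ u (P y) < u 0 + h := fun y => by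
    rw [inv_mul_lt_iff₀ hh0, mul_one]; constructor <;> intro <;> linarith
  have hShS : Sh ⊆ S := fun x hx => by
    rw [hSh] at hx; rw [hS]
    have hx' : u x < u 0 + h := hx
    show u x < u 0 + L
    linarith
  have hSho : IsOpen Sh := by
    have := (hucont.mono subset_closure).isOpen_inter_preimage W.ho (isOpen_Iio (a := u 0 + h))
    have e : Sh = S ∩ u ⁻¹' Set.Iio (u 0 + h) := by
      ext x
      refine ⟨fun hx => ⟨hShS hx, ?_⟩, fun hx => ?_⟩
      · rw [hSh] at hx; exact hx
      · rw [hSh]; exact hx.2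
    rw [e]; exact this
  have hη : (n : ℝ) ^ 2 * δ / h ≤ 1 / 100 := by
    have h1 := hδh.trans (mul_le_mul_of_nonneg_right (min_le_right _ _) hh0.le)
    rw [div_le_iff₀ hh0]
    have h2 := mul_le_mul_of_nonneg_left h1 (show (0:ℝ) ≤ n ^ 2 by positivity)
    refine h2.trans (le_of_eq ?_)
    field_simp
  have key := HX (P ⁻¹' S) (fun y => h⁻¹ * (u (P y) - u 0)) (sc h (P : Euc n →L[ℝ] Euc n) w) (sc h (P : Euc n →L[ℝ] Euc n) ws) (n ^ 2 * δ / h)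
    (W.ho.preimage P.continuous) hPS
    (by
      have h1 : ConvexOn ℝ (P ⁻¹' S) (fun y => u (P y)) := hcu.comp_linearMap (P : Euc n →ₗ[ℝ] Euc n)
      have h2 := (h1.add_const (-(u 0))).smul (inv_pos.2 hh0).le
      exact h2)
    (by
      have h1 : ContinuousOn (fun y => u (P y)) (P ⁻¹' S) := (hucont.mono subset_closure).comp P.continuous.continuousOn fun y hy => hy
      exact continuousOn_const.mul (h1.sub continuousOn_const))
    (by simp only [hP0, sub_self, mul_zero])
    (fun y hy => mul_nonneg (inv_pos.2 hh0).le (sub_nonneg.2 (hmin _ hy))) hη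
    (fun y hy => sm_sc (W.sm _ (hPS y hy)))
    (fun y hy => by rw [hessDet_sc (W.sm _ (hPS y hy)).two hh0 hPd]; exact W.det _ (hPS y hy))
    (fun y hy z => by have := (abs_le.1 (hq0 y hy z)).1; linarith)
    (fun y hy z => by have := (abs_le.1 (hq0 y hy z)).2; linarith)
    (fun y hy => by
      have h1 := abs_le.1 (hclose _ (hPS y hy))
      have h2 := abs_le.1 (hclose 0 h0S)
      have e : h⁻¹ * (u (P y) - u 0) - (sc h (P : Euc n →L[ℝ] Euc n) w y - sc h (P : Euc n →L[ℝ] Euc n) w 0) =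
          h⁻¹ * ((u (P y) - w (P y)) - (u 0 - w 0)) := by
        have e1 : sc h (P : Euc n →L[ℝ] Euc n) w 0 = h⁻¹ * w (P 0) := rfl
        have e2 : sc h (P : Euc n →L[ℝ] Euc n) w y = h⁻¹ * w (P y) := rfl
        rw [e1, e2, hP0]; ring
      rw [e, abs_mul, abs_of_pos (inv_pos.2 hh0), inv_mul_le_iff₀ hh0, mul_div_cancel₀ _ hh0.ne', abs_le]
      constructor <;> linarith)
    (P ⁻¹' Sh)
    (by
      ext y
      refine ⟨fun hy => ⟨hShS hy, (hU y).2 ?_⟩, fun hy => ?_⟩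
      · have hy' : P y ∈ Sh := hy
        rw [hSh] at hy'; exact hy'
      · show P y ∈ Sh
        rw [hSh]; exact (hU y).1 hy.2)
    (by
      have h1 : ConvexOn ℝ (P ⁻¹' Sh) (fun y => ws (P y)) := hwsc.comp_linearMap (P : Euc n →ₗ[ℝ] Euc n)
      exact h1.smul (inv_pos.2 hh0).le)
    (fun y hy => sm_sc (sm_of_open hSho hwss _ hy))
    (by
      have e : closure (P ⁻¹' Sh) = P ⁻¹' closure Sh := (P.toHomeomorph.preimage_closure Sh).symm
      rw [e]
      have h1 : ContinuousOn (fun y => ws (P y)) (P ⁻¹' closure Sh) := hwscont.comp P.continuous.continuousOn fun y hy => hy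
      exact continuousOn_const.mul h1)
    (fun y hy => by rw [hessDet_sc (sm_of_open hSho hwss _ hy).two hh0 hPd]; exact hwsd _ hy)
    (fun y hy => by
      have e : frontier (P ⁻¹' Sh) = P ⁻¹' frontier Sh := (P.toHomeomorph.preimage_frontier Sh).symm
      rw [e] at hy
      have e1 : sc h (P : Euc n →L[ℝ] Euc n) ws y = h⁻¹ * ws (P y) := rfl
      rw [e1, hwsb _ hy, mul_zero])
  rw [hPf, hPf]
  refine ⟨?_, fun y hy => ⟨sm_sc (sm_of_open hSho hwss _ (key y hy).1), sm_sc (W.sm _ (hShS (key y hy).1)), (key y hy).2⟩⟩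
  ext i j
  have h0P : (P : Euc n →L[ℝ] Euc n) 0 = 0 := hP0
  rw [← qf_bas (hessianMatrix (sc h (P : Euc n →L[ℝ] Euc n) w) 0), qf_sc (by rw [h0P]; exact (W.sm 0 h0S).two), h0P]
  have := hPq (bas i) (bas j)
  rw [← qf_bas (1 : Mat n), qf_one]
  refine (congrArg (fun t => h⁻¹ * t) this).trans ?_
  rw [inv_mul_cancel_left₀ hh0.ne']

theorem main_thm (n : ℕ) (hn : 2 ≤ n) :
    ∃ C₄ hc C₅ C₆ : ℝ, 0 < C₄ ∧ C₄ ≤ 1 ∧ 0 < hc ∧ hc ≤ 1 / 5 ∧ 0 < C₅ ∧ 0 < C₆ ∧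
      ∀ (L : ℝ) (_ : 0 < L) (ξ : Euc n) (u g w : Euc n → ℝ) (δ : ℝ),
        StrictConvexOn ℝ (closure {z : Euc n | u z < u 0 + L}) u →
        ContDiffOn ℝ 2 u (closure {z : Euc n | u z < u 0 + L}) →
        Metric.ball ξ 1 ⊆ {z : Euc n | u z < u 0 + L} →
        {z : Euc n | u z < u 0 + L} ⊆ Metric.ball ξ (n : ℝ) →
        gradient u 0 = 0 →
        (∀ z ∈ frontier {z : Euc n | u z < u 0 + L}, u z = 0) →
        (∀ z ∈ {z : Euc n | u z < u 0 + L}, hessDet u z = g z ^ n) →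
        g 0 = 1 →
        (∀ z ∈ {z : Euc n | u z < u 0 + L}, |g z - 1| ≤ δ) →
        δ ≤ ((n : ℝ) ^ 2)⁻¹ / 5 →
        ConvexOn ℝ {z : Euc n | u z < u 0 + L} w →
        ContDiffOn ℝ (⊤ : ℕ∞) w {z : Euc n | u z < u 0 + L} →
        ContinuousOn w (closure {z : Euc n | u z < u 0 + L}) →
        (∀ z ∈ {z : Euc n | u z < u 0 + L}, hessDet w z = 1) →
        (∀ z ∈ frontier {z : Euc n | u z < u 0 + L}, w z = 0) →
        ∀ h : ℝ, 0 < h → h ≤ hc → δ ≤ min (C₄ * h) (((n : ℝ) ^ 2)⁻¹ / 5) →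
        ∀ R : Matrix (Fin n) (Fin n) ℝ, R.PosSemidef → R * R = hessianMatrix w 0 →
        ∀ ws : Euc n → ℝ,
          ConvexOn ℝ {z : Euc n | u z < u 0 + h} ws →
          ContDiffOn ℝ (⊤ : ℕ∞) ws {z : Euc n | u z < u 0 + h} →
          ContinuousOn ws (closure {z : Euc n | u z < u 0 + h}) →
          (∀ z ∈ {z : Euc n | u z < u 0 + h}, hessDet ws z = 1) →
          (∀ z ∈ frontier {z : Euc n | u z < u 0 + h}, ws z = 0) →
          matOpNorm
              (hessianMatrix (affFT ((h ^ (-(1 : ℝ) / 2)) • R) ws) 0 -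
                (1 : Matrix (Fin n) (Fin n) ℝ)) ≤ C₅ * δ / h ∧
          ∀ y ∈ Metric.ball (0 : Euc n) (1 / 4),
            ‖iteratedFDeriv ℝ 3
                (fun z => affFT ((h ^ (-(1 : ℝ) / 2)) • R) ws z -
                  affFT ((h ^ (-(1 : ℝ) / 2)) • R) w z) y‖ ≤ C₆ * δ / h := by
  have hn0 : n ≠ 0 := by omega
  have hnp : (0:ℝ) < n := by exact_mod_cast Nat.pos_of_ne_zero hn0
  obtain ⟨C₄, hc, X, h4, h41, hc0, hc5, hX, H⟩ := assembly hn
  refine ⟨C₄, hc, n ^ 4 * (X + 1), n ^ 5 * (X + 1), h4, h41, hc0, hc5, by positivity, by positivity, ?_⟩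
  intro L hL ξ u g w δ hsc hc2 hb1 hb2 hgrad hub hud hg0 hg hδn hwc hws hwcont hwd hwb h hh0 hhc hδh R hR hRR ws hsc' hss' hscont' hsd' hsb'
  have h0S : (0 : Euc n) ∈ {z : Euc n | u z < u 0 + L} := by show u 0 < u 0 + L; linarith
  have hδ0 : 0 ≤ δ := (abs_nonneg _).trans (hg 0 h0S)
  have hδ20 : δ ≤ 1 / 20 := by
    have hn2 : (2:ℝ) ≤ n := by exact_mod_cast hn
    have : ((n:ℝ) ^ 2)⁻¹ ≤ 4⁻¹ := inv_anti₀ (by norm_num) (by nlinarith)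
    linarith
  obtain ⟨hLz, hSo⟩ := section_open hn0 hsc hc2 hb1 hb2 hub fun z hz => by
    rw [hud z hz]
    have := (abs_le.1 (hg z hz)).1
    exact pow_ne_zero _ (by linarith)
  have hSc : Convex ℝ {z : Euc n | u z < u 0 + L} := by
    have h1 := hsc.convexOn.convex_lt (u 0 + L)
    have e : {x | x ∈ closure {z : Euc n | u z < u 0 + L} ∧ u x < u 0 + L} = {z : Euc n | u z < u 0 + L} := by
      ext x; exact ⟨fun hx => hx.2, fun hx => ⟨subset_closure hx, hx⟩⟩
    rwa [e] at h1
  have W : Sol {z : Euc n | u z < u 0 + L} ξ w := ⟨hSo, hSc, hb1, hb2, hwc, sm_of_open hSo hws, hwcont, hwd, hwb⟩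
  have hfu : fderiv ℝ u 0 = 0 := by
    unfold gradient at hgrad
    simpa using hgrad
  have hu2 : ∀ x ∈ {z : Euc n | u z < u 0 + L}, ContDiffAt ℝ 2 u x := fun x hx =>
    hc2.contDiffAt (mem_of_superset (hSo.mem_nhds hx) subset_closure)
  obtain ⟨hone, hest⟩ := H _ ξ u g w δ L W rfl hL hLz (hsc.convexOn.subset subset_closure hSc) hu2 hc2.continuousOn hub hud hg hδ0 hδ20 hfu h hh0 hhc
    (hδh.trans (min_le_left _ _)) R hR hRR ws _ rfl hsc' hss' hscont' hsd' hsb'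
  have hη0 : 0 ≤ (n : ℝ) ^ 2 * δ / h := by positivity
  have hB0 : 0 ≤ X * ((n : ℝ) ^ 2 * δ / h) := mul_nonneg hX hη0
  constructor
  · have h00 : (0 : Euc n) ∈ closedBall (0 : Euc n) (1 / 4) := mem_closedBall_self (by norm_num)
    obtain ⟨s1, s2, hI⟩ := hest 0 h00
    rw [← hone, ← hess_sub s1.two s2.two]
    refine (matOpNorm_le (B := X * (n ^ 2 * δ / h)) (fun i j => ?_) hB0).trans ?_
    · rw [hess_apply (s1.sub s2).two]
      exact hI [i, j] (by simp) (by simp)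
    · have e : (n : ℝ) ^ 4 * (X + 1) * δ / h = n ^ 2 * (X * (n ^ 2 * δ / h)) + n ^ 2 * (n ^ 2 * δ / h) := by ring
      rw [e]
      have : 0 ≤ (n : ℝ) ^ 2 * (n ^ 2 * δ / h) := by positivity
      linarith
  · intro y hy
    obtain ⟨s1, s2, hI⟩ := hest y (ball_subset_closedBall hy)
    refine (third_norm (s1.sub s2) (B := X * (n ^ 2 * δ / h)) (fun I hI3 => hI I (by omega) (by omega)) hB0).trans ?_
    have e : (n : ℝ) ^ 5 * (X + 1) * δ / h = n ^ 3 * (X * (n ^ 2 * δ / h)) + n ^ 3 * (n ^ 2 * δ / h) := by ring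
    rw [e]
    have : 0 ≤ (n : ℝ) ^ 3 * (n ^ 2 * δ / h) := by positivity
    linarith

end MA
end

/-- Third part of the perturbation lemma for sections: with the same set-up,
`T x = h^{−1/2}(D²w(0))^{1/2} x`, and `w♯` the convex solution of `det D²w♯ = 1` in
`S(u,h)` with zero boundary values, one has `|D²(F_T w♯)(0) − I| ≤ C₅ δ/h` and
`sup_{B_{1/4}} |D³(F_T w♯ − F_T w)| ≤ C₆ δ/h`. -/
theorem section_perturbation_transformed_solutions (n : ℕ) (hn : 2 ≤ n) :
    ∃ C₄ hc C₅ C₆ : ℝ, 0 < C₄ ∧ C₄ ≤ 1 ∧ 0 < hc ∧ hc ≤ 1 / 5 ∧ 0 < C₅ ∧ 0 < C₆ ∧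
      ∀ (L : ℝ) (_ : 0 < L) (ξ : Euc n) (u g w : Euc n → ℝ) (δ : ℝ),
        StrictConvexOn ℝ (closure {z : Euc n | u z < u 0 + L}) u →
        ContDiffOn ℝ 2 u (closure {z : Euc n | u z < u 0 + L}) →
        Metric.ball ξ 1 ⊆ {z : Euc n | u z < u 0 + L} →
        {z : Euc n | u z < u 0 + L} ⊆ Metric.ball ξ (n : ℝ) →
        gradient u 0 = 0 →
        (∀ z ∈ frontier {z : Euc n | u z < u 0 + L}, u z = 0) →
        (∀ z ∈ {z : Euc n | u z < u 0 + L}, hessDet u z = g z ^ n) →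
        g 0 = 1 →
        (∀ z ∈ {z : Euc n | u z < u 0 + L}, |g z - 1| ≤ δ) →
        δ ≤ ((n : ℝ) ^ 2)⁻¹ / 5 →
        ConvexOn ℝ {z : Euc n | u z < u 0 + L} w →
        ContDiffOn ℝ (⊤ : ℕ∞) w {z : Euc n | u z < u 0 + L} →
        ContinuousOn w (closure {z : Euc n | u z < u 0 + L}) →
        (∀ z ∈ {z : Euc n | u z < u 0 + L}, hessDet w z = 1) →
        (∀ z ∈ frontier {z : Euc n | u z < u 0 + L}, w z = 0) →
        ∀ h : ℝ, 0 < h → h ≤ hc → δ ≤ min (C₄ * h) (((n : ℝ) ^ 2)⁻¹ / 5) →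
        ∀ R : Matrix (Fin n) (Fin n) ℝ, R.PosSemidef → R * R = hessianMatrix w 0 →
        ∀ ws : Euc n → ℝ,
          ConvexOn ℝ {z : Euc n | u z < u 0 + h} ws →
          ContDiffOn ℝ (⊤ : ℕ∞) ws {z : Euc n | u z < u 0 + h} →
          ContinuousOn ws (closure {z : Euc n | u z < u 0 + h}) →
          (∀ z ∈ {z : Euc n | u z < u 0 + h}, hessDet ws z = 1) →
          (∀ z ∈ frontier {z : Euc n | u z < u 0 + h}, ws z = 0) →
          matOpNorm
              (hessianMatrix (affFT ((h ^ (-(1 : ℝ) / 2)) • R) ws) 0 -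
                (1 : Matrix (Fin n) (Fin n) ℝ)) ≤ C₅ * δ / h ∧
          ∀ y ∈ Metric.ball (0 : Euc n) (1 / 4),
            ‖iteratedFDeriv ℝ 3
                (fun z => affFT ((h ^ (-(1 : ℝ) / 2)) • R) ws z -
                  affFT ((h ^ (-(1 : ℝ) / 2)) • R) w z) y‖ ≤ C₆ * δ / h := by
  exact MA.main_thm n hn
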